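/- arXiv:math/9902133 — 5 statements merged into one kernel-verified Lean document; each statement's English description precedes it below -/
import Mathlib

section
/- Let k be an algebraically closed field of characteristic 0, let m be an odd positive integer, and let q ∈ k be a primitive m-th root of unity. Then deg M_q(n) = m^{n(n−1)/2}; equivalently, the supremum of dim_k V over all finite-dimensional irreducible M_q(n)-modules V equals m^{n(n−1)/2}. -/
open scoped BigOperators

/-- `p` is a polynomial identity of the ring `A`. -/
def IsPolyIdentity (A : Type) [Ring A] (p : FreeAlgebra ℤ ℕ) : Prop :=
  ∀ f : ℕ → A, FreeAlgebra.lift ℤ f p = 0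

/-- `A` has degree at most `d`: it satisfies all polynomial identities of `d × d`
matrices over commutative rings. -/
def DegLE (A : Type) [Ring A] (d : ℕ) : Prop :=
  ∀ p : FreeAlgebra ℤ ℕ,
    (∀ (R : Type) [CommRing R], IsPolyIdentity (Matrix (Fin d) (Fin d) R) p) →
    IsPolyIdentity A p

/-- `deg A = d`. -/
def HasDeg (A : Type) [Ring A] (d : ℕ) : Prop :=
  DegLE A d ∧ ∀ e : ℕ, DegLE A e → d ≤ e

/-- `A` satisfies a (nonzero) multilinear identity of degree `b`. -/
def SatisfiesMultilinearIdentity (A : Type) [Ring A] (b : ℕ) : Prop :=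
  ∃ c : Equiv.Perm (Fin b) → ℤ, c ≠ 0 ∧
    ∀ f : Fin b → A,
      ∑ σ : Equiv.Perm (Fin b), c σ • (List.ofFn fun i => f (σ i)).prod = 0

/-- The P.I. degree of `A`: half the smallest degree of a multilinear identity of `A`. -/
noncomputable def piDeg (A : Type) [Ring A] : ℕ :=
  sInf {b : ℕ | 0 < b ∧ SatisfiesMultilinearIdentity A b} / 2

/-- `A` is a P.I. algebra. -/
def IsPIAlgebra (A : Type) [Ring A] : Prop :=
  ∃ b : ℕ, 0 < b ∧ SatisfiesMultilinearIdentity A b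

/-- `A` is a prime ring. -/
def IsPrimeRing' (A : Type) [Ring A] : Prop :=
  ∀ a b : A, (∀ x : A, a * x * b = 0) → a = 0 ∨ b = 0

/-- A two-sided ideal is maximal. -/
def TwoSidedIdeal.IsMaximal' {A : Type} [Ring A] (I : TwoSidedIdeal A) : Prop :=
  I ≠ ⊤ ∧ ∀ J : TwoSidedIdeal A, I < J → J = ⊤

open scoped BigOperators

/-- Defining relations of the quantized matrix algebra `M_q(n,r)` (generators `Z (i,j)`). -/
inductive QMatRel (k : Type) [Field k] (q : k) (n r : ℕ) :
    FreeAlgebra k (Fin n × Fin r) → FreeAlgebra k (Fin n × Fin r) → Prop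
  | row (i : Fin n) (j l : Fin r) (h : j < l) :
      QMatRel k q n r (FreeAlgebra.ι k (i, j) * FreeAlgebra.ι k (i, l))
        (q • (FreeAlgebra.ι k (i, l) * FreeAlgebra.ι k (i, j)))
  | col (i s : Fin n) (j : Fin r) (h : i < s) :
      QMatRel k q n r (FreeAlgebra.ι k (i, j) * FreeAlgebra.ι k (s, j))
        (q • (FreeAlgebra.ι k (s, j) * FreeAlgebra.ι k (i, j)))
  | cross (i s : Fin n) (j l : Fin r) (h1 : i < s) (h2 : l < j) :
      QMatRel k q n r (FreeAlgebra.ι k (i, j) * FreeAlgebra.ι k (s, l))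
        (FreeAlgebra.ι k (s, l) * FreeAlgebra.ι k (i, j))
  | diag (i s : Fin n) (j l : Fin r) (h1 : i < s) (h2 : j < l) :
      QMatRel k q n r (FreeAlgebra.ι k (i, j) * FreeAlgebra.ι k (s, l))
        (FreeAlgebra.ι k (s, l) * FreeAlgebra.ι k (i, j) +
          (q - q⁻¹) • (FreeAlgebra.ι k (i, l) * FreeAlgebra.ι k (s, j)))

/-- The quantized matrix algebra `M_q(n,r)`. -/
abbrev QMat (k : Type) [Field k] (q : k) (n r : ℕ) : Type := RingQuot (QMatRel k q n r)

/-- The generator `Z_{i,j}` of `M_q(n,r)`. -/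
noncomputable def Zgen (k : Type) [Field k] (q : k) (n r : ℕ) (i : Fin n) (j : Fin r) :
    QMat k q n r :=
  RingQuot.mkAlgHom k (QMatRel k q n r) (FreeAlgebra.ι k (i, j))

/-- Number of inversions (the length) of a permutation. -/
def invCount {t : ℕ} (σ : Equiv.Perm (Fin t)) : ℕ :=
  (Finset.univ.filter (fun p : Fin t × Fin t => p.1 < p.2 ∧ σ p.2 < σ p.1)).card

/-- The `t × t` quantum minor on rows `row 0 < ... < row (t-1)` and columns
`col 0 < ... < col (t-1)`. -/
noncomputable def qMinor (k : Type) [Field k] (q : k) (n r : ℕ) (t : ℕ)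
    (row : Fin t → Fin n) (col : Fin t → Fin r) : QMat k q n r :=
  ∑ σ : Equiv.Perm (Fin t),
    ((-q) ^ invCount σ) • (List.ofFn fun a => Zgen k q n r (row a) (col (σ a))).prod

section SkewCommute

variable {R B : Type*} [CommRing R] [Ring B] [Algebra R B]

/-- `x` and `y` commute up to the scalar `a`. -/
def SkewCommute (a : R) (x y : B) : Prop := x * y = a • (y * x)

namespace SkewCommute

variable {a b : R} {x y z : B}

theorem add_left (hx : SkewCommute a x z) (hy : SkewCommute a y z) :
    SkewCommute a (x + y) z := by
  unfold SkewCommute at *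
  rw [add_mul, mul_add, smul_add, hx, hy]

theorem mul_left (hx : SkewCommute a x z) (hy : SkewCommute b y z) :
    SkewCommute (a * b) (x * y) z := by
  unfold SkewCommute at *
  rw [mul_assoc, hy, mul_smul_comm, ← mul_assoc, hx, smul_mul_assoc, smul_smul, mul_assoc,
    mul_comm b a]

theorem smul_left (c : R) (h : SkewCommute a x y) : SkewCommute a (c • x) y := by
  unfold SkewCommute at *
  rw [smul_mul_assoc, h, mul_smul_comm, smul_comm]

theorem smul_right (c : R) (h : SkewCommute a x y) : SkewCommute a x (c • y) := by
  unfold SkewCommute at *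
  rw [smul_mul_assoc, mul_smul_comm, h, smul_comm]

theorem symm (hab : a * b = 1) (h : SkewCommute a x y) : SkewCommute b y x := by
  unfold SkewCommute at *
  rw [h, smul_smul, mul_comm b a, hab, one_smul]

theorem inv_left {u : Bˣ} (hab : a * b = 1) (h : SkewCommute a (u : B) y) :
    SkewCommute b (↑u⁻¹ : B) y := by
  unfold SkewCommute at *
  have h' : y * (↑u⁻¹ : B) = a • ((↑u⁻¹ : B) * y) := by
    calc y * (↑u⁻¹ : B) = (↑u⁻¹ : B) * (u * y) * (↑u⁻¹ : B) := by
          rw [← mul_assoc, Units.inv_mul, one_mul]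
      _ = a • ((↑u⁻¹ : B) * y) := by
          rw [h, mul_smul_comm, smul_mul_assoc, mul_assoc, mul_assoc, Units.mul_inv, mul_one]
  rw [h', smul_smul, mul_comm b a, hab, one_smul]

end SkewCommute

theorem skewCommute_one_iff {x y : B} : SkewCommute (1 : R) x y ↔ x * y = y * x := by
  simp [SkewCommute]

end SkewCommute

section QuantumColumn

variable {R B : Type*} [CommRing R] [Ring B] [Algebra R B]

/-- The first `r` entries of `a` satisfy the relations of a column of a quantum matrix. -/
def IsQuantumColumn (q : R) (r : ℕ) (a : ℕ → B) : Prop :=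
  ∀ i k, i < k → k < r → SkewCommute q (a i) (a k)

/-- The first `r` entries of `a` and `b` satisfy the relations between two columns of a quantum
matrix, the column `a` being to the left of `b`. The inverse of `q` is passed as `q'`. -/
structure IsQuantumColumnPair (q q' : R) (r : ℕ) (a b : ℕ → B) : Prop where
  row : ∀ i, i < r → SkewCommute q (a i) (b i)
  cross : ∀ i k, i < k → k < r → a k * b i = b i * a k
  diag : ∀ i k, i < k → k < r → a i * b k = b k * a i + (q - q') • (b i * a k)

namespace IsQuantumColumnPair

variable {q q' : R} {r : ℕ} {a a' b b' : ℕ → B}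

theorem add_left (h : IsQuantumColumnPair q q' r a b) (h' : IsQuantumColumnPair q q' r a' b) :
    IsQuantumColumnPair q q' r (fun i => a i + a' i) b where
  row i hi := (h.row i hi).add_left (h'.row i hi)
  cross i k hik hk := by rw [add_mul, mul_add, h.cross i k hik hk, h'.cross i k hik hk]
  diag i k hik hk := by
    rw [add_mul, mul_add, mul_add, h.diag i k hik hk, h'.diag i k hik hk, smul_add]
    abel

theorem add_right (h : IsQuantumColumnPair q q' r a b) (h' : IsQuantumColumnPair q q' r a b') :
    IsQuantumColumnPair q q' r a (fun i => b i + b' i) where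
  row i hi := by
    have := h.row i hi
    have := h'.row i hi
    simp_all only [SkewCommute, add_mul, mul_add, smul_add]
  cross i k hik hk := by rw [add_mul, mul_add, h.cross i k hik hk, h'.cross i k hik hk]
  diag i k hik hk := by
    rw [add_mul, mul_add, add_mul, h.diag i k hik hk, h'.diag i k hik hk, smul_add]
    abel

theorem mul_left {g : B} (h : IsQuantumColumnPair q q' r a b)
    (hg : ∀ i, i < r → g * b i = b i * g) :
    IsQuantumColumnPair q q' r (fun i => a i * g) b where
  row i hi := by
    have := h.row i hi
    unfold SkewCommute at *
    rw [mul_assoc, hg i hi, ← mul_assoc, this, smul_mul_assoc, mul_assoc]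
  cross i k hik hk := by
    rw [mul_assoc, hg i (hik.trans hk), ← mul_assoc, h.cross i k hik hk, mul_assoc]
  diag i k hik hk := by
    rw [mul_assoc, hg k hk, ← mul_assoc, h.diag i k hik hk, add_mul, smul_mul_assoc, mul_assoc,
      mul_assoc]

theorem mul_right {g : B} (h : IsQuantumColumnPair q q' r a b)
    (hg : ∀ i, i < r → g * a i = a i * g) :
    IsQuantumColumnPair q q' r a (fun i => b i * g) where
  row i hi := by
    have := h.row i hi
    unfold SkewCommute at *
    rw [mul_assoc, hg i hi, ← mul_assoc, this, smul_mul_assoc, mul_assoc]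
  cross i k hik hk := by
    rw [mul_assoc, hg k hk, ← mul_assoc, h.cross i k hik hk, mul_assoc]
  diag i k hik hk := by
    rw [mul_assoc, mul_assoc, hg k hk, hg i (hik.trans hk), ← mul_assoc, h.diag i k hik hk,
      add_mul, smul_mul_assoc, mul_assoc, mul_assoc]

theorem of_isQuantumColumn {g : B} (hq : q * q' = 1) (hb : IsQuantumColumn q r b)
    (hg : ∀ i, i < r → SkewCommute q g (b i)) :
    IsQuantumColumnPair q q' r (fun i => b i * g) b := by
  have key : ∀ i k, k < r → b i * g * b k = q • (b i * b k * g) := fun i k hk => by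
    rw [mul_assoc, hg k hk, mul_smul_comm, mul_assoc]
  refine ⟨fun i hi => ?_, fun i k hik hk => ?_, fun i k hik hk => ?_⟩
  · rw [SkewCommute, key i i hi, mul_assoc]
  · rw [key k i (hik.trans hk), ← mul_assoc, hb i k hik hk, smul_mul_assoc]
  · rw [key i k hk, ← mul_assoc, ← mul_assoc, hb i k hik hk, smul_mul_assoc, smul_smul, smul_smul,
      mul_comm q q, sub_mul, mul_comm q' q, hq, sub_smul, one_smul]
    abel

end IsQuantumColumnPair

theorem IsQuantumColumn.add_mul {q q' : R} {r : ℕ} {a b : ℕ → B} {g : B} (hq : q * q' = 1)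
    (ha : IsQuantumColumn q r a) (hb : IsQuantumColumn q r b)
    (hab : IsQuantumColumnPair q q' r a b) (hga : ∀ i, i < r → SkewCommute q' g (a i))
    (hgb : ∀ i, i < r → SkewCommute q g (b i)) :
    IsQuantumColumn q r (fun i => a i + b i * g) := by
  intro i k hik hk
  have hi := hik.trans hk
  have e1 : b i * g * a k = q' • (b i * a k * g) := by
    rw [mul_assoc, hga k hk, mul_smul_comm, mul_assoc]
  have e2 : b i * g * (b k * g) = (q * q) • (b k * b i * g * g) := by
    rw [← mul_assoc, mul_assoc (b i), hgb k hk, mul_smul_comm, ← mul_assoc, hb i k hik hk]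
    simp only [smul_mul_assoc, smul_smul]
  have e3 : b k * g * a i = q' • (b k * a i * g) := by
    rw [mul_assoc, hga i hi, mul_smul_comm, mul_assoc]
  have e4 : b k * g * (b i * g) = q • (b k * b i * g * g) := by
    rw [← mul_assoc, mul_assoc (b k), hgb i hi, mul_smul_comm, ← mul_assoc]
    simp only [smul_mul_assoc]
  have e5 : a i * (b k * g) = b k * a i * g + (q - q') • (b i * a k * g) := by
    rw [← mul_assoc, hab.diag i k hik hk, _root_.add_mul, smul_mul_assoc]
  have e6 : a k * (b i * g) = b i * a k * g := by
    rw [← mul_assoc, hab.cross i k hik hk]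
  simp only [SkewCommute, _root_.add_mul, mul_add, e1, e2, e3, e4, e5, e6, smul_add, smul_smul, hq,
    one_smul, sub_smul]
  rw [ha i k hik hk]
  abel

end QuantumColumn

section ExtendRow

variable {R B : Type*} [CommRing R] [Ring B] [Algebra R B]

/-- Multiplication of a matrix, given by its columns, by a lower unitriangular matrix whose
entries are products of consecutive entries of `g`. -/
def extendRow (Y : ℕ → ℕ → B) (g : ℕ → B) : ℕ → ℕ → B
  | 0, i => Y 0 i
  | c + 1, i => Y (c + 1) i + extendRow Y g c i * g c

theorem skewCommute_extendRow {Y : ℕ → ℕ → B} {g : ℕ → B} {i : ℕ} {u : B} {a f : ℕ → R} (C : ℕ)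
    (hY : ∀ c, c ≤ C → SkewCommute (a c) (Y c i) u) (hg : ∀ c, c < C → SkewCommute (f c) (g c) u)
    (haf : ∀ c, c < C → a c * f c = a (c + 1)) :
    SkewCommute (a C) (extendRow Y g C i) u := by
  induction C with
  | zero => exact hY 0 le_rfl
  | succ C ih =>
    refine (hY _ le_rfl).add_left ?_
    rw [← haf C C.lt_succ_self]
    exact (ih (fun c hc => hY c (hc.trans C.le_succ)) (fun c hc => hg c (hc.trans C.lt_succ_self))
      fun c hc => haf c (hc.trans C.lt_succ_self)).mul_left (hg C C.lt_succ_self)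

/-- The ratio `τ • t c⁻¹ * t (c + 1)` of consecutive entries. -/
def stepRatio (τ : ℕ → R) (t : ℕ → Bˣ) (c : ℕ) : B := τ c • ((↑(t c)⁻¹ : B) * t (c + 1))

theorem skewCommute_stepRatio {τ : ℕ → R} {t : ℕ → Bˣ} {c : ℕ} {u : B} {a a' b : R}
    (haa : a * a' = 1) (h : SkewCommute a (t c : B) u) (h' : SkewCommute b (t (c + 1) : B) u) :
    SkewCommute (a' * b) (stepRatio τ t c) u :=
  ((h.inv_left haa).mul_left h').smul_left _

section

variable {q q' : R} {n r : ℕ} {Y : ℕ → ℕ → B} {t : ℕ → Bˣ} {τ : ℕ → R}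

theorem extendRow_commute_of_lt (hq : q * q' = 1)
    (ht : ∀ c d, c < d → d < n → SkewCommute q (t d : B) (t c : B))
    (hYc : ∀ i c d, i < r → c < n → d < n → c ≠ d → Y c i * t d = t d * Y c i)
    {i c d : ℕ} (hi : i < r) (hcd : c < d) (hd : d < n) :
    extendRow Y (stepRatio τ t) c i * t d = t d * extendRow Y (stepRatio τ t) c i := by
  have hq' : q' * q = 1 := by rw [mul_comm, hq]
  rw [← skewCommute_one_iff (R := R)]
  refine skewCommute_extendRow (a := fun _ => 1) (f := fun _ => q * q') c (fun e he => ?_)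
    (fun e he => ?_) (fun e he => by rw [hq, one_mul])
  · exact skewCommute_one_iff.2 (hYc i e d hi (by omega) hd (by omega))
  · exact skewCommute_stepRatio hq' ((ht _ _ (by omega) hd).symm hq)
      ((ht _ _ (by omega) hd).symm hq)

theorem skewCommute_extendRow_self (hq : q * q' = 1)
    (ht : ∀ c d, c < d → d < n → SkewCommute q (t d : B) (t c : B))
    (hYt : ∀ i c, i < r → c < n → SkewCommute q (Y c i) (t c : B))
    (hYc : ∀ i c d, i < r → c < n → d < n → c ≠ d → Y c i * t d = t d * Y c i)
    {i c : ℕ} (hi : i < r) (hc : c < n) :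
    SkewCommute q (extendRow Y (stepRatio τ t) c i) (t c : B) := by
  have hq' : q' * q = 1 := by rw [mul_comm, hq]
  cases c with
  | zero => exact hYt i 0 hi hc
  | succ c =>
    refine (hYt i _ hi hc).add_left ?_
    have h1 : SkewCommute (1 : R) (extendRow Y (stepRatio τ t) c i) (t (c + 1) : B) :=
      skewCommute_one_iff.2 (extendRow_commute_of_lt hq ht hYc hi c.lt_succ_self hc)
    have h2 : SkewCommute (q * 1) (stepRatio τ t c) (t (c + 1) : B) :=
      skewCommute_stepRatio hq' ((ht _ _ c.lt_succ_self hc).symm hq) (skewCommute_one_iff.2 rfl)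
    simpa using h1.mul_left h2

theorem extendRow_mul_of_lt (hq : q * q' = 1)
    (ht : ∀ c d, c < d → d < n → SkewCommute q (t d : B) (t c : B))
    (hYt : ∀ i c, i < r → c < n → SkewCommute q (Y c i) (t c : B))
    (hYc : ∀ i c d, i < r → c < n → d < n → c ≠ d → Y c i * t d = t d * Y c i)
    {x : ℕ → B} {lam : ℕ → R} (hx : ∀ c, x c = lam c • (t c : B))
    (hlam : ∀ c, lam (c + 1) = lam c * τ c)
    {i c d : ℕ} (hi : i < r) (hdc : d < c) (hc : c < n) :
    extendRow Y (stepRatio τ t) c i * x d = x d * extendRow Y (stepRatio τ t) c i +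
      (q - q') • (extendRow Y (stepRatio τ t) d i * x c) := by
  have hq' : q' * q = 1 := by rw [mul_comm, hq]
  have hxg : ∀ c, x c * stepRatio τ t c = x (c + 1) := fun c => by
    rw [hx, hx, stepRatio, hlam, smul_mul_assoc, mul_smul_comm, Units.mul_inv_cancel_left,
      smul_smul]
  have hYx : Y c i * x d = x d * Y c i := by
    rw [hx, mul_smul_comm, smul_mul_assoc, hYc i c d hi hc (by omega) (by omega)]
  induction c with
  | zero => omega
  | succ c ih =>
    rw [extendRow, add_mul, mul_add, hYx, add_assoc]
    congr 1
    obtain rfl | hlt := (Nat.le_of_lt_succ hdc).eq_or_lt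
    · have hg : stepRatio τ t d * x d = q • x (d + 1) := by
        have : SkewCommute (1 * q) (stepRatio τ t d) (x d) := by
          rw [hx]
          exact (skewCommute_stepRatio (one_mul 1) (skewCommute_one_iff.2 rfl)
            (ht _ _ d.lt_succ_self hc)).smul_right _
        rw [this, hxg, one_mul]
      have hZ : x d * extendRow Y (stepRatio τ t) d i =
          q' • (extendRow Y (stepRatio τ t) d i * x d) := by
        rw [hx]
        exact ((skewCommute_extendRow_self hq ht hYt hYc hi (by omega)).smul_right _).symm hq
      rw [mul_assoc, hg, ← mul_assoc, hZ, smul_mul_assoc, mul_assoc, hxg, mul_smul_comm, sub_smul]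
      abel
    · have hg : stepRatio τ t c * x d = x d * stepRatio τ t c := by
        rw [← skewCommute_one_iff (R := R), ← hq', hx]
        exact (skewCommute_stepRatio hq (ht _ _ hlt (by omega)) (ht _ _ (by omega) hc)).smul_right _
      rw [mul_assoc, hg, ← mul_assoc, ih hlt (by omega)
        (by rw [hx, mul_smul_comm, smul_mul_assoc, hYc i c d hi (by omega) (by omega) (by omega)]),
        add_mul, smul_mul_assoc, mul_assoc, mul_assoc _ (x c), hxg]

theorem isQuantumColumnPair_extendRow_right
    (hYc : ∀ i c d, i < r → c < n → d < n → c ≠ d → Y c i * t d = t d * Y c i)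
    (hpair : ∀ c d, c < d → d < n → IsQuantumColumnPair q q' r (Y d) (Y c))
    {c d : ℕ} (hcd : c < d) (hd : d < n) :
    IsQuantumColumnPair q q' r (Y d) (extendRow Y (stepRatio τ t) c) := by
  induction c with
  | zero => exact hpair 0 d hcd hd
  | succ c ih =>
    refine (hpair _ _ hcd hd).add_right ((ih (by omega)).mul_right fun i hi => ?_)
    rw [← skewCommute_one_iff (R := R), ← one_mul (1 : R)]
    exact skewCommute_stepRatio (one_mul 1)
      (skewCommute_one_iff.2 (hYc i d c hi hd (by omega) (by omega)).symm)
      (skewCommute_one_iff.2 (hYc i d (c + 1) hi hd (by omega) (by omega)).symm)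

theorem isQuantumColumn_extendRow (hq : q * q' = 1)
    (ht : ∀ c d, c < d → d < n → SkewCommute q (t d : B) (t c : B))
    (hYt : ∀ i c, i < r → c < n → SkewCommute q (Y c i) (t c : B))
    (hYc : ∀ i c d, i < r → c < n → d < n → c ≠ d → Y c i * t d = t d * Y c i)
    (hcol : ∀ c, c < n → IsQuantumColumn q r (Y c))
    (hpair : ∀ c d, c < d → d < n → IsQuantumColumnPair q q' r (Y d) (Y c))
    {c : ℕ} (hc : c < n) :
    IsQuantumColumn q r (extendRow Y (stepRatio τ t) c) := by
  have hq' : q' * q = 1 := by rw [mul_comm, hq]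
  induction c with
  | zero => exact hcol 0 hc
  | succ c ih =>
    refine (hcol _ hc).add_mul hq (ih (by omega))
      (isQuantumColumnPair_extendRow_right hYc hpair c.lt_succ_self hc)
      (fun i hi => ?_) (fun i hi => ?_)
    · rw [← one_mul q']
      exact skewCommute_stepRatio (one_mul 1)
        (skewCommute_one_iff.2 (hYc i _ c hi hc (by omega) (by omega)).symm)
        ((hYt i _ hi hc).symm hq)
    · rw [← mul_one q]
      exact skewCommute_stepRatio hq'
        ((skewCommute_extendRow_self hq ht hYt hYc hi (by omega)).symm hq)
        (skewCommute_one_iff.2 (extendRow_commute_of_lt hq ht hYc hi c.lt_succ_self hc).symm)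

theorem isQuantumColumnPair_extendRow (hq : q * q' = 1)
    (ht : ∀ c d, c < d → d < n → SkewCommute q (t d : B) (t c : B))
    (hYt : ∀ i c, i < r → c < n → SkewCommute q (Y c i) (t c : B))
    (hYc : ∀ i c d, i < r → c < n → d < n → c ≠ d → Y c i * t d = t d * Y c i)
    (hcol : ∀ c, c < n → IsQuantumColumn q r (Y c))
    (hpair : ∀ c d, c < d → d < n → IsQuantumColumnPair q q' r (Y d) (Y c))
    {c d : ℕ} (hcd : c < d) (hd : d < n) :
    IsQuantumColumnPair q q' r (extendRow Y (stepRatio τ t) d)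
      (extendRow Y (stepRatio τ t) c) := by
  have hq' : q' * q = 1 := by rw [mul_comm, hq]
  induction d with
  | zero => omega
  | succ d ih =>
    refine (isQuantumColumnPair_extendRow_right hYc hpair hcd hd).add_left ?_
    obtain rfl | hlt := (Nat.le_of_lt_succ hcd).eq_or_lt
    · refine .of_isQuantumColumn hq
        (isQuantumColumn_extendRow hq ht hYt hYc hcol hpair (by omega)) fun i hi => ?_
      rw [← mul_one q]
      exact skewCommute_stepRatio hq'
        ((skewCommute_extendRow_self hq ht hYt hYc hi (by omega)).symm hq)
        (skewCommute_one_iff.2 (extendRow_commute_of_lt hq ht hYc hi c.lt_succ_self hd).symm)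
    · refine (ih hlt (by omega)).mul_left fun i hi => ?_
      rw [← skewCommute_one_iff (R := R), ← one_mul (1 : R)]
      exact skewCommute_stepRatio (one_mul 1)
        (skewCommute_one_iff.2 (extendRow_commute_of_lt hq ht hYc hi hlt (by omega)).symm)
        (skewCommute_one_iff.2 (extendRow_commute_of_lt hq ht hYc hi hcd hd).symm)

end

end ExtendRow

section TorusMatrix

variable {R B : Type*} [CommRing R] [Ring B] [Algebra R B]

/-- The relations of the quantum torus of `n × n` matrices, the columns being numbered from right
to left. -/
structure IsQuantumTorus (q : R) (n : ℕ) (T : ℕ → ℕ → Bˣ) : Prop where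
  row : ∀ i c d, i < n → c < d → d < n → SkewCommute q (T i d : B) (T i c : B)
  col : ∀ i s c, i < s → s < n → c < n → SkewCommute q (T i c : B) (T s c : B)
  comm : ∀ i s c d, i < n → s < n → c < n → d < n → i ≠ s → c ≠ d →
    (T i c : B) * T s d = T s d * T i c

/-- The quantum matrix with `r` rows built from the quantum torus `T` by adjoining one row after
the other; the arguments after `r` are the column (counted from the right) and the row. -/
def torusMatrix (T : ℕ → ℕ → Bˣ) (lam τ : ℕ → ℕ → R) : ℕ → ℕ → ℕ → B
  | 0, _, _ => 0
  | r + 1, c, i => if i = r then lam r c • (T r c : B) else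
      extendRow (torusMatrix T lam τ r) (stepRatio (τ r) (T r)) c i

variable {q q' : R} {n : ℕ} {T : ℕ → ℕ → Bˣ} {lam τ : ℕ → ℕ → R}

theorem torusMatrix_succ_self (r c : ℕ) :
    torusMatrix T lam τ (r + 1) c r = lam r c • (T r c : B) := by
  simp [torusMatrix]

theorem torusMatrix_succ_of_lt {r i : ℕ} (c : ℕ) (hi : i < r) :
    torusMatrix T lam τ (r + 1) c i =
      extendRow (torusMatrix T lam τ r) (stepRatio (τ r) (T r)) c i := by
  simp [torusMatrix, hi.ne]

/-- The induction invariant for `torusMatrix`: its first `r` rows form a quantum matrix whose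
entries skew commute with the rows of the torus that have not been used. -/
structure IsPartialQuantumMatrix (q q' : R) (n r : ℕ) (T : ℕ → ℕ → Bˣ) (Z : ℕ → ℕ → B) :
    Prop where
  column : ∀ c, c < n → IsQuantumColumn q r (Z c)
  pair : ∀ c d, c < d → d < n → IsQuantumColumnPair q q' r (Z d) (Z c)
  skew : ∀ i c s, i < r → c < n → r ≤ s → s < n → SkewCommute q (Z c i) (T s c : B)
  comm : ∀ i c d s, i < r → c < n → d < n → r ≤ s → s < n → c ≠ d →
    Z c i * T s d = T s d * Z c i

theorem isPartialQuantumMatrix_torusMatrix (hq : q * q' = 1) (hT : IsQuantumTorus q n T)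
    (hlam : ∀ r c, lam r (c + 1) = lam r c * τ r c) {r : ℕ} (hr : r ≤ n) :
    IsPartialQuantumMatrix q q' n r T (torusMatrix T lam τ r) := by
  have hq' : q' * q = 1 := by rw [mul_comm, hq]
  induction r with
  | zero =>
    refine ⟨?_, fun c d _ _ => ⟨?_, ?_, ?_⟩, ?_, ?_⟩ <;> intros <;> simp_all [IsQuantumColumn]
  | succ r ih =>
    have H := ih (by omega)
    set Y := torusMatrix T lam τ r
    have ht : ∀ c d, c < d → d < n → SkewCommute q (T r d : B) (T r c : B) :=
      fun c d hcd hd => hT.row r c d hr hcd hd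
    have hYt : ∀ i c, i < r → c < n → SkewCommute q (Y c i) (T r c : B) :=
      fun i c hi hc => H.skew i c r hi hc le_rfl hr
    have hYc : ∀ i c d, i < r → c < n → d < n → c ≠ d → Y c i * T r d = T r d * Y c i :=
      fun i c d hi hc hd hcd => H.comm i c d r hi hc hd le_rfl hr hcd
    have hZr := torusMatrix_succ_self (T := T) (lam := lam) (τ := τ) r
    have hZ : ∀ {i : ℕ} (c : ℕ), i < r → torusMatrix T lam τ (r + 1) c i =
      extendRow Y (stepRatio (τ r) (T r)) c i := fun c hi => torusMatrix_succ_of_lt c hi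
    refine ⟨fun c hc i k hik hk => ?_, fun c d hcd hd => ⟨fun i hi => ?_, fun i k hik hk => ?_,
      fun i k hik hk => ?_⟩, fun i c s hi hc hs hsn => ?_, fun i c d s hi hc hd hs hsn hcd => ?_⟩
    · obtain rfl | hkr := (Nat.le_of_lt_succ hk).eq_or_lt
      · rw [hZr, hZ c hik]
        exact (skewCommute_extendRow_self hq ht hYt hYc hik hc).smul_right _
      · rw [hZ c (hik.trans hkr), hZ c hkr]
        exact isQuantumColumn_extendRow hq ht hYt hYc H.column H.pair hc i k hik hkr
    · obtain rfl | hir := (Nat.le_of_lt_succ hi).eq_or_lt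
      · rw [hZr, hZr]
        exact ((ht c d hcd hd).smul_left _).smul_right _
      · rw [hZ d hir, hZ c hir]
        exact (isQuantumColumnPair_extendRow hq ht hYt hYc H.column H.pair hcd hd).row i hir
    · obtain rfl | hkr := (Nat.le_of_lt_succ hk).eq_or_lt
      · rw [hZr, hZ c hik, smul_mul_assoc, mul_smul_comm,
          extendRow_commute_of_lt hq ht hYc hik hcd hd]
      · rw [hZ d hkr, hZ c (hik.trans hkr)]
        exact (isQuantumColumnPair_extendRow hq ht hYt hYc H.column H.pair hcd hd).cross
          i k hik hkr
    · obtain rfl | hkr := (Nat.le_of_lt_succ hk).eq_or_lt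
      · rw [hZ d hik, hZ c hik]
        exact extendRow_mul_of_lt hq ht hYt hYc hZr (hlam k) hik hcd hd
      · rw [hZ d (hik.trans hkr), hZ c hkr, hZ d hkr, hZ c (hik.trans hkr)]
        exact (isQuantumColumnPair_extendRow hq ht hYt hYc H.column H.pair hcd hd).diag
          i k hik hkr
    · obtain rfl | hir := (Nat.le_of_lt_succ hi).eq_or_lt
      · rw [hZr]
        exact (hT.col i s c hs hsn hc).smul_left _
      · rw [hZ c hir]
        have := skewCommute_extendRow (Y := Y) (g := stepRatio (τ r) (T r)) (i := i)
          (u := (T s c : B)) (a := fun e => if e = c then q else 1)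
          (f := fun e => if e + 1 = c then q else 1) c (fun e he => ?_) (fun e he => ?_)
          (fun e he => ?_)
        · simpa using this
        · split_ifs with h
          · subst h
            exact H.skew i e s hir hc (by omega) hsn
          · exact skewCommute_one_iff.2 (H.comm i e c s hir (by omega) hc (by omega) hsn h)
        · have h1 : SkewCommute (1 : R) (T r e : B) (T s c : B) := skewCommute_one_iff.2
            (hT.comm r s e c hr hsn (by omega) hc (by omega) he.ne)
          split_ifs with h
          · subst h
            rw [← one_mul q]
            exact skewCommute_stepRatio (one_mul 1) h1 (hT.col r s _ hs hsn hc)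
          · rw [← one_mul (1 : R)]
            exact skewCommute_stepRatio (one_mul 1) h1 (skewCommute_one_iff.2
              (hT.comm r s _ c hr hsn (by omega) hc (by omega) h))
        · simp [he.ne]
    · obtain rfl | hir := (Nat.le_of_lt_succ hi).eq_or_lt
      · rw [hZr, smul_mul_assoc, mul_smul_comm,
          hT.comm i s c d hr hsn hc hd (by omega) hcd]
      · rw [hZ c hir]
        have hT' : ∀ e, e < n → SkewCommute (if e = d then q else (1 : R)) (T r e : B)
            (T s d : B) := fun e he => by
          split_ifs with h
          · subst h
            exact hT.col r s e hs hsn he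
          · exact skewCommute_one_iff.2 (hT.comm r s e d hr hsn he hd (by omega) h)
        have := skewCommute_extendRow (Y := Y) (g := stepRatio (τ r) (T r)) (i := i)
          (u := (T s d : B)) (a := fun e => if e = d then q else 1)
          (f := fun e => (if e = d then q' else 1) * (if e + 1 = d then q else 1)) c
          (fun e he => ?_) (fun e he => ?_) (fun e he => ?_)
        · rw [← skewCommute_one_iff (R := R)]
          simpa [hcd] using this
        · split_ifs with h
          · subst h
            exact H.skew i e s hir hd (by omega) hsn
          · exact skewCommute_one_iff.2 (H.comm i e d s hir (by omega) hd (by omega) hsn h)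
        · refine skewCommute_stepRatio ?_ (hT' e (by omega)) (hT' (e + 1) (by omega))
          split_ifs <;> simp [hq]
        · rw [← mul_assoc]
          split_ifs <;> simp [hq]

end TorusMatrix

section TorusHom

variable {k : Type} [Field k] {q : k} {n : ℕ} {R B : Type*} [CommRing R] [Algebra k R] [Ring B]
  [Algebra R B] [Algebra k B] [IsScalarTower k R B] {T : ℕ → ℕ → Bˣ} {lam τ : ℕ → ℕ → R}

/-- The homomorphism from the quantized matrix algebra given by `torusMatrix`. -/
noncomputable def torusHom (hq0 : q ≠ 0) (hT : IsQuantumTorus (algebraMap k R q) n T)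
    (hlam : ∀ r c, lam r (c + 1) = lam r c * τ r c) : QMat k q n n →ₐ[k] B :=
  RingQuot.liftAlgHom k (s := QMatRel k q n n)
    ⟨FreeAlgebra.lift k fun x : Fin n × Fin n => torusMatrix T lam τ n (n - 1 - x.2) x.1, by
      have H := isPartialQuantumMatrix_torusMatrix (q' := algebraMap k R q⁻¹)
        (by rw [← map_mul, mul_inv_cancel₀ hq0, map_one]) hT hlam le_rfl
      intro x y hxy
      induction hxy with
      | row i j l h =>
        have := (H.pair (n - 1 - l) (n - 1 - j) (by omega) (by omega)).row i i.2
        simpa [SkewCommute, algebraMap_smul] using this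
      | col i s j h =>
        have := H.column (n - 1 - j) (by omega) i s h s.2
        simpa [SkewCommute, algebraMap_smul] using this
      | cross i s j l h1 h2 =>
        have := (H.pair (n - 1 - j) (n - 1 - l) (by omega) (by omega)).cross i s h1 s.2
        simpa using this.symm
      | diag i s j l h1 h2 =>
        have := (H.pair (n - 1 - l) (n - 1 - j) (by omega) (by omega)).diag i s h1 s.2
        rw [← map_sub, algebraMap_smul] at this
        simpa using this⟩

theorem torusHom_Zgen (hq0 : q ≠ 0) (hT : IsQuantumTorus (algebraMap k R q) n T)
    (hlam : ∀ r c, lam r (c + 1) = lam r c * τ r c) (i j : Fin n) :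
    torusHom hq0 hT hlam (Zgen k q n n i j) = torusMatrix T lam τ n (n - 1 - j) i := by
  simp [torusHom, Zgen]

end TorusHom

section Spanning

variable {k : Type} [Field k] {q : k} {n : ℕ}

theorem adjoin_range_Zgen :
    Algebra.adjoin k (Set.range fun x : Fin n × Fin n => Zgen k q n n x.1 x.2) = ⊤ := by
  have h : (fun x : Fin n × Fin n => Zgen k q n n x.1 x.2) =
      RingQuot.mkAlgHom k (QMatRel k q n n) ∘ FreeAlgebra.ι k := rfl
  rw [h, Set.range_comp, ← AlgHom.map_adjoin, FreeAlgebra.adjoin_range_ι, Algebra.map_top,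
    AlgHom.range_eq_top]
  exact RingQuot.mkAlgHom_surjective k _

theorem Zgen_row (i : Fin n) {j l : Fin n} (h : j < l) :
    Zgen k q n n i j * Zgen k q n n i l = q • (Zgen k q n n i l * Zgen k q n n i j) := by
  simpa [Zgen] using RingQuot.mkAlgHom_rel k (QMatRel.row (q := q) i j l h)

theorem Zgen_col {i s : Fin n} (j : Fin n) (h : i < s) :
    Zgen k q n n i j * Zgen k q n n s j = q • (Zgen k q n n s j * Zgen k q n n i j) := by
  simpa [Zgen] using RingQuot.mkAlgHom_rel k (QMatRel.col (q := q) i s j h)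

theorem Zgen_cross {i s j l : Fin n} (h : i < s) (h' : l < j) :
    Zgen k q n n i j * Zgen k q n n s l = Zgen k q n n s l * Zgen k q n n i j := by
  simpa [Zgen] using RingQuot.mkAlgHom_rel k (QMatRel.cross (q := q) i s j l h h')

theorem Zgen_diag {i s j l : Fin n} (h : i < s) (h' : j < l) :
    Zgen k q n n i j * Zgen k q n n s l = Zgen k q n n s l * Zgen k q n n i j +
      (q - q⁻¹) • (Zgen k q n n i l * Zgen k q n n s j) := by
  simpa [Zgen] using RingQuot.mkAlgHom_rel k (QMatRel.diag (q := q) i s j l h h')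

theorem eq_one_smul_add_neg_smul {B : Type*} [Ring B] [Algebra k B] {x y z : B} {c : k}
    (h : x = y + c • z) : y = (1 : k) • x + (-c) • z := by
  rw [h, one_smul, neg_smul]
  abel

theorem exists_Zgen_mul_Zgen (hq : q ≠ 0) {a b : Fin n × Fin n}
    (hab : finProdFinEquiv b < finProdFinEquiv a) :
    ∃ (α β : k) (c d : Fin n × Fin n), finProdFinEquiv c < finProdFinEquiv a ∧
      Zgen k q n n a.1 a.2 * Zgen k q n n b.1 b.2 =
        α • (Zgen k q n n b.1 b.2 * Zgen k q n n a.1 a.2) +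
          β • (Zgen k q n n c.1 c.2 * Zgen k q n n d.1 d.2) := by
  obtain ⟨s, t⟩ := a
  obtain ⟨i, j⟩ := b
  have hlex : ∀ i s j t : Fin n, i < s →
      finProdFinEquiv ((i, j) : Fin n × Fin n) < finProdFinEquiv (s, t) := by
    intro i s j t h
    rw [Fin.lt_def] at h ⊢
    simp only [finProdFinEquiv_apply_val]
    have : n * (i + 1 : ℕ) ≤ n * s := Nat.mul_le_mul_left n h
    have := j.2
    rw [mul_add] at *
    omega
  have key : ∀ x y : QMat k q n n, x * y = q • (y * x) → y * x = q⁻¹ • (x * y) := by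
    intro x y h
    rw [h, smul_smul, inv_mul_cancel₀ hq, one_smul]
  rcases lt_trichotomy i s with h | rfl | h
  · rcases lt_trichotomy j t with h' | rfl | h'
    · refine ⟨1, -(q - q⁻¹), (i, t), (s, j), hlex _ _ _ _ h, ?_⟩
      have e := eq_one_smul_add_neg_smul (k := k) (B := QMat k q n n) (Zgen_diag h h')
      exact e
    · exact ⟨q⁻¹, 0, (i, j), (i, j), hab, by rw [key _ _ (Zgen_col j h), zero_smul, add_zero]⟩
    · exact ⟨1, 0, (i, j), (i, j), hab, by rw [Zgen_cross h h', one_smul, zero_smul, add_zero]⟩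
  · have h' : j < t := by
      rw [Fin.lt_def] at hab ⊢
      simp only [finProdFinEquiv_apply_val] at hab
      omega
    exact ⟨q⁻¹, 0, (i, j), (i, j), hab, by rw [key _ _ (Zgen_row i h'), zero_smul, add_zero]⟩
  · exact absurd (hlex _ _ t j h) hab.asymm

/-- The product of the generators along a word. -/
noncomputable def wordProd (k : Type) [Field k] (q : k) (n : ℕ) (w : List (Fin n × Fin n)) :
    QMat k q n n :=
  (w.map fun x => Zgen k q n n x.1 x.2).prod

/-- The words whose letters increase weakly in the lexicographic order. -/
def IsSortedWord {n : ℕ} (w : List (Fin n × Fin n)) : Prop :=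
  w.Pairwise fun x y => finProdFinEquiv x ≤ finProdFinEquiv y

theorem exists_descent_of_not_isSortedWord {w : List (Fin n × Fin n)} (hw : ¬ IsSortedWord w) :
    ∃ u a b v, w = u ++ a :: b :: v ∧ finProdFinEquiv b < finProdFinEquiv a := by
  induction w with
  | nil => exact absurd List.Pairwise.nil hw
  | cons x w ih =>
    by_cases h : IsSortedWord w
    · cases w with
      | nil => exact absurd (List.pairwise_singleton _ _) hw
      | cons y w =>
        refine ⟨[], x, y, w, rfl, ?_⟩
        by_contra! hle
        refine hw (List.pairwise_cons.2 ⟨fun z hz => ?_, h⟩)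
        rcases List.mem_cons.1 hz with rfl | hz
        · exact hle
        · exact hle.trans (List.rel_of_pairwise_cons h hz)
    · obtain ⟨u, a, b, v, rfl, hab⟩ := ih h
      exact ⟨x :: u, a, b, v, rfl, hab⟩

/-- The number whose base `n * n` digits are the letters of the word. -/
def wordCode {n : ℕ} (w : List (Fin n × Fin n)) : ℕ :=
  Nat.ofDigits (n * n) (w.reverse.map fun x => (finProdFinEquiv x : ℕ))

theorem wordCode_lt {u v : List (Fin n × Fin n)} {a b c d : Fin n × Fin n}
    (h : finProdFinEquiv c < finProdFinEquiv a) :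
    wordCode (u ++ c :: d :: v) < wordCode (u ++ a :: b :: v) := by
  have hn : 0 < n * n := (Nat.zero_le _).trans_lt (finProdFinEquiv a).2
  have hd := (finProdFinEquiv d).2
  have key : (finProdFinEquiv d : ℕ) + n * n * finProdFinEquiv c <
      finProdFinEquiv b + n * n * finProdFinEquiv a := by
    have : n * n * (finProdFinEquiv c + 1 : ℕ) ≤ n * n * finProdFinEquiv a :=
      Nat.mul_le_mul_left _ h
    rw [mul_add] at this
    omega
  have e : ∀ x y : Fin n × Fin n, wordCode (u ++ x :: y :: v) = wordCode v +
      (n * n) ^ v.length * ((finProdFinEquiv y + n * n * finProdFinEquiv x : ℕ) +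
        (n * n) ^ 2 * wordCode u) := by
    intro x y
    simp only [wordCode, List.reverse_append, List.reverse_cons, List.map_append, List.map_cons,
      List.map_nil, List.append_assoc, Nat.ofDigits_append, Nat.ofDigits_singleton,
      List.length_map, List.length_reverse, List.length_singleton]
    ring
  rw [e, e]
  exact Nat.add_lt_add_left (Nat.mul_lt_mul_of_pos_left (Nat.add_lt_add_right key _)
    (pow_pos hn _)) _

theorem wordProd_mem_span_sorted (hq : q ≠ 0) (w : List (Fin n × Fin n)) :
    wordProd k q n w ∈ Submodule.span k (Set.image (wordProd k q n) {w | IsSortedWord w}) := by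
  induction h : wordCode w using Nat.strong_induction_on generalizing w with
  | h N ih =>
    by_cases hw : IsSortedWord w
    · exact Submodule.subset_span ⟨w, hw, rfl⟩
    · obtain ⟨u, a, b, v, rfl, hab⟩ := exists_descent_of_not_isSortedWord hw
      obtain ⟨α, β, c, d, hc, e⟩ := exists_Zgen_mul_Zgen hq hab
      have key : wordProd k q n (u ++ a :: b :: v) = α • wordProd k q n (u ++ b :: a :: v) +
          β • wordProd k q n (u ++ c :: d :: v) := by
        simp only [wordProd, List.map_append, List.map_cons, List.prod_append, List.prod_cons]
        rw [← mul_assoc (Zgen k q n n a.1 a.2), e]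
        simp only [add_mul, mul_add, smul_mul_assoc, mul_smul_comm, mul_assoc]
      rw [key]
      exact add_mem (Submodule.smul_mem _ _ (ih _ (h ▸ wordCode_lt hab) _ rfl))
        (Submodule.smul_mem _ _ (ih _ (h ▸ wordCode_lt hc) _ rfl))

theorem span_sorted_wordProd (hq : q ≠ 0) :
    Submodule.span k (Set.image (wordProd k q n) {w | IsSortedWord w}) = ⊤ := by
  rw [eq_top_iff, ← Algebra.top_toSubmodule, ← adjoin_range_Zgen, Algebra.adjoin_eq_span,
    Submodule.span_le]
  intro x hx
  obtain ⟨l, hl, rfl⟩ := Submonoid.exists_list_of_mem_closure hx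
  have : ∃ w : List (Fin n × Fin n), l = w.map fun x => Zgen k q n n x.1 x.2 := by
    have : l ∈ Set.range (List.map fun x : Fin n × Fin n => Zgen k q n n x.1 x.2) := by
      rw [Set.range_list_map]
      exact hl
    obtain ⟨w, hw⟩ := this
    exact ⟨w, hw.symm⟩
  obtain ⟨w, rfl⟩ := this
  exact wordProd_mem_span_sorted hq w

end Spanning

section Weyl

variable {D K : Type*} [AddCommGroup D] [DecidableEq D] [CommRing K]

/-- The translation by `s` followed by multiplication with the function `f`. -/
def weylMatrix (s : D) (f : D → K) : Matrix D D K := fun a b => if a = b + s then f a else 0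

theorem weylMatrix_mul [Fintype D] (s t : D) (f g : D → K) :
    weylMatrix s f * weylMatrix t g = weylMatrix (s + t) fun a => f a * g (a - s) := by
  ext a b
  rw [Matrix.mul_apply, Finset.sum_eq_single (a - s)]
  · simp only [weylMatrix, sub_add_cancel, if_true, mul_ite, mul_zero]
    refine if_congr ?_ rfl rfl
    rw [sub_eq_iff_eq_add, add_assoc, add_comm t]
  · intro c _ hc
    have : ¬ a = c + s := fun h => hc (by rw [h, add_sub_cancel_right])
    simp [weylMatrix, this]
  · simp

theorem weylMatrix_zero_one : weylMatrix (0 : D) (fun _ => (1 : K)) = 1 := by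
  ext a b
  simp [weylMatrix, Matrix.one_apply]

/-- `weylMatrix` as a unit. -/
def weylUnit [Fintype D] (s : D) (f : D → Kˣ) : (Matrix D D K)ˣ where
  val := weylMatrix s fun a => f a
  inv := weylMatrix (-s) fun a => ↑(f (a + s))⁻¹
  val_inv := by
    rw [weylMatrix_mul, ← weylMatrix_zero_one]
    simp
  inv_val := by
    rw [weylMatrix_mul, ← weylMatrix_zero_one]
    simp

theorem skewCommute_weylUnit [Fintype D] {s t : D} {f g : D → Kˣ} {a : K}
    (h : ∀ x, (f x : K) * g (x - s) = a * (g x * f (x - t))) :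
    SkewCommute a (weylUnit s f : Matrix D D K) (weylUnit t g) := by
  rw [SkewCommute]
  ext x y
  simp only [weylUnit, weylMatrix_mul, Matrix.smul_apply, weylMatrix, h, add_comm t s]
  split_ifs <;> simp

end Weyl

section Antisymm

variable {m n : ℕ}

/-- The antisymmetric functions on pairs. -/
def AntisymmFun (m n : ℕ) : AddSubgroup (Fin n × Fin n → ZMod m) where
  carrier := {v | ∀ x, v x.swap = -v x}
  zero_mem' := by simp
  add_mem' := fun {u v} hu hv x => by
    simp only [Set.mem_ofPred_eq] at hu hv
    simp [hu x, hv x, add_comm]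
  neg_mem' := fun {u} hu x => by
    simp only [Set.mem_ofPred_eq] at hu
    simp [hu x]

theorem antisymmFun_apply_swap (v : AntisymmFun m n) (x : Fin n × Fin n) : v.1 x.swap = -v.1 x :=
  v.2 x

noncomputable instance [NeZero m] : Fintype (AntisymmFun m n) := Fintype.ofFinite _

theorem ZMod.isUnit_two_of_odd (hm : Odd m) : IsUnit (2 : ZMod m) := by
  have := (ZMod.isUnit_iff_coprime 2 m).2 (Nat.coprime_two_left.2 hm)
  simpa using this

theorem antisymmFun_apply_diag (hm : Odd m) (v : AntisymmFun m n) (i : Fin n) : v.1 (i, i) = 0 := by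
  have h := antisymmFun_apply_swap v (i, i)
  rw [Prod.swap_prod_mk, eq_neg_iff_add_eq_zero, ← two_mul] at h
  exact (ZMod.isUnit_two_of_odd hm).mul_right_eq_zero.1 h

/-- An antisymmetric function is determined by its values above the diagonal. -/
def antisymmFunEquiv (n : ℕ) (hm : Odd m) :
    AntisymmFun m n ≃ ({x : Fin n × Fin n // x.1 < x.2} → ZMod m) where
  toFun v x := v.1 x
  invFun f := ⟨fun x => if h : x.1 < x.2 then f ⟨x, h⟩ else
    if h : x.2 < x.1 then -f ⟨x.swap, h⟩ else 0, fun x => by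
      rcases lt_trichotomy x.1 x.2 with h | h | h
      · simp [h, h.asymm]
      · simp [h]
      · simp [h, h.asymm]⟩
  left_inv v := by
    ext x
    rcases lt_trichotomy x.1 x.2 with h | h | h
    · simp [h]
    · obtain ⟨i, j⟩ := x
      obtain rfl : i = j := h
      simp [antisymmFun_apply_diag hm]
    · simp [h, h.asymm, antisymmFun_apply_swap]
  right_inv f := by
    ext x
    simp [x.2]

theorem card_lt_pairs (n : ℕ) :
    Fintype.card {x : Fin n × Fin n // x.1 < x.2} = n * (n - 1) / 2 := by
  rw [Fintype.card_subtype, Finset.card_filter, Fintype.sum_prod_type_right]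
  simp_rw [← Finset.card_filter, Finset.filter_gt_eq_Iio, Fin.card_Iio]
  rw [Fin.sum_univ_eq_sum_range fun i => i, Finset.sum_range_id]

theorem card_antisymmFun [NeZero m] (hm : Odd m) :
    Fintype.card (AntisymmFun m n) = m ^ (n * (n - 1) / 2) := by
  rw [Fintype.card_congr (antisymmFunEquiv n hm), Fintype.card_fun, ZMod.card, card_lt_pairs]

/-- The antisymmetric function supported on a pair and its transpose. -/
def antiSingle (m : ℕ) (x : Fin n × Fin n) : AntisymmFun m n :=
  ⟨Pi.single x 1 - Pi.single x.swap 1, fun y => by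
    simp [Pi.single_apply, Prod.swap_eq_iff_eq_swap]⟩

/-- The sign of `s - i`. -/
def orderSign (m : ℕ) (i s : Fin n) : ZMod m := if i < s then 1 else if s < i then -1 else 0

theorem orderSign_symm (i s : Fin n) : orderSign m s i = -orderSign m i s := by
  rcases lt_trichotomy i s with h | rfl | h
  · simp [orderSign, h, h.asymm]
  · simp [orderSign]
  · simp [orderSign, h, h.asymm]

/-- The exponents of the commutation relations of a quantum torus. -/
def torusForm (m : ℕ) (x y : Fin n × Fin n) : ZMod m :=
  (if x.2 = y.2 then orderSign m x.1 y.1 else 0) - if x.1 = y.1 then orderSign m x.2 y.2 else 0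

theorem torusForm_symm (x y : Fin n × Fin n) : torusForm m y x = -torusForm m x y := by
  simp only [torusForm, eq_comm (a := y.1), eq_comm (a := y.2), orderSign_symm x.1,
    orderSign_symm x.2]
  split_ifs <;> ring

theorem torusForm_swap_swap (x y : Fin n × Fin n) :
    torusForm m x.swap y.swap = -torusForm m x y := by
  simp only [torusForm, Prod.fst_swap, Prod.snd_swap]
  ring

theorem torusForm_swap_left (x y : Fin n × Fin n) :
    torusForm m x.swap y = -torusForm m x y.swap := by
  rw [← torusForm_swap_swap x, Prod.swap_swap]

/-- The linear form giving the phases of the Weyl operator of a pair. -/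
noncomputable def torusPhase (x : Fin n × Fin n) (v : AntisymmFun m n) : ZMod m :=
  2⁻¹ * ∑ y, torusForm m x y * v.1 y

theorem torusPhase_sub (x : Fin n × Fin n) (u v : AntisymmFun m n) :
    torusPhase x (u - v) = torusPhase x u - torusPhase x v := by
  simp [torusPhase, mul_sub, Finset.sum_sub_distrib]

theorem torusPhase_antiSingle (x y : Fin n × Fin n) :
    torusPhase x (antiSingle m y) = 2⁻¹ * (torusForm m x y - torusForm m x y.swap) := by
  simp [torusPhase, antiSingle, mul_sub, Finset.sum_sub_distrib, Pi.single_apply]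

theorem torusPhase_antiSingle_sub (hm : Odd m) (x y : Fin n × Fin n) :
    torusPhase x (antiSingle m y) - torusPhase y (antiSingle m x) = torusForm m x y := by
  rw [torusPhase_antiSingle, torusPhase_antiSingle, torusForm_symm x y, torusForm_symm x.swap y,
    torusForm_swap_left, ← mul_sub]
  have h : (2 : ZMod m)⁻¹ * 2 = 1 := ZMod.inv_mul_of_unit _ (ZMod.isUnit_two_of_odd hm)
  linear_combination torusForm m x y * h

end Antisymm

section WeylTorus

variable {k : Type*} [Field k] {q : k} {m n : ℕ} [NeZero m]

/-- The character of `ZMod m` taking the value `q` at `1`. -/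
noncomputable def rootChar (hq : IsPrimitiveRoot q m) : AddChar (ZMod m) k :=
  AddChar.zmodChar m hq.pow_eq_one

theorem rootChar_one (hq : IsPrimitiveRoot q m) : rootChar hq 1 = q := by
  have := AddChar.zmodChar_apply' hq.pow_eq_one 1
  simpa [rootChar] using this

theorem rootChar_injective (hq : IsPrimitiveRoot q m) : Function.Injective (rootChar hq) := by
  intro a b h
  have := (AddChar.zmodChar_primitive_of_primitive_root m hq).zmod_char_eq_one_iff m (a - b)
  rw [← sub_eq_zero, ← this]
  change rootChar hq (a - b) = 1
  rw [sub_eq_add_neg, AddChar.map_add_eq_mul, h, ← AddChar.map_add_eq_mul, add_neg_cancel,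
    AddChar.map_zero_eq_one]

theorem rootChar_ne_zero (hq : IsPrimitiveRoot q m) (a : ZMod m) : rootChar hq a ≠ 0 := by
  intro h
  have := AddChar.map_add_eq_mul (rootChar hq) a (-a)
  rw [add_neg_cancel, AddChar.map_zero_eq_one, h, zero_mul] at this
  exact one_ne_zero this

/-- The Weyl operator of a pair. -/
noncomputable def weylTorusUnit (hq : IsPrimitiveRoot q m) (x : Fin n × Fin n) :
    (Matrix (AntisymmFun m n) (AntisymmFun m n) k)ˣ :=
  weylUnit (antiSingle m x) fun v =>
    Units.mk0 (rootChar hq (torusPhase x v)) (rootChar_ne_zero hq _)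

theorem skewCommute_weylTorusUnit (hq : IsPrimitiveRoot q m) (hm : Odd m) (x y : Fin n × Fin n) :
    SkewCommute (rootChar hq (torusForm m x y))
      (weylTorusUnit hq x : Matrix (AntisymmFun m n) (AntisymmFun m n) k) (weylTorusUnit hq y) := by
  refine skewCommute_weylUnit fun v => ?_
  rw [Units.val_mk0, Units.val_mk0, Units.val_mk0, Units.val_mk0, ← AddChar.map_add_eq_mul,
    ← AddChar.map_add_eq_mul, ← AddChar.map_add_eq_mul,
    torusPhase_sub, torusPhase_sub, ← torusPhase_antiSingle_sub hm x y]
  congr 1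
  ring

/-- The Weyl operators indexed by natural numbers. -/
noncomputable def weylTorus (hq : IsPrimitiveRoot q m) (n i c : ℕ) :
    (Matrix (AntisymmFun m n) (AntisymmFun m n) k)ˣ :=
  if h : i < n ∧ c < n then weylTorusUnit hq (⟨i, h.1⟩, ⟨c, h.2⟩) else 1

theorem weylTorus_coe (hq : IsPrimitiveRoot q m) (x : Fin n × Fin n) :
    weylTorus hq n x.1 x.2 = weylTorusUnit hq x := by
  simp [weylTorus]

theorem isQuantumTorus_weylTorus (hq : IsPrimitiveRoot q m) (hm : Odd m) (n : ℕ) :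
    IsQuantumTorus q n (weylTorus hq n) where
  row i c d hi hcd hd := by
    have := skewCommute_weylTorusUnit hq hm (⟨i, hi⟩, ⟨d, hd⟩) (⟨i, hi⟩, ⟨c, hcd.trans hd⟩)
    simpa [weylTorus, hi, hd, hcd.trans hd, torusForm, orderSign, hcd, hcd.not_gt, hcd.ne',
      rootChar_one]
      using this
  col i s c his hs hc := by
    have := skewCommute_weylTorusUnit hq hm (⟨i, his.trans hs⟩, ⟨c, hc⟩) (⟨s, hs⟩, ⟨c, hc⟩)
    simpa [weylTorus, hs, hc, his.trans hs, torusForm, orderSign, his, his.not_gt, his.ne,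
      rootChar_one]
      using this
  comm i s c d hi hs hc hd his hcd := by
    have := skewCommute_weylTorusUnit hq hm (⟨i, hi⟩, ⟨c, hc⟩) (⟨s, hs⟩, ⟨d, hd⟩)
    rw [← skewCommute_one_iff (R := k)]
    simpa [weylTorus, hs, hc, hi, hd, torusForm, his, hcd] using this

theorem IsQuantumTorus.map {R S B C : Type*} [CommRing R] [CommRing S] [Ring B] [Ring C]
    [Algebra R B] [Algebra S C] {q : R} {T : ℕ → ℕ → Bˣ} (hT : IsQuantumTorus q n T)
    (g : R →+* S) (f : B →+* C) (hf : ∀ r b, f (r • b) = g r • f b) :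
    IsQuantumTorus (g q) n fun i c => Units.map (f : B →* C) (T i c) where
  row i c d hi hcd hd := by
    have := congrArg f (hT.row i c d hi hcd hd)
    simpa [SkewCommute, hf] using this
  col i s c his hs hc := by
    have := congrArg f (hT.col i s c his hs hc)
    simpa [SkewCommute, hf] using this
  comm i s c d hi hs hc hd his hcd := by
    have := congrArg f (hT.comm i s c d hi hs hc hd his hcd)
    simpa using this

end WeylTorus

section Generation

theorem Subalgebra.inv_mem_of_finiteDimensional {k B : Type*} [Field k] [Ring B] [Algebra k B]
    [FiniteDimensional k B] (A : Subalgebra k B) (u : Bˣ) (hu : (u : B) ∈ A) :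
    ((u⁻¹ : Bˣ) : B) ∈ A := by
  have hinj : Function.Injective (LinearMap.mulLeft k (⟨u, hu⟩ : A)) := fun x y h => by
    have h : (u : B) * x = u * y := congrArg Subtype.val h
    exact Subtype.ext ((Units.mul_right_inj u).1 h)
  obtain ⟨x, hx⟩ := LinearMap.injective_iff_surjective.1 hinj 1
  have hx : (u : B) * x = 1 := congrArg Subtype.val hx
  rw [Units.inv_eq_of_mul_eq_one_right hx]
  exact x.2

theorem mem_of_torusMatrix_mem {k B : Type*} [Field k] [Ring B] [Algebra k B]
    [FiniteDimensional k B] {T : ℕ → ℕ → Bˣ} {n : ℕ} (A : Subalgebra k B)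
    (h : ∀ c i, c < n → i < n →
      torusMatrix T (fun _ _ => (1 : k)) (fun _ _ => 1) n c i ∈ A) {i c : ℕ} (hi : i < n)
    (hc : c < n) : (T i c : B) ∈ A := by
  have hT : ∀ r, (∀ c i, c < n → i < r + 1 →
      torusMatrix T (fun _ _ => (1 : k)) (fun _ _ => 1) (r + 1) c i ∈ A) →
      ∀ c, c < n → (T r c : B) ∈ A := fun r hr c hc => by
    simpa [torusMatrix_succ_self] using hr c r hc r.lt_succ_self
  have key : ∀ r, r ≤ n → ∀ c i, c < n → i < r →
      torusMatrix T (fun _ _ => (1 : k)) (fun _ _ => 1) r c i ∈ A := by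
    intro r hr
    induction hr using Nat.decreasingInduction with
    | self => exact h
    | of_succ r hr ih =>
      intro c i hc hi
      have hZ : ∀ c, c < n → extendRow (torusMatrix T (fun _ _ => (1 : k)) (fun _ _ => 1) r)
          (stepRatio (fun _ => (1 : k)) (T r)) c i ∈ A := fun c hc => by
        rw [← torusMatrix_succ_of_lt c hi]
        exact ih c i hc (hi.trans r.lt_succ_self)
      cases c with
      | zero => exact hZ 0 hc
      | succ c =>
        have h1 := hZ (c + 1) hc
        rw [extendRow] at h1
        have hg : stepRatio (fun _ => (1 : k)) (T r) c ∈ A := by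
          rw [stepRatio, one_smul]
          exact mul_mem (A.inv_mem_of_finiteDimensional _ (hT r ih c (by omega)))
            (hT r ih (c + 1) hc)
        exact (add_mem_cancel_right (mul_mem (hZ c (by omega)) hg)).1 h1
  exact hT i (key (i + 1) hi) c hc

theorem Subalgebra.single_mem_of_separates {D k : Type*} [Fintype D] [DecidableEq D] [Field k]
    (A : Subalgebra k (D → k)) (h : ∀ a b, a ≠ b → ∃ f ∈ A, f a ≠ f b) (a : D) :
    Pi.single a 1 ∈ A := by
  choose! f hf hne using h a
  have : (Pi.single a 1 : D → k) = ∏ b ∈ Finset.univ.erase a,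
      (f b a - f b b)⁻¹ • (f b - algebraMap k (D → k) (f b b)) := by
    ext c
    rw [Finset.prod_apply]
    by_cases hc : c = a
    · subst hc
      rw [Pi.single_eq_same, Finset.prod_eq_one]
      intro b hb
      have := hne b (Finset.ne_of_mem_erase hb).symm
      simp [inv_mul_cancel₀ (sub_ne_zero.2 this)]
    · rw [Pi.single_eq_of_ne hc,
        Finset.prod_eq_zero (Finset.mem_erase.2 ⟨hc, Finset.mem_univ _⟩)]
      simp
  rw [this]
  exact prod_mem fun b hb => A.smul_mem
    (sub_mem (hf b (Finset.ne_of_mem_erase hb).symm) (A.algebraMap_mem _)) _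

variable {m n : ℕ}

theorem orderSign_sub_orderSign {i j : Fin n} (h : (j : ℕ) = i + 1) (s : Fin n) :
    orderSign m i s - orderSign m j s = (if s = i then 1 else 0) + if s = j then 1 else 0 := by
  simp only [orderSign, Fin.ext_iff, Fin.lt_def, h]
  split_ifs <;> first | omega | ring

theorem sum_torusForm_mul (v : Fin n × Fin n → ZMod m) (i c : Fin n) :
    ∑ y, torusForm m (i, c) y * v y =
      ∑ s, orderSign m i s * v (s, c) - ∑ d, orderSign m c d * v (i, d) := by
  simp only [torusForm, sub_mul, Finset.sum_sub_distrib, ite_mul, zero_mul]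
  rw [Fintype.sum_prod_type, Fintype.sum_prod_type_right]
  simp

theorem sum_orderSign_mul_sub {i j : Fin n} (h : (j : ℕ) = i + 1) (f : Fin n → ZMod m) :
    ∑ s, orderSign m i s * f s - ∑ s, orderSign m j s * f s = f i + f j := by
  rw [← Finset.sum_sub_distrib]
  simp [← sub_mul, orderSign_sub_orderSign h, add_mul, Finset.sum_add_distrib]

theorem eq_zero_of_sum_torusForm_eq_zero (hm : Odd m) (v : AntisymmFun m n)
    (h : ∀ x, ∑ y, torusForm m x y * v.1 y = 0) : v = 0 := by
  have h2 := ZMod.isUnit_two_of_odd hm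
  have step : ∀ {i j c d : Fin n}, (j : ℕ) = i + 1 → (d : ℕ) = c + 1 →
      v.1 (j, c) = v.1 (i, d) := by
    intro i j c d hij hcd
    refine h2.mul_right_injective ?_
    have e1 := h (i, c)
    have e2 := h (j, c)
    have e3 := h (i, d)
    have e4 := h (j, d)
    rw [sum_torusForm_mul] at e1 e2 e3 e4
    have f1 := sum_orderSign_mul_sub hij fun s => v.1 (s, c)
    have f2 := sum_orderSign_mul_sub hij fun s => v.1 (s, d)
    have f3 := sum_orderSign_mul_sub hcd fun s => v.1 (i, s)
    have f4 := sum_orderSign_mul_sub hcd fun s => v.1 (j, s)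
    linear_combination e1 - e2 - e3 + e4 - f1 + f2 + f3 - f4
  have shift : ∀ (t : ℕ) {i j c d : Fin n}, (j : ℕ) = i + t → (d : ℕ) = c + t →
      v.1 (j, c) = v.1 (i, d) := by
    intro t
    induction t with
    | zero =>
      intro i j c d hij hcd
      rw [Fin.ext hij, Fin.ext hcd]
    | succ t ih =>
      intro i j c d hij hcd
      rw [step (i := ⟨i + t, by omega⟩) (d := ⟨c + 1, by omega⟩) (by simpa [add_assoc] using hij)
        rfl]
      exact ih rfl (by simp only [hcd]; ring)
  have symm : ∀ i c : Fin n, v.1 (i, c) = v.1 (c, i) := by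
    intro i c
    rcases le_total i c with hic | hic
    · exact (shift (c - i : ℕ) (by omega) (by omega)).symm
    · exact shift (i - c : ℕ) (by omega) (by omega)
  ext ⟨i, c⟩
  have e := antisymmFun_apply_swap v (i, c)
  rw [Prod.swap_prod_mk, ← symm, eq_neg_iff_add_eq_zero, ← two_mul] at e
  exact h2.mul_right_eq_zero.1 e

theorem torusPhase_swap (x : Fin n × Fin n) (v : AntisymmFun m n) :
    torusPhase x.swap v = torusPhase x v := by
  rw [torusPhase, torusPhase, ← (Equiv.prodComm (Fin n) (Fin n)).sum_comp]
  congr 1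
  refine Finset.sum_congr rfl fun y _ => ?_
  rw [Equiv.prodComm_apply, torusForm_swap_swap, antisymmFun_apply_swap, neg_mul_neg]

theorem antiSingle_swap (x : Fin n × Fin n) : antiSingle m x.swap = -antiSingle m x := by
  ext y
  simp [antiSingle]

theorem sum_val_nsmul_antiSingle [NeZero m] (hm : Odd m) (v : AntisymmFun m n) :
    ∑ x, (2⁻¹ * v.1 x).val • antiSingle m x = v := by
  have h : (2 : ZMod m)⁻¹ * 2 = 1 := ZMod.inv_mul_of_unit _ (ZMod.isUnit_two_of_odd hm)
  ext y
  rw [AddSubgroup.val_finsetSum, Finset.sum_apply]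
  have : ∀ x, ((2⁻¹ * v.1 x).val • antiSingle m x).1 y =
      (if x = y then 2⁻¹ * v.1 x else 0) - if x = y.swap then 2⁻¹ * v.1 x else 0 := by
    intro x
    have e : (y = x.swap) = (x = y.swap) := by
      rw [← Prod.swap_eq_iff_eq_swap, eq_comm (a := x)]
    simp [antiSingle, Pi.single_apply, mul_sub, e, eq_comm (a := y)]
  rw [Finset.sum_congr rfl fun x _ => this x, Finset.sum_sub_distrib]
  simp only [Finset.sum_ite_eq', Finset.mem_univ, if_true, antisymmFun_apply_swap]
  linear_combination v.1 y * h

variable {k : Type*} [Field k] {q : k} [NeZero m]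

theorem weylTorusUnit_apply (hq : IsPrimitiveRoot q m) (x : Fin n × Fin n)
    (a b : AntisymmFun m n) : (weylTorusUnit hq x : Matrix _ _ k) a b =
      if a = b + antiSingle m x then rootChar hq (torusPhase x a) else 0 := rfl

theorem weylTorusUnit_mul_swap (hq : IsPrimitiveRoot q m) (hm : Odd m) (x : Fin n × Fin n) :
    ∃ c : k, c ≠ 0 ∧ (weylTorusUnit hq x : Matrix (AntisymmFun m n) (AntisymmFun m n) k) *
      (weylTorusUnit hq x.swap : Matrix (AntisymmFun m n) (AntisymmFun m n) k) =
      Matrix.diagonal fun v : AntisymmFun m n => c *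
        rootChar hq (∑ y, torusForm m x y * v.1 y) := by
  refine ⟨rootChar hq (-torusPhase x (antiSingle m x)), rootChar_ne_zero hq _, ?_⟩
  have h : (2 : ZMod m)⁻¹ * 2 = 1 := ZMod.inv_mul_of_unit _ (ZMod.isUnit_two_of_odd hm)
  change weylMatrix _ _ * weylMatrix _ _ = _
  rw [weylMatrix_mul, antiSingle_swap, add_neg_cancel]
  ext a b
  simp only [weylMatrix, add_zero, Matrix.diagonal_apply]
  refine if_congr Iff.rfl ?_ rfl
  rw [Units.val_mk0, Units.val_mk0, torusPhase_swap, torusPhase_sub, ← AddChar.map_add_eq_mul,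
    ← AddChar.map_add_eq_mul]
  congr 1
  simp only [torusPhase]
  linear_combination (∑ y, torusForm m x y * a.1 y) * h

theorem Subalgebra.eq_top_of_weylTorusUnit_mem (hq : IsPrimitiveRoot q m) (hm : Odd m)
    (A : Subalgebra k (Matrix (AntisymmFun m n) (AntisymmFun m n) k))
    (hA : ∀ x : Fin n × Fin n,
      (weylTorusUnit hq x : Matrix (AntisymmFun m n) (AntisymmFun m n) k) ∈ A) :
    A = ⊤ := by
  have hdiag : ∀ a : AntisymmFun m n, Matrix.single a a (1 : k) ∈ A := by
    intro a
    have := (A.comap (Matrix.diagonalAlgHom k)).single_mem_of_separates (fun u v huv => ?_) a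
    · simpa [Matrix.diagonal_single] using this
    · obtain ⟨x, hx⟩ : ∃ x, ∑ y, torusForm m x y * (u - v).1 y ≠ 0 := by
        by_contra! h
        exact huv (sub_eq_zero.1 (eq_zero_of_sum_torusForm_eq_zero hm _ h))
      obtain ⟨c, hc, e⟩ := weylTorusUnit_mul_swap hq hm x
      refine ⟨fun v => c * rootChar hq (∑ y, torusForm m x y * v.1 y), ?_, fun h => hx ?_⟩
      · rw [Subalgebra.mem_comap, Matrix.diagonalAlgHom_apply, ← e]
        exact mul_mem (hA _) (hA _)
      · have := rootChar_injective hq (mul_left_cancel₀ hc h)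
        simp only [AddSubgroup.coe_sub, Pi.sub_apply, mul_sub, Finset.sum_sub_distrib, this,
          sub_self]
  let S : AddSubmonoid (AntisymmFun m n) :=
    { carrier := {t | ∀ b, Matrix.single (b + t) b (1 : k) ∈ A}
      zero_mem' := fun b => by simpa using hdiag b
      add_mem' := fun {s t} hs ht b => by
        have := mul_mem (ht (b + s)) (hs b)
        rwa [Matrix.single_mul_single_same, mul_one, add_assoc] at this }
  have hS : ∀ x, antiSingle m x ∈ S := by
    intro x b
    have h1 := mul_mem (mul_mem (hdiag (b + antiSingle m x)) (hA x)) (hdiag b)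
    rw [Matrix.single_mul_mul_single, weylTorusUnit_apply, if_pos rfl, one_mul, mul_one] at h1
    have h2 := A.smul_mem h1 (rootChar hq (torusPhase x (b + antiSingle m x)))⁻¹
    rwa [Matrix.smul_single, smul_eq_mul, inv_mul_cancel₀ (rootChar_ne_zero hq _)] at h2
  have htop : ∀ t, t ∈ S := fun t => by
    rw [← sum_val_nsmul_antiSingle hm t]
    exact sum_mem fun x _ => nsmul_mem (hS x) _
  refine eq_top_iff.2 fun M _ => ?_
  rw [Matrix.matrix_eq_sum_single M]
  refine sum_mem fun a _ => sum_mem fun b _ => ?_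
  have := A.smul_mem (htop (a - b) b) (M a b)
  rwa [add_sub_cancel, Matrix.smul_single, smul_eq_mul, mul_one] at this

end Generation

section Surjective

variable {k : Type} [Field k] {q : k} {m n : ℕ} [NeZero m]

/-- The representation of the quantized matrix algebra on the functions on `AntisymmFun m n`. -/
noncomputable def weylRep (hq : IsPrimitiveRoot q m) (hm : Odd m) (n : ℕ) :
    QMat k q n n →ₐ[k] Matrix (AntisymmFun m n) (AntisymmFun m n) k :=
  torusHom (R := k) (lam := fun _ _ => 1) (τ := fun _ _ => 1) (hq.ne_zero (NeZero.ne m))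
    (isQuantumTorus_weylTorus hq hm n) fun _ _ => (mul_one 1).symm

theorem weylRep_surjective (hq : IsPrimitiveRoot q m) (hm : Odd m) (n : ℕ) :
    Function.Surjective (weylRep hq hm n) := by
  rw [← AlgHom.range_eq_top]
  refine Subalgebra.eq_top_of_weylTorusUnit_mem hq hm _ fun x => ?_
  rw [← weylTorus_coe]
  refine mem_of_torusMatrix_mem (n := n) _ (fun c i hc hi => ?_) x.1.2 x.2.2
  refine ⟨Zgen k q n n ⟨i, hi⟩ ⟨n - 1 - c, by omega⟩, ?_⟩
  have := torusHom_Zgen (R := k) (lam := fun _ _ => 1) (τ := fun _ _ => 1)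
    (hq.ne_zero (NeZero.ne m)) (isQuantumTorus_weylTorus hq hm n) (fun _ _ => (mul_one 1).symm)
    ⟨i, hi⟩ ⟨n - 1 - c, by omega⟩
  have e : n - 1 - (n - 1 - c) = c := by omega
  simp only [e] at this
  exact this

end Surjective

section InitialTerm

open Polynomial

variable {D K : Type*} [Fintype D] [DecidableEq D] [Field K]

/-- `x` is divisible by `X ^ d` and the quotient specializes to `y` at `X = 0`. -/
def HasInitialTerm (d : ℕ) (x : Matrix D D K[X]) (y : Matrix D D K) : Prop :=
  ∃ P : Matrix D D K[X], x = (X : K[X]) ^ d • P ∧ constantCoeff.mapMatrix P = y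

namespace HasInitialTerm

variable {d e : ℕ} {x x' : Matrix D D K[X]} {y y' : Matrix D D K}

theorem mapMatrix_smul (p : K[X]) (P : Matrix D D K[X]) :
    constantCoeff.mapMatrix (p • P) = constantCoeff p • constantCoeff.mapMatrix P := by
  ext a b
  simp

theorem mul (h : HasInitialTerm d x y) (h' : HasInitialTerm e x' y') :
    HasInitialTerm (d + e) (x * x') (y * y') := by
  obtain ⟨P, rfl, rfl⟩ := h
  obtain ⟨Q, rfl, rfl⟩ := h'
  exact ⟨P * Q, by rw [smul_mul_smul_comm, pow_add], map_mul _ _ _⟩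

theorem add_of_lt (h : HasInitialTerm d x y) (h' : HasInitialTerm e x' y') (hde : d < e) :
    HasInitialTerm d (x + x') y := by
  obtain ⟨P, rfl, rfl⟩ := h
  obtain ⟨Q, rfl, rfl⟩ := h'
  refine ⟨P + (X : K[X]) ^ (e - d) • Q, ?_, ?_⟩
  · rw [smul_add, smul_smul, ← pow_add, Nat.add_sub_cancel' hde.le]
  · rw [map_add, mapMatrix_smul, map_pow, constantCoeff_apply, coeff_X_zero,
      zero_pow (Nat.sub_pos_of_lt hde).ne', zero_smul, add_zero]

theorem smul (h : HasInitialTerm d x y) (a : K) (e : ℕ) :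
    HasInitialTerm (e + d) ((C a * (X : K[X]) ^ e) • x) (a • y) := by
  obtain ⟨P, rfl, rfl⟩ := h
  refine ⟨C a • P, ?_, ?_⟩
  · rw [smul_smul, smul_smul]
    congr 1
    ring
  · rw [mapMatrix_smul, constantCoeff_apply, coeff_C_zero]

theorem map {k : Type*} [Field k] [Algebra k K] (M : Matrix D D k) :
    HasInitialTerm 0 ((algebraMap k K[X]).mapMatrix M) ((algebraMap k K).mapMatrix M) := by
  refine ⟨_, (by rw [pow_zero, one_smul]), ?_⟩
  ext a b
  simp [Polynomial.algebraMap_apply]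

theorem sum_eq_zero {k ι : Type*} [Field k] [Algebra k K] {s : Finset ι} {wt : ι → ℕ}
    {x : ι → Matrix D D K[X]} {y : ι → Matrix D D K} (c : ι → k)
    (h : ∀ i ∈ s, HasInitialTerm (wt i) (x i) (y i)) (hs : ∑ i ∈ s, c i • x i = 0)
    (hd : ∀ i ∈ s, d ≤ wt i) : ∑ i ∈ s with wt i = d, c i • y i = 0 := by
  choose! P hP hy using h
  have e : (X : K[X]) ^ d • ∑ i ∈ s, (algebraMap k K[X] (c i) * X ^ (wt i - d)) • P i = 0 := by
    rw [← hs, Finset.smul_sum]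
    refine Finset.sum_congr rfl fun i hi => ?_
    rw [hP i hi, ← algebraMap_smul K[X] (c i), smul_smul, smul_smul]
    congr 1
    rw [mul_left_comm, ← pow_add, Nat.add_sub_cancel' (hd i hi)]
  rw [smul_eq_zero_iff_right (pow_ne_zero _ X_ne_zero)] at e
  have e' := congrArg constantCoeff.mapMatrix e
  rw [map_sum, map_zero] at e'
  rw [Finset.sum_filter]
  refine Eq.trans ?_ e'
  refine Finset.sum_congr rfl fun i hi => ?_
  rw [mapMatrix_smul, hy i hi]
  split_ifs with hwt
  · rw [hwt, Nat.sub_self, pow_zero, mul_one, Polynomial.algebraMap_apply, constantCoeff_apply,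
      coeff_C_zero, algebraMap_smul]
  · have : wt i - d ≠ 0 := by
      have := hd i hi
      omega
    rw [map_mul, map_pow, constantCoeff_apply X, coeff_X_zero, zero_pow this, mul_zero, zero_smul]

end HasInitialTerm

end InitialTerm

section Degeneration

open Polynomial

variable {D k K : Type*} [Fintype D] [DecidableEq D] [Field k] [Field K] [Algebra k K]
  {T : ℕ → ℕ → (Matrix D D k)ˣ} {t : ℕ → ℕ → K}

/-- The scalars of the entries on the diagonals of the degenerating family. -/
noncomputable def degLam (t : ℕ → ℕ → K) (r c : ℕ) : K[X] := C (t r c) * X ^ (r * (c + 1))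

/-- The ratios of the scalars `degLam`. -/
noncomputable def degTau (t : ℕ → ℕ → K) (r c : ℕ) : K[X] := C (t r (c + 1) / t r c) * X ^ r

theorem degLam_succ (ht : ∀ r c, t r c ≠ 0) (r c : ℕ) :
    degLam t r (c + 1) = degLam t r c * degTau t r c := by
  rw [degLam, degLam, degTau, mul_mul_mul_comm, ← C_mul, mul_div_cancel₀ _ (ht r c), ← pow_add]
  rfl

/-- Extension of scalars for units in matrix rings. -/
noncomputable def unitsBaseChange (K : Type*) [Field K] [Algebra k K] (u : (Matrix D D k)ˣ) :
    (Matrix D D K[X])ˣ :=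
  Units.map (((algebraMap k K[X]).mapMatrix : Matrix D D k →+* Matrix D D K[X]) :
    Matrix D D k →* Matrix D D K[X]) u

theorem hasInitialTerm_torusMatrix {r i : ℕ} (hi : i < r) (c : ℕ) :
    HasInitialTerm (i * (c + 1))
      (torusMatrix (fun i c => unitsBaseChange K (T i c)) (degLam t) (degTau t) r c i)
      (t i c • (algebraMap k K).mapMatrix (T i c : Matrix D D k)) := by
  induction r generalizing c with
  | zero => omega
  | succ r ih =>
    obtain rfl | hir := (Nat.le_of_lt_succ hi).eq_or_lt
    · rw [torusMatrix_succ_self]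
      have := (HasInitialTerm.map (K := K) (T i c : Matrix D D k)).smul (t i c) (i * (c + 1))
      exact this
    · rw [torusMatrix_succ_of_lt c hir]
      induction c with
      | zero => exact ih hir 0
      | succ c ihc =>
        have := (HasInitialTerm.map (K := K)
          ((((T r c)⁻¹ * T r (c + 1) : (Matrix D D k)ˣ)) : Matrix D D k)).smul
          (t r (c + 1) / t r c) r
        have h : stepRatio (degTau t r) (fun c => unitsBaseChange K (T r c)) c =
            (C (t r (c + 1) / t r c) * X ^ r) • (algebraMap k K[X]).mapMatrix
              (((T r c)⁻¹ * T r (c + 1) : (Matrix D D k)ˣ) : Matrix D D k) := by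
          rw [stepRatio, degTau, unitsBaseChange, unitsBaseChange, Units.val_mul, map_mul,
            ← map_inv]
          rfl
        rw [← h] at this
        rw [extendRow]
        exact (ih hir (c + 1)).add_of_lt (ihc.mul this) (by linarith)

end Degeneration

section Injective

open Polynomial

variable {k : Type} [Field k] {q : k} {m n : ℕ}

/-- The algebraically independent parameters of the degenerating family. -/
noncomputable def genericParam (k : Type) [Field k] (n i c : ℕ) :
    FractionRing (MvPolynomial (Fin n × Fin n) k) :=
  if h : i < n ∧ c < n then
    algebraMap (MvPolynomial (Fin n × Fin n) k) _
      (MvPolynomial.X (⟨i, h.1⟩, ⟨n - 1 - c, by omega⟩))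
  else 1

theorem genericParam_ne_zero (i c : ℕ) : genericParam k n i c ≠ 0 := by
  rw [genericParam]
  split_ifs with h
  · exact (map_ne_zero_iff _ (IsFractionRing.injective _ _)).2 (MvPolynomial.X_ne_zero _)
  · exact one_ne_zero

theorem genericParam_coe (x : Fin n × Fin n) : genericParam k n x.1 (n - 1 - x.2) =
    algebraMap (MvPolynomial (Fin n × Fin n) k) _ (MvPolynomial.X x) := by
  have h : (x.1 : ℕ) < n ∧ n - 1 - (x.2 : ℕ) < n := by omega
  have e : n - 1 - (n - 1 - (x.2 : ℕ)) = x.2 := by omega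
  rw [genericParam, dif_pos h]
  simp only [e]

theorem IsSortedWord.eq_of_toFinsupp_eq {w w' : List (Fin n × Fin n)} (hw : IsSortedWord w)
    (hsort : IsSortedWord w')
    (h : Multiset.toFinsupp (w : Multiset (Fin n × Fin n)) = Multiset.toFinsupp (w' : Multiset _)) :
    w = w' :=
  (Multiset.coe_eq_coe.1 (Multiset.toFinsupp.injective h)).eq_of_pairwise
    (fun _ _ _ _ h1 h2 => finProdFinEquiv.injective (le_antisymm h1 h2)) hw hsort

/-- The Weyl operator of a word. -/
noncomputable def wordUnit {D : Type*} [Fintype D] [DecidableEq D]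
    (T : ℕ → ℕ → (Matrix D D k)ˣ) (w : List (Fin n × Fin n)) : (Matrix D D k)ˣ :=
  (w.map fun x => T x.1 (n - 1 - x.2)).prod

/-- The weight of a word. -/
def wordWeight (w : List (Fin n × Fin n)) : ℕ :=
  (w.map fun x => (x.1 : ℕ) * (n - 1 - x.2 + 1)).sum

variable {D : Type} [Fintype D] [DecidableEq D] {T : ℕ → ℕ → (Matrix D D k)ˣ}

/-- The homomorphism to matrices over polynomials given by the degenerating family. -/
noncomputable def degHom (hq0 : q ≠ 0) (hT : IsQuantumTorus q n T) :
    QMat k q n n →ₐ[k] Matrix D D (FractionRing (MvPolynomial (Fin n × Fin n) k))[X] :=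
  torusHom hq0 (hT.map (algebraMap k (FractionRing (MvPolynomial (Fin n × Fin n) k))[X])
    (algebraMap k (FractionRing (MvPolynomial (Fin n × Fin n) k))[X]).mapMatrix
    fun r b => by ext i j; simp) (degLam_succ (t := genericParam k n) genericParam_ne_zero)

theorem hasInitialTerm_degHom_wordProd (hq0 : q ≠ 0) (hT : IsQuantumTorus q n T)
    (w : List (Fin n × Fin n)) :
    HasInitialTerm (wordWeight w) (degHom hq0 hT (wordProd k q n w))
      (algebraMap (MvPolynomial (Fin n × Fin n) k) (FractionRing (MvPolynomial (Fin n × Fin n) k))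
        (MvPolynomial.monomial (Multiset.toFinsupp (w : Multiset (Fin n × Fin n))) 1) •
        (algebraMap k (FractionRing (MvPolynomial (Fin n × Fin n) k))).mapMatrix
          (wordUnit T w : Matrix D D k)) := by
  induction w with
  | nil =>
    have := HasInitialTerm.map (K := FractionRing (MvPolynomial (Fin n × Fin n) k))
      (1 : Matrix D D k)
    simpa [wordWeight, wordProd, wordUnit] using this
  | cons x w ih =>
    have h := hasInitialTerm_torusMatrix (T := T) (t := genericParam k n) x.1.2 (n - 1 - x.2)
    have h' : degHom hq0 hT (Zgen k q n n x.1 x.2) =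
        torusMatrix (fun i c => unitsBaseChange _ (T i c)) (degLam (genericParam k n))
          (degTau (genericParam k n)) n (n - 1 - x.2) x.1 := torusHom_Zgen ..
    have := h.mul ih
    rw [genericParam_coe, smul_mul_smul_comm, ← map_mul, ← map_mul] at this
    convert this using 1
    · simp [wordWeight]
    · rw [← h', ← map_mul]
      simp [wordProd]
    · rw [← Multiset.cons_coe, ← Multiset.singleton_add, map_add, MvPolynomial.X,
        MvPolynomial.monomial_mul, Multiset.toFinsupp_singleton, one_mul, wordUnit, wordUnit,
        List.map_cons, List.prod_cons, Units.val_mul]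

theorem degHom_injective [Nonempty D] (hq0 : q ≠ 0) (hT : IsQuantumTorus q n T) :
    Function.Injective (degHom hq0 hT) := by
  rw [injective_iff_map_eq_zero]
  intro f hf
  have hmem : f ∈ Submodule.span k (Set.image (wordProd k q n) {w | IsSortedWord w}) := by
    rw [span_sorted_wordProd hq0]
    trivial
  obtain ⟨c, hc, rfl⟩ := (Finsupp.mem_span_image_iff_linearCombination k).1 hmem
  rw [Finsupp.mem_supported] at hc
  by_contra! hne
  have hsupp : c.support.Nonempty := by
    rw [Finsupp.support_nonempty_iff]
    rintro rfl
    exact hne (map_zero _)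
  obtain ⟨w₀, hw₀, hmin⟩ := c.support.exists_min_image wordWeight hsupp
  rw [Finsupp.linearCombination_apply, Finsupp.sum, map_sum] at hf
  have hsum := HasInitialTerm.sum_eq_zero (s := c.support) c
    (fun w _ => hasInitialTerm_degHom_wordProd hq0 hT w)
    (by
      refine Eq.trans (Finset.sum_congr rfl fun w _ => ?_) hf
      exact (map_smul _ _ _).symm) hmin
  obtain ⟨a, b, hab⟩ : ∃ a b, (wordUnit T w₀ : Matrix D D k) a b ≠ 0 := by
    by_contra! h
    exact (wordUnit T w₀).ne_zero (Matrix.ext h)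
  have hentry := congrFun (congrFun hsum a) b
  have hpoly : algebraMap (MvPolynomial (Fin n × Fin n) k)
      (FractionRing (MvPolynomial (Fin n × Fin n) k))
      (∑ w ∈ c.support with wordWeight w = wordWeight w₀,
        MvPolynomial.monomial (Multiset.toFinsupp (w : Multiset (Fin n × Fin n)))
          (c w * (wordUnit T w : Matrix D D k) a b)) = 0 := by
    rw [map_sum]
    refine Eq.trans (Finset.sum_congr rfl fun w _ => ?_)
      ((Matrix.sum_apply a b _ _).symm.trans hentry)
    rw [Matrix.smul_apply, Matrix.smul_apply, RingHom.mapMatrix_apply, Matrix.map_apply,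
      smul_eq_mul, Algebra.smul_def, IsScalarTower.algebraMap_apply k
        (MvPolynomial (Fin n × Fin n) k), IsScalarTower.algebraMap_apply k
        (MvPolynomial (Fin n × Fin n) k) (FractionRing (MvPolynomial (Fin n × Fin n) k))
        ((wordUnit T w : Matrix D D k) a b), ← map_mul, ← map_mul, MvPolynomial.algebraMap_eq,
      mul_comm (MvPolynomial.monomial _ _), ← mul_assoc, ← MvPolynomial.C_mul,
      MvPolynomial.C_mul_monomial, mul_one]
  rw [map_eq_zero_iff _ (IsFractionRing.injective _ _)] at hpoly
  have hcoeff := congrArg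
    (MvPolynomial.coeff (Multiset.toFinsupp (w₀ : Multiset (Fin n × Fin n)))) hpoly
  rw [MvPolynomial.coeff_sum, Finset.sum_eq_single w₀, MvPolynomial.coeff_monomial, if_pos rfl,
    MvPolynomial.coeff_zero] at hcoeff
  · exact mul_ne_zero (Finsupp.mem_support_iff.1 hw₀) hab hcoeff
  · intro w hw hww₀
    rw [MvPolynomial.coeff_monomial, if_neg]
    exact fun h => hww₀ ((hc (Finset.mem_filter.1 hw).1).eq_of_toFinsupp_eq (hc hw₀) h)
  · intro h
    exact (h (Finset.mem_filter.2 ⟨hw₀, rfl⟩)).elim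

theorem IsPolyIdentity.of_injective {A B : Type} [Ring A] [Ring B] {p : FreeAlgebra ℤ ℕ}
    (φ : A →+* B) (hφ : Function.Injective φ) (h : IsPolyIdentity B p) : IsPolyIdentity A p := by
  intro f
  refine hφ ?_
  rw [map_zero, ← h (φ ∘ f)]
  have : φ.toIntAlgHom.comp (FreeAlgebra.lift ℤ f) = FreeAlgebra.lift ℤ (φ ∘ f) := by
    ext x
    simp
  exact DFunLike.congr_fun this p

theorem DegLE.of_injective {A R : Type} [Ring A] [CommRing R] (φ : A →+* Matrix D D R)
    (hφ : Function.Injective φ) : DegLE A (Fintype.card D) := fun _ hp =>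
  (hp R).of_injective
    ((Matrix.reindexRingEquiv R (Fintype.equivFin D)).toRingHom.comp φ)
    ((Matrix.reindexRingEquiv R (Fintype.equivFin D)).injective.comp hφ)

theorem degLE_QMat [NeZero m] (hq : IsPrimitiveRoot q m) (hm : Odd m) (n : ℕ) :
    DegLE (QMat k q n n) (m ^ (n * (n - 1) / 2)) := by
  rw [← card_antisymmFun hm]
  exact DegLE.of_injective (degHom (hq.ne_zero (NeZero.ne m))
    (isQuantumTorus_weylTorus hq hm n)).toRingHom (degHom_injective _ _)

end Injective

section Capelli

/-- The polynomial `∑ sign σ ∏ᵢ y i * x (σ i) * z i` in `3 * N` variables. -/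
noncomputable def capelliPoly (N : ℕ) : FreeAlgebra ℤ ℕ :=
  ∑ σ : Equiv.Perm (Fin N), Equiv.Perm.sign σ • (List.ofFn fun i =>
    FreeAlgebra.ι ℤ (Encodable.encode ((1, i) : Fin 3 × Fin N)) *
      FreeAlgebra.ι ℤ (Encodable.encode ((0, σ i) : Fin 3 × Fin N)) *
      FreeAlgebra.ι ℤ (Encodable.encode ((2, i) : Fin 3 × Fin N))).prod

theorem lift_capelliPoly {A : Type*} [Ring A] (N : ℕ) (f : ℕ → A) :
    FreeAlgebra.lift ℤ f (capelliPoly N) =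
      ∑ σ : Equiv.Perm (Fin N), Equiv.Perm.sign σ • (List.ofFn fun i =>
        f (Encodable.encode ((1, i) : Fin 3 × Fin N)) *
          f (Encodable.encode ((0, σ i) : Fin 3 × Fin N)) *
          f (Encodable.encode ((2, i) : Fin 3 × Fin N))).prod := by
  simp only [capelliPoly, map_sum, Units.smul_def, map_zsmul, map_list_prod, List.map_ofFn,
    Function.comp_def, map_mul, FreeAlgebra.lift_ι_apply]

theorem isPolyIdentity_capelliPoly {e N : ℕ} (hN : e * e < N) (R : Type) [CommRing R] :
    IsPolyIdentity (Matrix (Fin e) (Fin e) R) (capelliPoly N) := by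
  intro f
  rw [lift_capelliPoly]
  let g : MultilinearMap R (fun _ : Fin N => Matrix (Fin e) (Fin e) R)
      (Matrix (Fin e) (Fin e) R) :=
    (MultilinearMap.mkPiAlgebraFin R N _).compLinearMap fun i =>
      LinearMap.mulRight R (f (Encodable.encode ((2, i) : Fin 3 × Fin N))) ∘ₗ
        LinearMap.mulLeft R (f (Encodable.encode ((1, i) : Fin 3 × Fin N)))
  have h : g.alternatization = 0 := by
    refine (Matrix.stdBasis R (Fin e) (Fin e)).ext_alternating fun v hv => ?_
    have := Fintype.card_le_of_injective v hv
    simp only [Fintype.card_fin, Fintype.card_prod] at this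
    omega
  have := congrArg (fun a => a fun i => f (Encodable.encode ((0, i) : Fin 3 × Fin N))) h
  simpa [MultilinearMap.alternatization_apply, g] using this

theorem not_isPolyIdentity_capelliPoly {D R : Type} [Fintype D] [DecidableEq D] [CommRing R]
    [Nontrivial R] {e : ℕ} (he : e < Fintype.card D) :
    ¬ IsPolyIdentity (Matrix D D R) (capelliPoly (e * e + 1)) := by
  intro h
  obtain ⟨o⟩ : Nonempty D := Fintype.card_pos_iff.1 (by omega)
  obtain ⟨a⟩ : Nonempty (Fin (e * e + 1) ↪ D × D) := by
    refine Function.Embedding.nonempty_of_card_le ?_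
    rw [Fintype.card_fin, Fintype.card_prod]
    exact Nat.mul_self_lt_mul_self he
  let g : Fin 3 × Fin (e * e + 1) → Matrix D D R := fun x =>
    ![Matrix.single (a x.2).1 (a x.2).2 1, Matrix.single o (a x.2).1 1,
      Matrix.single (a x.2).2 o 1] x.1
  have hf := h fun j => (Encodable.decode j).elim 0 g
  simp only [lift_capelliPoly, Encodable.encodek, Option.elim_some, g, Matrix.cons_val_zero,
    Matrix.cons_val_one, Matrix.cons_val] at hf
  rw [Finset.sum_eq_single 1] at hf
  · have : (Matrix.single o o (1 : R)) ^ (e * e + 1) = Matrix.single o o 1 :=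
      IsIdempotentElem.pow_succ_eq (e * e) (by simp [IsIdempotentElem])
    simp only [Equiv.Perm.sign_one, Equiv.Perm.one_apply, Matrix.single_mul_single_same, mul_one,
      one_smul, List.ofFn_const, List.prod_replicate, this] at hf
    simpa using congrFun (congrFun hf o) o
  · intro σ _ hσ
    obtain ⟨i, hi⟩ : ∃ i, σ i ≠ i := by
      by_contra! hi
      exact hσ (Equiv.ext hi)
    rw [List.prod_eq_zero, smul_zero]
    rw [List.mem_ofFn']
    refine ⟨i, ?_⟩
    beta_reduce
    rw [Matrix.single_mul_mul_single, Matrix.single_apply, if_neg]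
    · simp
    · exact fun hh => hi (a.injective (Prod.ext hh.1 hh.2))
  · exact fun hh => absurd (Finset.mem_univ _) hh

theorem IsPolyIdentity.of_surjective {A B : Type} [Ring A] [Ring B] {p : FreeAlgebra ℤ ℕ}
    (φ : A →+* B) (hφ : Function.Surjective φ) (h : IsPolyIdentity A p) : IsPolyIdentity B p := by
  intro f
  obtain ⟨g, rfl⟩ := hφ.comp_left (α := ℕ) f
  have : φ.toIntAlgHom.comp (FreeAlgebra.lift ℤ g) = FreeAlgebra.lift ℤ (φ ∘ g) := by
    ext x
    simp
  rw [← this, AlgHom.comp_apply, h g, map_zero]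

theorem DegLE.card_le_of_surjective {A D R : Type} [Ring A] [Fintype D] [DecidableEq D]
    [CommRing R] [Nontrivial R] {e : ℕ} (hA : DegLE A e) (φ : A →+* Matrix D D R)
    (hφ : Function.Surjective φ) : Fintype.card D ≤ e := by
  by_contra! he
  exact not_isPolyIdentity_capelliPoly he ((hA _ fun R _ =>
    isPolyIdentity_capelliPoly (Nat.lt_succ_self _) R).of_surjective φ hφ)

end Capelli

section SimpleModules

theorem isSimpleModule_of_toEnd_surjective {k A V : Type*} [Field k] [Ring A] [AddCommGroup V]
    [Module k V] [Nontrivial V] [Module A V]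
    (h : ∀ f : Module.End k V, ∃ a : A, ∀ v, a • v = f v) : IsSimpleModule A V := by
  refine isSimpleModule_iff_toSpanSingleton_surjective.2 ⟨inferInstance, fun x hx y => ?_⟩
  obtain ⟨f, hf⟩ := IsSimpleModule.toSpanSingleton_surjective (Module.End k V) hx y
  obtain ⟨a, ha⟩ := h f
  exact ⟨a, (ha x).trans hf⟩

theorem toEnd_surjective_of_isSimpleModule {k A V : Type*} [Field k] [IsAlgClosed k] [Ring A]
    [Algebra k A] [AddCommGroup V] [Module k V] [Module A V] [IsScalarTower k A V]
    [IsSimpleModule A V] [FiniteDimensional k V] (f : Module.End k V) :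
    ∃ a : A, ∀ v, a • v = f v := by
  classical
  let F : Module.End (Module.End A V) V :=
    { f with
      map_smul' := fun g v => by
        obtain ⟨c, rfl⟩ := (IsSimpleModule.algebraMap_end_bijective_of_isAlgClosed k).2 g
        exact f.map_smul c v }
  let b := Module.finBasis k V
  obtain ⟨a, ha⟩ := jacobson_density F (Finset.univ.image b)
  have : Algebra.lsmul k k V a = f := b.ext fun i =>
    (ha (b i) (Finset.mem_image_of_mem b (Finset.mem_univ i))).symm
  exact ⟨a, fun v => DFunLike.congr_fun this v⟩

theorem DegLE.finrank_le {k A V : Type} [Field k] [IsAlgClosed k] [Ring A]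
    [Algebra k A] [AddCommGroup V] [Module k V] [Module A V] [IsScalarTower k A V]
    [IsSimpleModule A V] [FiniteDimensional k V] {e : ℕ} (hA : DegLE A e) :
    Module.finrank k V ≤ e := by
  have := hA.card_le_of_surjective (D := Fin (Module.finrank k V)) (R := k)
    ((LinearMap.toMatrixAlgEquiv (Module.finBasis k V)).toAlgHom.comp
      (Algebra.lsmul k k V)).toRingHom fun M => by
      obtain ⟨a, ha⟩ := toEnd_surjective_of_isSimpleModule (A := A)
        ((LinearMap.toMatrixAlgEquiv (Module.finBasis k V)).symm M)
      refine ⟨a, ?_⟩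
      have h : Algebra.lsmul k k V a = _ := LinearMap.ext ha
      change LinearMap.toMatrixAlgEquiv (Module.finBasis k V) (Algebra.lsmul k k V a) = M
      rw [h, AlgEquiv.apply_symm_apply]
  rwa [Fintype.card_fin] at this

theorem exists_simpleModule_of_surjective {k A D : Type} [Field k] [Ring A] [Algebra k A]
    [Fintype D] [DecidableEq D] [Nonempty D] (φ : A →ₐ[k] Matrix D D k)
    (hφ : Function.Surjective φ) :
    ∃ (V : Type) (_ : AddCommGroup V) (_ : Module k V) (_ : Module A V) (_ : IsScalarTower k A V),
      IsSimpleModule A V ∧ Module.Finite k V ∧ Fintype.card D = Module.finrank k V := by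
  let ψ : A →ₐ[k] Module.End k (D → k) := (Matrix.toLinAlgEquiv' (R := k)).toAlgHom.comp φ
  let _ : Module A (D → k) := Module.compHom (D → k) ψ.toRingHom
  have hsmul : ∀ (a : A) (v : D → k), a • v = ψ a v := fun _ _ => rfl
  have : IsScalarTower k A (D → k) := ⟨fun c a v => by
    rw [hsmul, hsmul, map_smul, LinearMap.smul_apply]⟩
  refine ⟨D → k, inferInstance, inferInstance, inferInstance, inferInstance,
    isSimpleModule_of_toEnd_surjective (k := k) fun f => ?_, inferInstance, by simp⟩
  obtain ⟨a, ha⟩ := hφ (Matrix.toLinAlgEquiv'.symm f)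
  refine ⟨a, fun v => ?_⟩
  change Matrix.toLinAlgEquiv' (φ a) v = f v
  rw [ha, AlgEquiv.apply_symm_apply]

end SimpleModules

/-- For `k` algebraically closed of characteristic zero, `m` odd and
`q` a primitive `m`-th root of unity, `deg M_q(n) = m^(n(n-1)/2)`; equivalently the
supremum of the dimensions of the finite-dimensional irreducible `M_q(n)`-modules is
`m^(n(n-1)/2)`. -/
theorem deg_QMat_square
    (k : Type) [Field k] [IsAlgClosed k] [CharZero k] (q : k) (m : ℕ)
    (hm : 0 < m) (hodd : Odd m) (hq : IsPrimitiveRoot q m) (n : ℕ) :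
    HasDeg (QMat k q n n) (m ^ (n * (n - 1) / 2)) ∧
      sSup {c : ℕ | ∃ (V : Type) (_ : AddCommGroup V) (_ : Module k V)
          (_ : Module (QMat k q n n) V) (_ : IsScalarTower k (QMat k q n n) V),
          IsSimpleModule (QMat k q n n) V ∧ Module.Finite k V ∧ c = Module.finrank k V} =
        m ^ (n * (n - 1) / 2) := by
  have : NeZero m := ⟨hm.ne'⟩
  have hdeg := degLE_QMat hq hodd n
  have hsurj := weylRep_surjective hq hodd n
  have hcard := card_antisymmFun (m := m) (n := n) hodd
  refine ⟨⟨hdeg, fun e he => ?_⟩, IsGreatest.csSup_eq ⟨?_, ?_⟩⟩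
  · rw [← hcard]
    exact he.card_le_of_surjective (weylRep hq hodd n).toRingHom hsurj
  · have : Nonempty (AntisymmFun m n) := ⟨0⟩
    rw [← hcard]
    exact exists_simpleModule_of_surjective (weylRep hq hodd n) hsurj
  · rintro c ⟨V, _, _, _, _, h1, h2, rfl⟩
    exact hdeg.finrank_le
end

section
/- Let q ∈ k be a primitive m-th root of unity and suppose r = x·s and n = y·s with both x and y odd. For t = 1−r, ..., n define Ψ_t ∈ M_q(n,r) by: Ψ_{1−r} = 1; for j = 2, ..., r, Ψ_{2−j} is the (r−j+1)×(r−j+1) quantum minor on rows 1, ..., r−j+1 and columns j, ..., r; for i = 1, ..., n−r+1, Ψ_i is the r×r quantum minor on rows i, ..., i+r−1 and columns 1, ..., r; for c = 1, ..., r−1, Ψ_{n−c+1} is the c×c quantum minor on rows n−c+1, ..., n and columns 1, ..., c. Then for each a = 1, ..., s, the element Z_a := Π_{ℓ=−x}^{y−1} (Ψ_{a+ℓ·s})^{ε_ℓ}, where ε_ℓ = 1 for ℓ even and ε_ℓ = m−1 for ℓ odd (factors multiplied in order of increasing ℓ), is central in M_q(n,r). -/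
open scoped BigOperators

/-- The elements `Ψ_t` of `M_q(n,r)`, defined for `1 - r ≤ t ≤ n`:
`Ψ_{1-r} = 1`; for `2 - r ≤ t ≤ 0` (i.e. `t = 2 - j`, `j = 2, ..., r`), `Ψ_t` is the
`(r+t-1) × (r+t-1)` quantum minor on rows `1, ..., r+t-1` and columns `2-t, ..., r`;
for `1 ≤ t ≤ n-r+1`, `Ψ_t` is the `r × r` quantum minor on rows `t, ..., t+r-1` and
columns `1, ..., r`; for `n-r+2 ≤ t ≤ n` (i.e. `t = n-c+1`, `c = 1, ..., r-1`), `Ψ_t`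
is the `(n+1-t) × (n+1-t)` quantum minor on rows `t, ..., n` and columns
`1, ..., n+1-t`.  (Indices here are 1-based as in the paper; the Lean indexing is
0-based.) -/
noncomputable def Psi (k : Type) [Field k] (q : k) (n r : ℕ) (hn : 0 < n) (hr : 0 < r)
    (t : ℤ) : QMat k q n r :=
  if t ≤ 1 - (r : ℤ) then 1
  else if t ≤ 0 then
    qMinor k q n r ((r : ℤ) - 1 + t).toNat
      (fun a => ⟨(a : ℕ) % n, Nat.mod_lt _ hn⟩)
      (fun a => ⟨((1 - t).toNat + (a : ℕ)) % r, Nat.mod_lt _ hr⟩)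
  else if t ≤ (n : ℤ) - (r : ℤ) + 1 then
    qMinor k q n r r
      (fun a => ⟨((t - 1).toNat + (a : ℕ)) % n, Nat.mod_lt _ hn⟩)
      (fun a => ⟨(a : ℕ) % r, Nat.mod_lt _ hr⟩)
  else
    qMinor k q n r ((n : ℤ) + 1 - t).toNat
      (fun a => ⟨((t - 1).toNat + (a : ℕ)) % n, Nat.mod_lt _ hn⟩)
      (fun a => ⟨(a : ℕ) % r, Nat.mod_lt _ hr⟩)

/-- The element `Z_a = Π_{ℓ = -x}^{y-1} (Ψ_{a + ℓ·s})^{ε_ℓ}` of `M_q(n,r)`, where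
`ε_ℓ = 1` for `ℓ` even and `ε_ℓ = m - 1` for `ℓ` odd, the factors being multiplied in
order of increasing `ℓ`. -/
noncomputable def Zcentral (k : Type) [Field k] (q : k) (n r : ℕ) (hn : 0 < n)
    (hr : 0 < r) (x y s m : ℕ) (a : ℕ) : QMat k q n r :=
  (List.ofFn fun t : Fin (x + y) =>
      Psi k q n r hn hr ((a : ℤ) + (((t : ℕ) : ℤ) - (x : ℤ)) * (s : ℤ)) ^
        (if Even (((t : ℕ) : ℤ) - (x : ℤ)) then 1 else m - 1)).prod

section QuantumWedge

variable {k M C : Type*} [Field k] [Ring M] [Algebra k M] [LinearOrder C]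

/-- The number of elements of `J` below `p`. -/
def rankBelow (J : Finset C) (p : C) : ℕ := (J.filter (· < p)).card

lemma rankBelow_erase {J : Finset C} {p : C} (hp : p ∈ J) (x : C) :
    (rankBelow (J.erase p) x : ℤ) = rankBelow J x - if p < x then 1 else 0 := by
  unfold rankBelow
  rw [Finset.filter_erase]
  split_ifs with h
  · have hm : p ∈ J.filter (· < x) := by simp [hp, h]
    rw [Finset.card_erase_of_mem hm]
    have := Finset.card_pos.2 ⟨p, hm⟩
    omega
  · rw [Finset.erase_eq_of_notMem (by simp [h])]
    simp

lemma rankBelow_insert {J : Finset C} {p : C} (hp : p ∉ J) (x : C) :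
    (rankBelow (insert p J) x : ℤ) = rankBelow J x + if p < x then 1 else 0 := by
  unfold rankBelow
  rw [Finset.filter_insert]
  split_ifs with h
  · rw [Finset.card_insert_of_notMem (by simp [hp])]
    simp
  · simp

/-- Left multiplication by the form `∑ p, a p ξ_p` in the quantum exterior algebra with
coefficients in `M`, whose elements are given by their coefficients on the monomials `ξ_J`. -/
def wedgeRow (q : k) (a : C → M) : (Finset C → M) →ₗ[k] (Finset C → M) where
  toFun F J := ∑ p ∈ J, (-q) ^ (rankBelow J p : ℤ) • (a p * F (J.erase p))
  map_add' F G := by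
    ext J
    simp [mul_add, Finset.sum_add_distrib]
  map_smul' c F := by
    ext J
    simp [Finset.smul_sum, smul_comm c]

lemma wedgeRow_apply (q : k) (a : C → M) (F : Finset C → M) (J : Finset C) :
    wedgeRow q a F J = ∑ p ∈ J, (-q) ^ (rankBelow J p : ℤ) • (a p * F (J.erase p)) := rfl

lemma wedgeRow_mul_right (q : k) (a : C → M) (F : Finset C → M) (z : M) :
    wedgeRow q a (fun J => F J * z) = fun J => wedgeRow q a F J * z := by
  ext J
  simp [wedgeRow_apply, Finset.sum_mul, mul_assoc]

/-- The product of the forms attached to a list of rows. -/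
def wedge (q : k) : List (C → M) → Finset C → M
  | [] => fun J => if J = ∅ then 1 else 0
  | a :: L => wedgeRow q a (wedge q L)

/-- The pairing `∑ l, z l * G l`. -/
def contract [Fintype C] (z : C → M) (G : C → Finset C → M) (J : Finset C) : M :=
  ∑ l, z l * G l J

/-- The effect on coefficients of moving a row `z` to the left past the form of `a`. -/
def transfer [Fintype C] (q : k) (a : C → M) (G : C → Finset C → M) (l : C) (J : Finset C) : M :=
  (∑ p ∈ J, ((-q) ^ (rankBelow J p : ℤ) * if p = l then q else 1) • (a p * G l (J.erase p))) +
    if l ∈ J then ((-q) ^ (rankBelow J l : ℤ) * (q - q⁻¹)) •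
      ∑ m with l < m, a m * G m (J.erase l) else 0

/-- The coefficients obtained by moving the `j`-th entry of a row to the left past `D`. -/
def braid (q : k) (j : C) (D : Finset C → M) (l : C) (J : Finset C) : M :=
  if l = j then (if j ∈ J then q else 1) • D J
  else if l < j ∧ l ∈ J ∧ j ∉ J then
    ((q - q⁻¹) * (-q) ^ ((rankBelow J l : ℤ) + 1 - rankBelow J j)) • D (insert j (J.erase l))
  else 0

lemma transfer_braid [Fintype C] {q : k} (hq : q ≠ 0) (a : C → M) (j : C) (D : Finset C → M) :
    transfer q a (braid q j D) = braid q j (wedgeRow q a D) := by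
  have hq' : -q ≠ 0 := neg_ne_zero.2 hq
  ext l J
  rcases lt_trichotomy l j with hlj | rfl | hjl
  · by_cases hl : l ∈ J
    swap
    · simp [transfer, braid, hl, hlj.ne]
    have hsum : ∀ J' : Finset C, j ∉ J' → ∀ f : C → M, (∀ m, l < m → m ≠ j → m ∉ J' → f m = 0) →
        ∑ m with l < m, f m = f j + ∑ m ∈ J', if l < m then f m else 0 := by
      intro J' hj f hf
      rw [← Finset.sum_filter, ← Finset.sum_insert (f := f) (s := J'.filter (l < ·)) (by simp [hj])]
      refine (Finset.sum_subset ?_ ?_).symm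
      · intro m
        simp only [Finset.mem_insert, Finset.mem_filter, Finset.mem_univ, true_and]
        rintro (rfl | h)
        · exact hlj
        · exact h.2
      · intro m hm hm'
        simp only [Finset.mem_insert, Finset.mem_filter, Finset.mem_univ, true_and,
          not_or, not_and] at hm hm'
        exact hf m hm hm'.1 fun h => hm'.2 h hm
    have hbig : ∀ m, j < m → ∀ J, braid q j D m J = 0 := by
      intro m hm J
      simp [braid, hm.ne', hm.not_gt]
    by_cases hj : j ∈ J
    · unfold transfer
      rw [if_pos hl, Finset.sum_eq_single j, Finset.sum_eq_single j]
      · have e1 : braid q j D l (J.erase j) =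
            ((q - q⁻¹) * (-q) ^ ((rankBelow J l : ℤ) + 1 - rankBelow J j)) • D (J.erase l) := by
          unfold braid
          rw [if_neg hlj.ne, if_pos ⟨hlj, by simp [hl, hlj.ne], by simp⟩,
            rankBelow_erase hj, rankBelow_erase hj, if_neg hlj.not_gt, if_neg (lt_irrefl _),
            Finset.erase_right_comm, Finset.insert_erase (by simp [hj, hlj.ne'])]
          simp
        have e2 : braid q j D j (J.erase l) = q • D (J.erase l) := by
          simp [braid, hj, hlj.ne']
        have e3 : braid q j (wedgeRow q a D) l J = 0 := by
          simp [braid, hlj.ne, hj]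
        rw [e1, e2, e3, if_neg hlj.ne']
        simp only [mul_smul_comm, smul_smul, ← add_smul]
        convert zero_smul k _
        rw [mul_one, mul_left_comm, ← zpow_add₀ hq']
        have : (rankBelow J j : ℤ) + (rankBelow J l + 1 - rankBelow J j) = rankBelow J l + 1 := by
          ring
        rw [this, zpow_add₀ hq', zpow_one]
        ring
      · intro m hm hmj
        have : braid q j D m (J.erase l) = 0 := by
          simp [braid, hmj, hj, hlj.ne']
        simp [this]
      · simp [hlj]
      · intro p hp hpj
        have : braid q j D l (J.erase p) = 0 := by
          simp [braid, hlj.ne, hj, Ne.symm hpj]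
        simp [this]
      · simp [hj]
    · have hJ : ∀ p ∈ J, p ≠ j := fun p hp h => hj (h ▸ hp)
      unfold transfer
      rw [if_pos hl, hsum (J.erase l) (by simp [hj])]
      swap
      · intro m hm hmj hmJ
        have : m ∉ J := by simpa [hm.ne'] using hmJ
        simp [braid, hmj, this]
      have e0 : braid q j D j (J.erase l) = D (J.erase l) := by
        simp [braid, hj]
      have e2 : braid q j (wedgeRow q a D) l J = ((q - q⁻¹) * (-q) ^ ((rankBelow J l : ℤ) + 1 -
          rankBelow J j)) • wedgeRow q a D (insert j (J.erase l)) := by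
        rw [braid, if_neg hlj.ne, if_pos ⟨hlj, hl, hj⟩]
      rw [e2, wedgeRow_apply, Finset.sum_insert (by simp [hj]), Finset.erase_insert (by simp [hj]),
        e0, ← Finset.add_sum_erase _ _ hl]
      have e1 : braid q j D l (J.erase l) = 0 := by
        simp [braid, hlj.ne]
      rw [e1, mul_zero, smul_zero, zero_add, smul_add, smul_add, add_left_comm]
      congr 1
      · rw [smul_smul]
        congr 1
        rw [rankBelow_insert (by simp [hj]), rankBelow_erase hl, if_pos hlj, if_neg (lt_irrefl _),
          mul_comm, mul_assoc, ← zpow_add₀ hq']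
        congr 2
        ring
      · rw [Finset.smul_sum, Finset.smul_sum, ← Finset.sum_add_distrib]
        refine Finset.sum_congr rfl fun p hp => ?_
        obtain ⟨hpl, hpJ⟩ := Finset.mem_erase.1 hp
        have hpj := hJ p hpJ
        have hset : insert j ((J.erase p).erase l) = (insert j (J.erase l)).erase p := by
          rw [Finset.erase_insert_of_ne hpj.symm, Finset.erase_right_comm]
        have hset' : insert j ((J.erase l).erase p) = (insert j (J.erase l)).erase p := by
          rw [Finset.erase_insert_of_ne hpj.symm]
        have f1 : braid q j D l (J.erase p) = ((q - q⁻¹) * (-q) ^ ((rankBelow J l : ℤ) + 1 -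
            rankBelow J j + ((if p < j then 1 else 0) - if p < l then 1 else 0))) •
              D ((insert j (J.erase l)).erase p) := by
          unfold braid
          rw [if_neg hlj.ne, if_pos ⟨hlj, by simp [hl, hpl.symm], by simp [hj]⟩, hset,
            rankBelow_erase hpJ, rankBelow_erase hpJ]
          congr 3
          ring
        rw [f1, if_neg hpl, rankBelow_insert (by simp [hj]), rankBelow_erase hl]
        rcases lt_or_gt_of_ne hpl with h | h
        · rw [if_neg h.not_gt]
          simp only [mul_smul_comm, smul_smul, smul_zero, add_zero]
          congr 1
          simp only [h, h.trans hlj, if_true, h.not_gt, (h.trans hlj).not_gt, if_false]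
          simp only [sub_self, add_zero, sub_zero]
          ring
        · rw [if_pos h]
          rcases lt_or_gt_of_ne hpj with h' | h'
          · have f2 : braid q j D p (J.erase l) = ((q - q⁻¹) * (-q) ^ ((rankBelow J p : ℤ) + 1 -
                rankBelow J j)) • D ((insert j (J.erase l)).erase p) := by
              unfold braid
              rw [if_neg hpj, if_pos ⟨h', hp, by simp [hj]⟩, hset',
                rankBelow_erase hl, rankBelow_erase hl, if_pos h, if_pos hlj]
              congr 3
              ring
            rw [f2]
            simp only [mul_smul_comm, smul_smul, ← add_smul]
            congr 1
            simp only [h, h', h.not_gt, h'.not_gt, if_true, if_false]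
            simp only [zpow_add₀ hq', zpow_sub₀ hq', zpow_one, zpow_zero]
            field_simp
            ring
          · rw [hbig p h']
            simp only [mul_smul_comm, smul_smul, smul_zero, add_zero, mul_zero]
            congr 1
            simp only [h, h', h.not_gt, h'.not_gt, if_true, if_false]
            simp only [sub_self, add_zero, sub_add_cancel]
            ring
  · have h2 : ∀ m, l < m → ∀ J, braid q l D m J = 0 := by
      intro m hm J
      simp [braid, hm.ne', hm.not_gt]
    have h3 : ∑ m with l < m, a m * braid q l D m (J.erase l) = 0 :=
      Finset.sum_eq_zero fun m hm => by rw [h2 m (by simpa using hm), mul_zero]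
    rw [transfer, h3, smul_zero, ite_self, add_zero]
    simp only [braid, if_true, wedgeRow_apply, Finset.smul_sum]
    refine Finset.sum_congr rfl fun p hp => ?_
    rw [mul_smul_comm, smul_smul, smul_smul]
    congr 1
    by_cases hpl : p = l
    · subst hpl
      simp [hp, mul_comm]
    · simp [hpl, Ne.symm hpl, mul_comm]
  · have h2 : ∀ m, j < m → ∀ J, braid q j D m J = 0 := by
      intro m hm J
      simp [braid, hm.ne', hm.not_gt]
    have h3 : ∑ m with l < m, a m * braid q j D m (J.erase l) = 0 :=
      Finset.sum_eq_zero fun m hm => by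
        rw [h2 m (hjl.trans (by simpa using hm)), mul_zero]
    rw [transfer, h3, smul_zero, ite_self, add_zero]
    simp [braid, hjl.ne', hjl.not_gt]

/-- The commutation relations between two rows `a` and `b` of a quantized matrix, `a` being above
`b`. -/
structure QAbove (q : k) (a b : C → M) : Prop where
  same (j : C) : a j * b j = q • (b j * a j)
  comm (l j : C) (h : l < j) : a j * b l = b l * a j
  diag (l j : C) (h : l < j) : a l * b j = b j * a l + (q - q⁻¹) • (a j * b l)

/-- The commutation relations between the entries of a row of a quantized matrix. -/
def QRow (q : k) (a : C → M) : Prop := ∀ l j : C, l < j → a l * a j = q • (a j * a l)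

lemma wedgeRow_contract [Fintype C] {q c d : k} {a z : C → M}
    (h : ∀ p m, a p * z m = c • ((if p = m then q else 1) • (z m * a p) +
      if p < m then (q - q⁻¹) • (z p * a m) else 0) - d • (z p * a m)) (G : C → Finset C → M) :
    wedgeRow q a (contract z G) =
      c • contract z (transfer q a G) - d • wedgeRow q z (contract a G) := by
  ext J
  have h1 : ∀ m p, a p * (z m * G m (J.erase p)) =
      (c * if p = m then q else 1) • (z m * (a p * G m (J.erase p))) +
      (if p < m then (c * (q - q⁻¹)) • (z p * (a m * G m (J.erase p))) else 0) -
      d • (z p * (a m * G m (J.erase p))) := by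
    intro m p
    rw [← mul_assoc, h]
    split_ifs <;> simp [sub_mul, add_mul, mul_assoc, smul_smul]
  have h2 : wedgeRow q z (contract a G) J = ∑ p ∈ J, ∑ m, (-q) ^ (rankBelow J p : ℤ) •
      (z p * (a m * G m (J.erase p))) := by
    simp only [wedgeRow_apply, contract, Finset.mul_sum, Finset.smul_sum]
  have h3 : contract z (transfer q a G) J =
      (∑ p ∈ J, ∑ m, ((-q) ^ (rankBelow J p : ℤ) * if p = m then q else 1) •
        (z m * (a p * G m (J.erase p)))) +
      ∑ p ∈ J, ∑ m, if p < m then ((-q) ^ (rankBelow J p : ℤ) * (q - q⁻¹)) •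
        (z p * (a m * G m (J.erase p))) else 0 := by
    simp only [contract, transfer, mul_add, Finset.sum_add_distrib, Finset.mul_sum]
    congr 1
    · rw [Finset.sum_comm]
      simp only [mul_smul_comm]
    · simp only [mul_ite, mul_zero]
      rw [← Finset.sum_filter]
      simp only [Finset.filter_mem_eq_inter, Finset.univ_inter]
      refine Finset.sum_congr rfl fun p _ => ?_
      rw [← Finset.sum_filter, Finset.smul_sum, Finset.mul_sum]
      simp only [mul_smul_comm]
  rw [Pi.sub_apply, Pi.smul_apply, Pi.smul_apply, h2, h3]
  simp only [wedgeRow_apply, contract, Finset.mul_sum, Finset.smul_sum, smul_add,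
    ← Finset.sum_add_distrib, ← Finset.sum_sub_distrib]
  refine Finset.sum_congr rfl fun p _ => Finset.sum_congr rfl fun m _ => ?_
  rw [h1]
  simp only [smul_sub, smul_add, smul_ite, smul_zero, smul_smul]
  congr 1
  · congr 1
    · congr 1; ring
    · split_ifs
      · congr 1; ring
      · rfl
  · congr 1; ring

lemma QAbove.wedgeRow_contract [Fintype C] {q : k} {a z : C → M} (h : QAbove q a z)
    (G : C → Finset C → M) :
    wedgeRow q a (contract z G) = contract z (transfer q a G) := by
  rw [_root_.wedgeRow_contract (c := 1) (d := 0), one_smul, zero_smul, sub_zero]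
  intro p m
  rcases lt_trichotomy p m with hpm | rfl | hpm
  · rw [if_neg hpm.ne, if_pos hpm, h.diag _ _ hpm, h.comm _ _ hpm]
    simp
  · simp [h.same]
  · simp [h.comm _ _ hpm, hpm.ne', hpm.not_gt]

lemma QAbove.wedgeRow_contract_of_below [Fintype C] {q : k} (hq : q ≠ 0) {a z : C → M}
    (h : QAbove q z a) (G : C → Finset C → M) :
    wedgeRow q a (contract z G) =
      contract z (transfer q a G) - (q - q⁻¹) • wedgeRow q z (contract a G) := by
  rw [_root_.wedgeRow_contract (c := 1) (d := q - q⁻¹), one_smul]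
  intro p m
  rcases lt_trichotomy p m with hpm | rfl | hpm
  · rw [if_neg hpm.ne, if_pos hpm, h.comm _ _ hpm]
    simp
  · simp [h.same, smul_smul, ← sub_smul, sub_mul, hq]
  · simp [h.diag _ _ hpm, h.comm _ _ hpm, hpm.ne', hpm.not_gt]

lemma QRow.wedgeRow_contract [Fintype C] {q : k} (hq : q ≠ 0) {z : C → M} (h : QRow q z)
    (G : C → Finset C → M) :
    wedgeRow q z (contract z G) = q⁻¹ • contract z (transfer q z G) := by
  rw [_root_.wedgeRow_contract (c := q⁻¹) (d := 0), zero_smul, sub_zero]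
  intro p m
  rcases lt_trichotomy p m with hpm | rfl | hpm
  · rw [if_neg hpm.ne, if_pos hpm, h _ _ hpm, one_smul, zero_smul, sub_zero, smul_add, smul_smul,
      smul_smul, ← add_smul]
    congr 1
    field_simp
    ring
  · simp [smul_smul, hq]
  · simp [h _ _ hpm, hpm.ne', hpm.not_gt, smul_smul, hq]

/-- Two forms multiply as the sum over pairs `l < j` of antisymmetrized coefficients. -/
lemma wedgeRow_wedgeRow {q : k} (hq : q ≠ 0) (a b : C → M) (F : Finset C → M) (J : Finset C) :
    wedgeRow q a (wedgeRow q b F) J = ∑ l ∈ J, ∑ j ∈ J, if l < j then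
      (-q) ^ ((rankBelow J l : ℤ) + rankBelow J j) •
        (((-q)⁻¹ • (a l * b j) + a j * b l) * F ((J.erase l).erase j)) else 0 := by
  have hq' : -q ≠ 0 := neg_ne_zero.2 hq
  let f : C → C → M := fun l j => if l = j then 0 else
    (-q) ^ ((rankBelow J l : ℤ) + rankBelow J j - if l < j then 1 else 0) •
      (a l * (b j * F ((J.erase l).erase j)))
  have h1 : wedgeRow q a (wedgeRow q b F) J = ∑ l ∈ J, ∑ j ∈ J, f l j := by
    rw [wedgeRow_apply]
    refine Finset.sum_congr rfl fun l hl => ?_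
    rw [wedgeRow_apply, ← Finset.add_sum_erase _ _ hl, Finset.mul_sum, Finset.smul_sum]
    simp only [f, if_true, zero_add]
    refine Finset.sum_congr rfl fun j hj => ?_
    rw [if_neg (Finset.ne_of_mem_erase hj).symm, rankBelow_erase hl, mul_smul_comm, smul_smul,
      ← zpow_add₀ hq', add_sub_assoc]
  have h2 : ∀ l j, f l j = (if l < j then f l j else 0) + if j < l then f l j else 0 := by
    intro l j
    rcases lt_trichotomy l j with h | rfl | h
    · simp [h, h.not_gt]
    · simp [f]
    · simp [h, h.not_gt]
  rw [h1, Finset.sum_congr rfl fun l _ => Finset.sum_congr rfl fun j _ => h2 l j]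
  simp only [Finset.sum_add_distrib]
  rw [Finset.sum_comm (f := fun l j => if j < l then _ else _)]
  simp only [← Finset.sum_add_distrib]
  refine Finset.sum_congr rfl fun l _ => Finset.sum_congr rfl fun j _ => ?_
  split_ifs with h
  · simp only [f, h.ne, h.ne', h, h.not_gt, if_true, if_false, sub_zero]
    rw [Finset.erase_right_comm, add_mul, smul_add, smul_mul_assoc, smul_smul, mul_assoc,
      mul_assoc, zpow_sub₀ hq', zpow_one, div_eq_mul_inv, add_comm (rankBelow J j : ℤ)]
  · simp

lemma QRow.wedgeRow_wedgeRow {q : k} (hq : q ≠ 0) {a : C → M} (h : QRow q a)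
    (F : Finset C → M) : wedgeRow q a (wedgeRow q a F) = 0 := by
  ext J
  rw [_root_.wedgeRow_wedgeRow hq]
  refine Finset.sum_eq_zero fun l _ => Finset.sum_eq_zero fun j _ => ?_
  split_ifs with hlj
  · rw [h _ _ hlj, smul_smul, inv_neg, neg_mul, inv_mul_cancel₀ hq]
    simp
  · rfl

lemma QAbove.wedgeRow_wedgeRow {q : k} (hq : q ≠ 0) {a b : C → M} (h : QAbove q a b)
    (F : Finset C → M) :
    wedgeRow q b (wedgeRow q a F) = (-q) • wedgeRow q a (wedgeRow q b F) := by
  ext J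
  rw [Pi.smul_apply, _root_.wedgeRow_wedgeRow hq, _root_.wedgeRow_wedgeRow hq, Finset.smul_sum]
  refine Finset.sum_congr rfl fun l _ => ?_
  rw [Finset.smul_sum]
  refine Finset.sum_congr rfl fun j _ => ?_
  split_ifs with hlj
  · rw [smul_comm]
    congr 1
    rw [← smul_mul_assoc (-q) _ (F _)]
    congr 1
    have h1 : b j * a l = a l * b j - (q - q⁻¹) • (a j * b l) := by
      rw [h.diag _ _ hlj, add_sub_cancel_right]
    rw [← h.comm _ _ hlj, h1, smul_add, smul_smul, mul_inv_cancel₀ (neg_ne_zero.2 hq)]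
    module
  · simp

lemma wedge_mul_sub_mem [Fintype C] {q : k} (hq : q ≠ 0) (K : Submodule k (Finset C → M))
    (z : C → M) (L : List (C → M)) (hK : ∀ a ∈ L, ∀ F ∈ K, wedgeRow q a F ∈ K)
    (hL : ∀ a ∈ L, ∀ G, wedgeRow q a (contract z G) - contract z (transfer q a G) ∈ K) (j : C) :
    (fun J => wedge q L J * z j) - contract z (braid q j (wedge q L)) ∈ K := by
  induction L with
  | nil =>
    convert K.zero_mem
    ext J
    have : ∀ l, z l * braid q j (wedge q []) l J =
        if l = j then (if J = ∅ then z j else 0) else 0 := by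
      intro l
      by_cases hl : l = j
      · subst hl
        by_cases hJ : J = ∅
        · simp [braid, wedge, hJ]
        · simp [braid, wedge, hJ]
      · simp [braid, wedge, hl]
    simp only [Pi.sub_apply, contract, this]
    simp [wedge]
  | cons a L ih =>
    have h1 := hK a (by simp) _ (ih (fun b hb => hK b (by simp [hb])) fun b hb => hL b (by simp [hb]))
    have h2 := K.add_mem h1 (hL a (by simp) (braid q j (wedge q L)))
    rw [map_sub, wedgeRow_mul_right, transfer_braid hq, sub_add_sub_cancel] at h2
    exact h2

lemma contract_braid [Fintype C] {q : k} {z : C → M} {j : C} {J : Finset C}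
    (hJ : j ∈ J ∨ ∀ c ∈ J, j < c) (D : Finset C → M) :
    contract z (braid q j D) J = (if j ∈ J then q else 1) • (z j * D J) := by
  rw [contract, Finset.sum_eq_single j]
  · simp [braid]
  · intro l _ hlj
    have : ¬ (l < j ∧ l ∈ J ∧ j ∉ J) := by
      rintro ⟨h1, h2, h3⟩
      rcases hJ with hJ | hJ
      · exact h3 hJ
      · exact (hJ l h2).not_gt h1
    simp [braid, hlj, this]
  · simp

lemma wedge_mul_of_above [Fintype C] {q : k} (hq : q ≠ 0) {z : C → M} {L : List (C → M)}
    (hL : ∀ a ∈ L, QAbove q a z) {j : C} {J : Finset C} (hJ : j ∈ J ∨ ∀ c ∈ J, j < c) :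
    wedge q L J * z j = (if j ∈ J then q else 1) • (z j * wedge q L J) := by
  have := wedge_mul_sub_mem hq ⊥ z L (by simp)
    (fun a ha G => by simp [(hL a ha).wedgeRow_contract]) j
  rw [Submodule.mem_bot, sub_eq_zero] at this
  rw [← contract_braid hJ, ← this]

lemma wedge_cons_mul [Fintype C] {q : k} (hq : q ≠ 0) {z : C → M} (hz : QRow q z)
    {L : List (C → M)} (hL : ∀ a ∈ L, QAbove q a z ∨ QAbove q z a) {j : C} {J : Finset C}
    (hJ : j ∈ J ∨ ∀ c ∈ J, j < c) :
    wedge q (z :: L) J * z j =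
      (q⁻¹ * if j ∈ J then q else 1) • (z j * wedge q (z :: L) J) := by
  have := wedge_mul_sub_mem hq (LinearMap.ker (wedgeRow q z)) z L
    (by
      intro a ha F hF
      rw [LinearMap.mem_ker] at hF ⊢
      rcases hL a ha with h | h
      · rw [h.wedgeRow_wedgeRow hq, hF, map_zero, smul_zero]
      · have h1 := h.wedgeRow_wedgeRow hq F
        rw [hF, map_zero] at h1
        exact (smul_eq_zero.1 h1.symm).resolve_left (neg_ne_zero.2 hq))
    (by
      intro a ha G
      rw [LinearMap.mem_ker]
      rcases hL a ha with h | h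
      · rw [h.wedgeRow_contract, sub_self, map_zero]
      · rw [h.wedgeRow_contract_of_below hq, sub_sub_cancel_left, map_neg, map_smul,
          hz.wedgeRow_wedgeRow hq, smul_zero, neg_zero]) j
  rw [LinearMap.mem_ker, map_sub, sub_eq_zero, wedgeRow_mul_right, hz.wedgeRow_contract hq,
    transfer_braid hq] at this
  have h2 := congrFun this J
  rw [Pi.smul_apply, contract_braid hJ, smul_smul] at h2
  exact h2

lemma wedge_perm {R : Type*} {q : k} (hq : q ≠ 0) {Z : R → C → M}
    (hZ : ∀ s t, s ≠ t → QAbove q (Z s) (Z t) ∨ QAbove q (Z t) (Z s)) {L L' : List R}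
    (h : L.Perm L') (hL : L.Nodup) :
    ∃ c : k, c ≠ 0 ∧ wedge q (L.map Z) = c • wedge q (L'.map Z) := by
  induction h with
  | nil => exact ⟨1, one_ne_zero, by simp⟩
  | cons x _ ih =>
    obtain ⟨c, hc, h⟩ := ih hL.of_cons
    exact ⟨c, hc, by simp [wedge, h]⟩
  | swap x y l =>
    have hxy : x ≠ y := by
      rintro rfl
      simp at hL
    rcases hZ x y hxy with h | h
    · exact ⟨-q, neg_ne_zero.2 hq, h.wedgeRow_wedgeRow hq _⟩
    · refine ⟨(-q)⁻¹, inv_ne_zero (neg_ne_zero.2 hq), ?_⟩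
      simp only [List.map_cons, wedge]
      rw [h.wedgeRow_wedgeRow hq, smul_smul, inv_mul_cancel₀ (neg_ne_zero.2 hq), one_smul]
  | trans h1 _ ih1 ih2 =>
    obtain ⟨c, hc, h⟩ := ih1 hL
    obtain ⟨c', hc', h'⟩ := ih2 (h1.nodup_iff.1 hL)
    exact ⟨c * c', mul_ne_zero hc hc', by rw [h, h', smul_smul]⟩

lemma wedge_mul_of_mem [Fintype C] {R : Type*} {q : k} (hq : q ≠ 0) {Z : R → C → M}
    (hZ : ∀ s t, s ≠ t → QAbove q (Z s) (Z t) ∨ QAbove q (Z t) (Z s)) (hrow : ∀ s, QRow q (Z s))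
    {L : List R} (hL : L.Nodup) {i : R} (hi : i ∈ L) {j : C} {J : Finset C}
    (hJ : j ∈ J ∨ ∀ c ∈ J, j < c) :
    wedge q (L.map Z) J * Z i j =
      (q⁻¹ * if j ∈ J then q else 1) • (Z i j * wedge q (L.map Z) J) := by
  classical
  have hp := List.perm_cons_erase hi
  obtain ⟨c, -, h⟩ := wedge_perm hq hZ hp hL
  have hL' := hp.nodup_iff.1 hL
  rw [h, Pi.smul_apply, smul_mul_assoc, mul_smul_comm, smul_comm _ c, List.map_cons,
    wedge_cons_mul hq (hrow i) _ hJ]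
  intro a ha
  obtain ⟨s, hs, rfl⟩ := List.mem_map.1 ha
  exact hZ s i fun h => (List.nodup_cons.1 hL').1 (h ▸ hs)

lemma wedge_rev {r : ℕ} {q : k} (hq : q ≠ 0) (L : List (Fin r → M)) :
    ∃ c : ℕ → k, (∀ n, c n ≠ 0) ∧ ∀ J : Finset (Fin r),
      wedge q⁻¹ (L.map (· ∘ Fin.rev)) (J.image Fin.rev) = c J.card • wedge q L J := by
  have hq' : -q⁻¹ ≠ 0 := neg_ne_zero.2 (inv_ne_zero hq)
  induction L with
  | nil => exact ⟨1, by simp, by simp [wedge]⟩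
  | cons a L ih =>
    obtain ⟨c, hc, h⟩ := ih
    refine ⟨fun n => (-q⁻¹) ^ ((n : ℤ) - 1) * c (n - 1),
      fun n => mul_ne_zero (zpow_ne_zero _ hq') (hc _), fun J => ?_⟩
    simp only [List.map_cons, wedge]
    rw [wedgeRow_apply, wedgeRow_apply, Finset.sum_image (by simp), Finset.smul_sum]
    refine Finset.sum_congr rfl fun p hp => ?_
    have hrank : (rankBelow (J.image Fin.rev) (Fin.rev p) : ℤ) = J.card - 1 - rankBelow J p := by
      have h1 : rankBelow (J.image Fin.rev) (Fin.rev p) = (J.filter (p < ·)).card := by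
        unfold rankBelow
        rw [Finset.filter_image, Finset.card_image_of_injective _ Fin.rev_injective]
        simp
      have h2 := Finset.card_filter_add_card_filter_not (s := J) (p < ·)
      have h3 : J.filter (fun x => ¬ p < x) = insert p (J.filter (· < p)) := by
        ext x
        simp only [not_lt, Finset.mem_filter, Finset.mem_insert, le_iff_eq_or_lt]
        constructor
        · rintro ⟨hx, rfl | hx'⟩
          · exact Or.inl rfl
          · exact Or.inr ⟨hx, hx'⟩
        · rintro (rfl | hx)
          · exact ⟨hp, Or.inl rfl⟩
          · exact ⟨hx.1, Or.inr hx.2⟩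
      rw [h3, Finset.card_insert_of_notMem (by simp)] at h2
      rw [h1, rankBelow]
      omega
    rw [hrank, ← Finset.image_erase Fin.rev_injective, h, Finset.card_erase_of_mem hp,
      Function.comp_apply, Fin.rev_rev, mul_smul_comm, smul_smul, smul_smul, zpow_sub₀ hq']
    congr 1
    rw [neg_inv, inv_zpow (-q) (rankBelow J p), div_inv_eq_mul]
    ring

lemma QAbove.rev {r : ℕ} {q : k} (hq : q ≠ 0) {a b : Fin r → M} (h : QAbove q a b) :
    QAbove q⁻¹ (b ∘ Fin.rev) (a ∘ Fin.rev) where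
  same j := by
    simp [h.same, smul_smul, hq]
  comm l j hlj := (h.comm _ _ (Fin.rev_lt_rev.2 hlj)).symm
  diag l j hlj := by
    have h' := Fin.rev_lt_rev.2 hlj
    simp only [Function.comp_apply]
    rw [h.diag _ _ h', h.comm _ _ h', inv_inv, add_assoc, ← add_smul]
    simp

lemma QRow.rev {r : ℕ} {q : k} (hq : q ≠ 0) {a : Fin r → M} (h : QRow q a) :
    QRow q⁻¹ (a ∘ Fin.rev) := by
  intro l j hlj
  simp only [Function.comp_apply]
  rw [h _ _ (Fin.rev_lt_rev.2 hlj), smul_smul, inv_mul_cancel₀ hq, one_smul]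

lemma wedge_mul_of_below {r : ℕ} {q : k} (hq : q ≠ 0) {z : Fin r → M} {L : List (Fin r → M)}
    (hL : ∀ a ∈ L, QAbove q z a) {j : Fin r} {J : Finset (Fin r)}
    (hJ : j ∈ J ∨ ∀ c ∈ J, c < j) :
    wedge q L J * z j = (if j ∈ J then q⁻¹ else 1) • (z j * wedge q L J) := by
  obtain ⟨c, hc, h⟩ := wedge_rev hq L
  have key := wedge_mul_of_above (inv_ne_zero hq) (z := z ∘ Fin.rev)
    (L := L.map (· ∘ Fin.rev)) (j := Fin.rev j) (J := J.image Fin.rev)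
    (by
      intro a ha
      obtain ⟨b, hb, rfl⟩ := List.mem_map.1 ha
      exact (hL b hb).rev hq) (by simpa using hJ)
  rw [h, smul_mul_assoc, mul_smul_comm, smul_comm _ (c _)] at key
  simpa using smul_right_injective M (hc _) key

lemma wedge_mul_of_mem' {r : ℕ} {R : Type*} {q : k} (hq : q ≠ 0) {Z : R → Fin r → M}
    (hZ : ∀ s t, s ≠ t → QAbove q (Z s) (Z t) ∨ QAbove q (Z t) (Z s)) (hrow : ∀ s, QRow q (Z s))
    {L : List R} (hL : L.Nodup) {i : R} (hi : i ∈ L) {j : Fin r} {J : Finset (Fin r)}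
    (hJ : j ∈ J ∨ ∀ c ∈ J, c < j) :
    wedge q (L.map Z) J * Z i j =
      (q * if j ∈ J then q⁻¹ else 1) • (Z i j * wedge q (L.map Z) J) := by
  obtain ⟨c, hc, h⟩ := wedge_rev hq (L.map Z)
  have key := wedge_mul_of_mem (inv_ne_zero hq) (Z := fun s => Z s ∘ Fin.rev)
    (fun s t hst => (hZ s t hst).symm.imp (·.rev hq) (·.rev hq)) (fun s => (hrow s).rev hq)
    hL hi (j := Fin.rev j) (J := J.image Fin.rev) (by simpa using hJ)
  rw [List.map_map] at h
  change wedge q⁻¹ (L.map ((· ∘ Fin.rev) ∘ Z)) _ * _ =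
    _ • (_ * wedge q⁻¹ (L.map ((· ∘ Fin.rev) ∘ Z)) _) at key
  rw [h, smul_mul_assoc, mul_smul_comm, smul_comm _ (c _)] at key
  simpa using smul_right_injective M (hc _) key

end QuantumWedge

section Laplace

/-- The permutation of `Fin (t + 1)` sending `0` to `p` and acting as `τ` on the rest, relabelled
in increasing order. -/
def permCons {t : ℕ} (p : Fin (t + 1)) (τ : Equiv.Perm (Fin t)) : Equiv.Perm (Fin (t + 1)) :=
  (Equiv.Perm.decomposeFin.symm (0, τ)).trans p.cycleRange.symm

lemma permCons_zero {t : ℕ} (p : Fin (t + 1)) (τ : Equiv.Perm (Fin t)) : permCons p τ 0 = p := by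
  simp [permCons]

lemma permCons_succ {t : ℕ} (p : Fin (t + 1)) (τ : Equiv.Perm (Fin t)) (a : Fin t) :
    permCons p τ a.succ = p.succAbove (τ a) := by
  simp [permCons]

lemma permCons_bijective (t : ℕ) :
    Function.Bijective fun x : Fin (t + 1) × Equiv.Perm (Fin t) => permCons x.1 x.2 := by
  rw [Fintype.bijective_iff_injective_and_card]
  constructor
  · rintro ⟨p, τ⟩ ⟨p', τ'⟩ h
    have h0 := DFunLike.congr_fun h 0
    simp only [permCons_zero] at h0
    subst h0
    congr 1
    ext a
    have h1 := DFunLike.congr_fun h a.succ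
    simp only [permCons_succ] at h1
    rw [Fin.succAbove_right_injective h1]
  · simp [Fintype.card_perm, Nat.factorial_succ]

lemma invCount_permCons {t : ℕ} (p : Fin (t + 1)) (τ : Equiv.Perm (Fin t)) :
    invCount (permCons p τ) = p + invCount τ := by
  have h1 : ∑ b : Fin t, (if p.succAbove (τ b) < p then 1 else 0) = (p : ℕ) := by
    rw [Equiv.sum_comp τ fun b => if p.succAbove b < p then 1 else 0]
    have : ∀ b : Fin t, p.succAbove b < p ↔ (b : ℕ) < p := fun b => by
      rw [Fin.succAbove_lt_iff_castSucc_lt, Fin.lt_def, Fin.val_castSucc]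
    simp only [this, Finset.sum_boole, Nat.cast_id]
    rw [Fin.card_filter_val_lt]
    omega
  unfold invCount
  simp only [Finset.card_filter, Fintype.sum_prod_type, Fin.sum_univ_succ, permCons_zero,
    permCons_succ, Fin.succ_pos, Fin.succ_lt_succ_iff, Fin.succAbove_lt_succAbove_iff, true_and,
    false_and, if_false, Fin.not_lt_zero, zero_add, h1]

variable {k M C : Type*} [Field k] [Ring M] [Algebra k M] [LinearOrder C]

lemma rankBelow_image {t : ℕ} {col : Fin t → C} (hcol : StrictMono col) (p : Fin t) :
    rankBelow (Finset.univ.image col) (col p) = p := by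
  unfold rankBelow
  rw [Finset.filter_image, Finset.card_image_of_injective _ hcol.injective]
  simp only [hcol.lt_iff_lt, Fin.lt_def]
  rw [Fin.card_filter_val_lt]
  omega

lemma sum_perm_eq_wedge (q : k) (t : ℕ) (A : Fin t → C → M) (col : Fin t → C)
    (hcol : StrictMono col) :
    ∑ σ : Equiv.Perm (Fin t), (-q) ^ invCount σ • (List.ofFn fun a => A a (col (σ a))).prod =
      wedge q (List.ofFn A) (Finset.univ.image col) := by
  induction t with
  | zero => simp [wedge, invCount]
  | succ t ih =>
    rw [← (permCons_bijective t).sum_comp, Fintype.sum_prod_type, List.ofFn_succ, wedge,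
      wedgeRow_apply, Finset.sum_image (fun a _ b _ h => hcol.injective h)]
    refine Finset.sum_congr rfl fun p _ => ?_
    have himg : (Finset.univ.image col).erase (col p) = Finset.univ.image (col ∘ p.succAbove) := by
      rw [← Finset.image_erase hcol.injective, ← Finset.image_image, Fin.image_succAbove_univ]
      congr 1
      ext; simp
    rw [himg, ← ih (fun a => A a.succ) _ (hcol.comp p.strictMono_succAbove),
      rankBelow_image hcol, Finset.mul_sum, Finset.smul_sum]
    refine Finset.sum_congr rfl fun τ _ => ?_
    rw [List.ofFn_succ, List.prod_cons, invCount_permCons, pow_add, mul_smul, zpow_natCast]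
    simp only [permCons_zero, permCons_succ, mul_smul_comm, Function.comp_apply]

end Laplace

section QuantizedMatrices

variable {k : Type} [Field k] {q : k} {n r : ℕ}

lemma qAbove_Zgen {s i : Fin n} (h : s < i) :
    QAbove q (Zgen k q n r s) (Zgen k q n r i) where
  same j := by
    simpa [Zgen] using RingQuot.mkAlgHom_rel k (QMatRel.col (q := q) s i j h)
  comm l j hlj := by
    simpa [Zgen] using RingQuot.mkAlgHom_rel k (QMatRel.cross (q := q) s i j l h hlj)
  diag l j hlj := by
    simpa [Zgen] using RingQuot.mkAlgHom_rel k (QMatRel.diag (q := q) s i l j h hlj)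

lemma qRow_Zgen (i : Fin n) : QRow q (Zgen k q n r i) := fun l j hlj => by
  simpa [Zgen] using RingQuot.mkAlgHom_rel k (QMatRel.row (q := q) i l j hlj)

lemma qAbove_Zgen_or {s i : Fin n} (h : s ≠ i) :
    QAbove q (Zgen k q n r s) (Zgen k q n r i) ∨ QAbove q (Zgen k q n r i) (Zgen k q n r s) :=
  (lt_or_gt_of_ne h).imp qAbove_Zgen qAbove_Zgen

lemma mem_center_of_commute_Zgen {z : QMat k q n r}
    (h : ∀ i j, z * Zgen k q n r i j = Zgen k q n r i j * z) :
    z ∈ Subalgebra.center k (QMat k q n r) := by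
  rw [Subalgebra.mem_center_iff]
  intro b
  obtain ⟨b, rfl⟩ := RingQuot.mkAlgHom_surjective k (QMatRel k q n r) b
  induction b with
  | grade0 c => rw [AlgHom.commutes]; exact Algebra.commutes c z
  | grade1 x => exact (h x.1 x.2).symm
  | mul a b ha hb => rw [map_mul, mul_assoc, hb, ← mul_assoc, ha, mul_assoc]
  | add a b ha hb => rw [map_add, add_mul, mul_add, ha, hb]

lemma qMinor_eq_wedge {t : ℕ} (row : Fin t → Fin n) {col : Fin t → Fin r} (hcol : StrictMono col) :
    qMinor k q n r t row col =
      wedge q ((List.ofFn row).map (Zgen k q n r)) (Finset.univ.image col) := by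
  rw [List.map_ofFn]
  exact sum_perm_eq_wedge q t _ col hcol

variable {t : ℕ} {row : Fin t → Fin n} {col : Fin t → Fin r}

lemma qMinor_mul_of_above (hq : q ≠ 0) (hcol : StrictMono col) {i : Fin n} {j : Fin r}
    (hi : ∀ a, row a < i) (hj : (∃ a, col a = j) ∨ ∀ a, j < col a) :
    qMinor k q n r t row col * Zgen k q n r i j =
      q ^ (if ∃ a, col a = j then 1 else 0 : ℤ) • (Zgen k q n r i j * qMinor k q n r t row col) := by
  rw [qMinor_eq_wedge row hcol, wedge_mul_of_above hq _ (by simpa using hj)]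
  · congr 1
    simp only [Finset.mem_image, Finset.mem_univ, true_and]
    split_ifs <;> simp
  · simpa [List.mem_ofFn] using fun a => qAbove_Zgen (hi a)

lemma qMinor_mul_of_below (hq : q ≠ 0) (hcol : StrictMono col) {i : Fin n} {j : Fin r}
    (hi : ∀ a, i < row a) (hj : (∃ a, col a = j) ∨ ∀ a, col a < j) :
    qMinor k q n r t row col * Zgen k q n r i j =
      q ^ (if ∃ a, col a = j then -1 else 0 : ℤ) •
        (Zgen k q n r i j * qMinor k q n r t row col) := by
  rw [qMinor_eq_wedge row hcol, wedge_mul_of_below hq _ (by simpa using hj)]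
  · congr 1
    simp only [Finset.mem_image, Finset.mem_univ, true_and]
    split_ifs <;> simp
  · simpa [List.mem_ofFn] using fun a => qAbove_Zgen (hi a)

lemma qMinor_mul_of_mem (hq : q ≠ 0) (hrow : Function.Injective row) (hcol : StrictMono col)
    {i : Fin n} {j : Fin r} (hi : ∃ a, row a = i) (hj : (∃ a, col a = j) ∨ ∀ a, j < col a) :
    qMinor k q n r t row col * Zgen k q n r i j =
      q ^ (if ∃ a, col a = j then 0 else -1 : ℤ) •
        (Zgen k q n r i j * qMinor k q n r t row col) := by
  rw [qMinor_eq_wedge row hcol, wedge_mul_of_mem hq (fun s t => qAbove_Zgen_or) qRow_Zgen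
    (List.nodup_ofFn.2 hrow) (by simpa [List.mem_ofFn] using hi) (by simpa using hj)]
  congr 1
  simp only [Finset.mem_image, Finset.mem_univ, true_and]
  split_ifs <;> simp [hq]

lemma qMinor_mul_of_mem' (hq : q ≠ 0) (hrow : Function.Injective row) (hcol : StrictMono col)
    {i : Fin n} {j : Fin r} (hi : ∃ a, row a = i) (hj : (∃ a, col a = j) ∨ ∀ a, col a < j) :
    qMinor k q n r t row col * Zgen k q n r i j =
      q ^ (if ∃ a, col a = j then 0 else 1 : ℤ) •
        (Zgen k q n r i j * qMinor k q n r t row col) := by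
  rw [qMinor_eq_wedge row hcol, wedge_mul_of_mem' hq (fun s t => qAbove_Zgen_or) qRow_Zgen
    (List.nodup_ofFn.2 hrow) (by simpa [List.mem_ofFn] using hi) (by simpa using hj)]
  congr 1
  simp only [Finset.mem_image, Finset.mem_univ, true_and]
  split_ifs <;> simp [hq]

/-- The exponent of `q` picked up when `Ψ_t` moves past the generator with (zero-based) row `i` and
column `j`. -/
def psiExp (n r : ℕ) (t : ℤ) (i j : ℕ) : ℤ :=
  (if t + r ≤ i + 1 then 1 else 0) - (if (i : ℤ) + 1 < t then 1 else 0) -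
    (if (j : ℤ) + t ≤ 0 then 1 else 0) + (if (n : ℤ) + 1 ≤ j + t then 1 else 0)

/-- The exponent of `q` picked up when a minor on `t` consecutive rows from `u` and columns
from `v` moves past the generator in row `i` and column `j`. -/
def minorExp (u v t i j : ℕ) : ℤ :=
  (if u + t ≤ i then 1 else 0) - (if i < u then 1 else 0) -
    (if j < v then 1 else 0) + (if v + t ≤ j then 1 else 0)

lemma qMinor_interval_mul (hq : q ≠ 0) (hn : 0 < n) (hr : 0 < r) {u v t : ℕ} (hu : u + t ≤ n)
    (hv : v + t ≤ r) (hlow : v = 0 ∨ u = 0) (hhigh : v + t = r ∨ u + t = n)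
    (i : Fin n) (j : Fin r) :
    qMinor k q n r t (fun a => ⟨(u + a) % n, Nat.mod_lt _ hn⟩)
        (fun a => ⟨(v + a) % r, Nat.mod_lt _ hr⟩) * Zgen k q n r i j =
      q ^ minorExp u v t i j • (Zgen k q n r i j *
        qMinor k q n r t (fun a => ⟨(u + a) % n, Nat.mod_lt _ hn⟩)
          (fun a => ⟨(v + a) % r, Nat.mod_lt _ hr⟩)) := by
  set row : Fin t → Fin n := fun a => ⟨(u + a) % n, Nat.mod_lt _ hn⟩ with hrow
  set col : Fin t → Fin r := fun a => ⟨(v + a) % r, Nat.mod_lt _ hr⟩ with hcol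
  have hrow' : ∀ a, (row a : ℕ) = u + a := fun a => Nat.mod_eq_of_lt (by have := a.2; omega)
  have hcol' : ∀ a, (col a : ℕ) = v + a := fun a => Nat.mod_eq_of_lt (by have := a.2; omega)
  have hrm : Function.Injective row := fun a b h => by
    have := congrArg Fin.val h
    rw [hrow', hrow'] at this
    ext; omega
  have hcm : StrictMono col := fun a b h => by
    rw [Fin.lt_def, hcol', hcol']
    have : (a : ℕ) < b := h
    omega
  have hi := i.2
  have hj := j.2
  have ecol : (∃ a, col a = j) ↔ v ≤ j ∧ (j : ℕ) < v + t := by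
    constructor
    · rintro ⟨a, rfl⟩
      rw [hcol']
      have := a.2
      omega
    · rintro ⟨h1, h2⟩
      refine ⟨⟨j - v, by omega⟩, Fin.ext ?_⟩
      rw [hcol']
      simp only
      omega
  have erow : (∃ a, row a = i) ↔ u ≤ i ∧ (i : ℕ) < u + t := by
    constructor
    · rintro ⟨a, rfl⟩
      rw [hrow']
      have := a.2
      omega
    · rintro ⟨h1, h2⟩
      refine ⟨⟨i - u, by omega⟩, Fin.ext ?_⟩
      rw [hrow']
      simp only
      omega
  have lcol : (∀ a, j < col a) ∨ (v ≤ j) := by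
    by_cases h : v ≤ j
    · exact Or.inr h
    · exact Or.inl fun a => by rw [Fin.lt_def, hcol']; omega
  have gcol : (∀ a, col a < j) ∨ ((j : ℕ) < v + t) := by
    by_cases h : (j : ℕ) < v + t
    · exact Or.inr h
    · exact Or.inl fun a => by rw [Fin.lt_def, hcol']; have := a.2; omega
  rcases lt_or_ge (i : ℕ) u with h1 | h1
  · rw [qMinor_mul_of_below hq hcm]
    · congr 2
      simp only [ecol, minorExp]
      split_ifs <;> omega
    · intro a
      rw [Fin.lt_def, hrow']
      omega
    · rw [ecol]
      rcases gcol with h | h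
      · exact Or.inr h
      · exact Or.inl ⟨by omega, h⟩
  rcases le_or_gt (u + t) i with h2 | h2
  · rw [qMinor_mul_of_above hq hcm]
    · congr 2
      simp only [ecol, minorExp]
      split_ifs <;> omega
    · intro a
      rw [Fin.lt_def, hrow']
      omega
    · rw [ecol]
      rcases lcol with h | h
      · exact Or.inr h
      · exact Or.inl ⟨h, by omega⟩
  rcases lcol with h | h
  · rw [qMinor_mul_of_mem hq hrm hcm (erow.2 ⟨h1, h2⟩) (Or.inr h)]
    congr 2
    have h' := h ⟨0, by omega⟩
    rw [Fin.lt_def, hcol'] at h'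
    simp only [ecol, minorExp]
    split_ifs <;> omega
  · rw [qMinor_mul_of_mem' hq hrm hcm (erow.2 ⟨h1, h2⟩)]
    · congr 2
      simp only [ecol, minorExp]
      split_ifs <;> omega
    · rw [ecol]
      exact gcol.symm.imp (fun h' => ⟨h, h'⟩) id

lemma Psi_mul_Zgen (hq : q ≠ 0) (hn : 0 < n) (hr : 0 < r) (hrn : r ≤ n) {t : ℤ} (ht : 1 - r ≤ t)
    (ht' : t ≤ n) (i : Fin n) (j : Fin r) :
    Psi k q n r hn hr t * Zgen k q n r i j =
      q ^ psiExp n r t i j • (Zgen k q n r i j * Psi k q n r hn hr t) := by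
  have hi := i.2
  have hj := j.2
  unfold Psi
  split_ifs with h1 h2 h3
  · have : psiExp n r t i j = 0 := by
      unfold psiExp
      split_ifs <;> omega
    simp [this]
  · have := qMinor_interval_mul (q := q) hq hn hr (u := 0) (v := (1 - t).toNat)
      (t := ((r : ℤ) - 1 + t).toNat) (by omega) (by omega) (by omega) (by omega) i j
    simp only [zero_add] at this
    rw [this]
    congr 2
    unfold psiExp minorExp
    split_ifs <;> omega
  · have := qMinor_interval_mul (q := q) hq hn hr (u := (t - 1).toNat) (v := 0)
      (t := r) (by omega) (by omega) (by omega) (by omega) i j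
    simp only [zero_add] at this
    rw [this]
    congr 2
    unfold psiExp minorExp
    split_ifs <;> omega
  · have := qMinor_interval_mul (q := q) hq hn hr (u := (t - 1).toNat) (v := 0)
      (t := ((n : ℤ) + 1 - t).toNat) (by omega) (by omega) (by omega) (by omega) i j
    simp only [zero_add] at this
    rw [this]
    congr 2
    unfold psiExp minorExp
    split_ifs <;> omega

lemma alternating_sum_psiExp {n r x y s : ℕ} (hrs : r = x * s) (hns : n = y * s) (hx : Odd x)
    (hy : Odd y) {a : ℕ} (ha1 : 1 ≤ a) (has : a ≤ s) {i j : ℕ} (hi : i < n) (hj : j < r) :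
    ∑ t ∈ Finset.range (x + y), (-1) ^ t * psiExp n r (a + ((t : ℤ) - x) * s) i j = 0 := by
  let f : ℕ → ℤ := fun t => if a + t * s ≤ i + 1 then 1 else 0
  let g : ℕ → ℤ := fun t => if j + a + t * s ≤ x * s then 1 else 0
  have hf : ∀ t, f (y + t) = 0 := fun t => by
    refine if_neg ?_
    rw [add_mul]
    omega
  have hg : ∀ t, g (x + t) = 0 := fun t => by
    refine if_neg ?_
    rw [add_mul]
    omega
  have s1 : ∀ t : ℕ, (if (a + ((t : ℤ) - x) * s) + r ≤ i + 1 then (1 : ℤ) else 0) = f t := by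
    intro t
    refine if_congr ?_ rfl rfl
    rw [hrs]
    zify
    constructor <;> intro h <;> linarith
  have s3 : ∀ t : ℕ, (if (j : ℤ) + (a + ((t : ℤ) - x) * s) ≤ 0 then (1 : ℤ) else 0) = g t := by
    intro t
    refine if_congr ?_ rfl rfl
    zify
    constructor <;> intro h <;> linarith
  have s2 : ∀ t : ℕ, t < x → (if (i : ℤ) + 1 < a + ((t : ℤ) - x) * s then (1 : ℤ) else 0) = 0 := by
    intro t ht
    refine if_neg ?_
    have : ((t : ℤ) - x) * s ≤ (-1) * s := mul_le_mul_of_nonneg_right (by omega) (by omega)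
    omega
  have s2' : ∀ t : ℕ,
      (if (i : ℤ) + 1 < a + (((x + t : ℕ) : ℤ) - x) * s then (1 : ℤ) else 0) = 1 - f t := by
    intro t
    have : (((x + t : ℕ) : ℤ) - x) * s = ((t * s : ℕ) : ℤ) := by push_cast; ring
    rw [this]
    simp only [f]
    split_ifs <;> omega
  have s4 : ∀ t : ℕ, t < y →
      (if (n : ℤ) + 1 ≤ j + (a + ((t : ℤ) - x) * s) then (1 : ℤ) else 0) = 0 := by
    intro t ht
    refine if_neg ?_
    have : ((t : ℤ) - x) * s ≤ (y - 1 - x) * s := mul_le_mul_of_nonneg_right (by omega) (by omega)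
    have h2 : ((y : ℤ) - 1 - x) * s = n - s - r := by rw [hrs, hns]; push_cast; ring
    omega
  have s4' : ∀ t : ℕ,
      (if (n : ℤ) + 1 ≤ j + (a + (((y + t : ℕ) : ℤ) - x) * s) then (1 : ℤ) else 0) = 1 - g t := by
    intro t
    have : (((y + t : ℕ) : ℤ) - x) * s = n + ((t * s : ℕ) : ℤ) - ((x * s : ℕ) : ℤ) := by
      rw [hns]; push_cast; ring
    rw [this]
    simp only [g]
    split_ifs <;> omega
  have alt : ∀ u : ℕ, Odd u → ∑ t ∈ Finset.range u, (-1 : ℤ) ^ t = 1 := fun u hu => by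
    rw [neg_one_geom_sum, if_neg (Nat.not_even_iff_odd.2 hu)]
  simp only [psiExp, mul_add, mul_sub, Finset.sum_add_distrib, Finset.sum_sub_distrib, s1, s3]
  have e1 : ∑ t ∈ Finset.range (x + y), (-1 : ℤ) ^ t * f t =
      ∑ t ∈ Finset.range y, (-1 : ℤ) ^ t * f t := by
    rw [add_comm, Finset.sum_range_add]
    simp [hf]
  have e3 : ∑ t ∈ Finset.range (x + y), (-1 : ℤ) ^ t * g t =
      ∑ t ∈ Finset.range x, (-1 : ℤ) ^ t * g t := by
    rw [Finset.sum_range_add]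
    simp [hg]
  have e2 : ∑ t ∈ Finset.range (x + y), (-1 : ℤ) ^ t *
      (if (i : ℤ) + 1 < a + ((t : ℤ) - x) * s then (1 : ℤ) else 0) =
      ∑ t ∈ Finset.range y, (-1 : ℤ) ^ t * f t - ∑ t ∈ Finset.range y, (-1 : ℤ) ^ t := by
    rw [Finset.sum_range_add, Finset.sum_eq_zero fun t ht => by rw [s2 t (Finset.mem_range.1 ht),
      mul_zero], zero_add, ← Finset.sum_sub_distrib]
    refine Finset.sum_congr rfl fun t _ => ?_
    rw [s2', pow_add, hx.neg_one_pow]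
    ring
  have e4 : ∑ t ∈ Finset.range (x + y), (-1 : ℤ) ^ t *
      (if (n : ℤ) + 1 ≤ j + (a + ((t : ℤ) - x) * s) then (1 : ℤ) else 0) =
      ∑ t ∈ Finset.range x, (-1 : ℤ) ^ t * g t - ∑ t ∈ Finset.range x, (-1 : ℤ) ^ t := by
    rw [add_comm x, Finset.sum_range_add, Finset.sum_eq_zero fun t ht => by
      rw [s4 t (Finset.mem_range.1 ht), mul_zero], zero_add, ← Finset.sum_sub_distrib]
    refine Finset.sum_congr rfl fun t _ => ?_
    rw [s4', pow_add, hy.neg_one_pow]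
    ring
  rw [e1, e2, e3, e4, alt x hx, alt y hy]
  ring

end QuantizedMatrices

section QCommute

variable {k M : Type*} [Field k] [Ring M] [Algebra k M] {q : k} {z : M}

lemma pow_mul_of_mul_eq_zpow_smul (hq : q ≠ 0) {A : M} {e : ℤ} (h : A * z = q ^ e • (z * A))
    (b : ℕ) : A ^ b * z = q ^ (b * e) • (z * A ^ b) := by
  induction b with
  | zero => simp
  | succ b ih =>
    rw [pow_succ, mul_assoc, h, mul_smul_comm, ← mul_assoc, ih, smul_mul_assoc, smul_smul,
      ← zpow_add₀ hq, mul_assoc]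
    congr 2
    push_cast
    ring

lemma prod_ofFn_mul_of_mul_eq_zpow_smul (hq : q ≠ 0) {N : ℕ} {A : Fin N → M} {e : Fin N → ℤ}
    (h : ∀ t, A t * z = q ^ e t • (z * A t)) :
    (List.ofFn A).prod * z = q ^ (∑ t, e t) • (z * (List.ofFn A).prod) := by
  induction N with
  | zero => simp
  | succ N ih =>
    rw [List.ofFn_succ, List.prod_cons, mul_assoc, ih fun t => h t.succ, mul_smul_comm,
      ← mul_assoc, h, smul_mul_assoc, smul_smul, ← zpow_add₀ hq, mul_assoc, Fin.sum_univ_succ,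
      add_comm]

end QCommute

/-- Let `q` be a primitive `m`-th root of unity and suppose
`r = x·s`, `n = y·s` with `x` and `y` odd.  Then for each `a = 1, ..., s` the element
`Z_a = Π_{ℓ = -x}^{y-1} (Ψ_{a + ℓ·s})^{ε_ℓ}` is central in `M_q(n,r)`. -/
theorem Zcentral_mem_center
    (k : Type) [Field k] (q : k) (m : ℕ) (hm : 0 < m) (hq : IsPrimitiveRoot q m)
    (n r x y s : ℕ) (hr : 0 < r) (hrn : r ≤ n)
    (hrs : r = x * s) (hns : n = y * s) (hx : Odd x) (hy : Odd y)
    (a : ℕ) (ha1 : 1 ≤ a) (has : a ≤ s) :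
    Zcentral k q n r (lt_of_lt_of_le hr hrn) hr x y s m a ∈
      Subalgebra.center k (QMat k q n r) := by
  have hq0 : q ≠ 0 := hq.ne_zero hm.ne'
  refine mem_center_of_commute_Zgen fun i j => ?_
  unfold Zcentral
  have hterm : ∀ t : Fin (x + y), _ := fun t =>
    pow_mul_of_mul_eq_zpow_smul hq0
      (Psi_mul_Zgen (t := (a : ℤ) + (((t : ℕ) : ℤ) - (x : ℤ)) * (s : ℤ)) hq0
        (lt_of_lt_of_le hr hrn) hr hrn
        (by
          have h1 : (0 : ℤ) ≤ (t : ℕ) * s := by positivity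
          rw [hrs]
          push_cast
          linarith)
        (by
          have h1 : (((t : ℕ) : ℤ) - x) * s ≤ (y - 1) * s :=
            mul_le_mul_of_nonneg_right (by have := t.2; omega) (by omega)
          rw [hns]
          push_cast
          linarith) i j)
      (if Even (((t : ℕ) : ℤ) - (x : ℤ)) then 1 else m - 1)
  rw [prod_ofFn_mul_of_mul_eq_zpow_smul hq0 hterm]
  convert one_smul k _
  rw [hq.zpow_eq_one_iff_dvd, ← Int.modEq_zero_iff_dvd]
  have hsum := alternating_sum_psiExp hrs hns hx hy ha1 has i.2 j.2
  rw [Finset.sum_range] at hsum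
  have hneg : ∑ t : Fin (x + y), -((-1) ^ (t : ℕ) * psiExp n r (a + ((t : ℕ) - (x : ℤ)) * s) i j) =
      0 := by
    rw [Finset.sum_neg_distrib, hsum, neg_zero]
  rw [← hneg]
  refine Int.ModEq.sum fun t _ => ?_
  rw [← neg_mul]
  refine Int.ModEq.mul_right _ ?_
  have hpar : Even (((t : ℕ) : ℤ) - (x : ℤ)) ↔ Odd (t : ℕ) := by
    rw [Int.even_sub, Int.even_coe_nat, Int.even_coe_nat, ← Nat.not_even_iff_odd]
    have := Nat.not_even_iff_odd.2 hx
    tauto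
  by_cases ht : Odd (t : ℕ)
  · rw [if_pos (hpar.2 ht), ht.neg_one_pow]
    simp [Int.ModEq.refl]
  · rw [if_neg (fun h => ht (hpar.1 h)), (Nat.not_odd_iff_even.1 ht).neg_one_pow]
    rw [Int.modEq_iff_dvd, Nat.cast_sub hm]
    exact ⟨-1, by push_cast; ring⟩
end

section
/- Let m be even and q a primitive m-th root of unity. For all 1 ≤ k < ℓ ≤ n and 1 ≤ i < j ≤ r, the element Z_{k,i}^{m/2} Z_{k,j}^{m/2} Z_{ℓ,i}^{m/2} Z_{ℓ,j}^{m/2} is central in the quasipolynomial algebra M̄_q(n,r). -/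
open scoped BigOperators

/-- Defining relations of the quasipolynomial algebra `M̄_q(n,r)` associated with the
quantized matrix algebra `M_q(n,r)`. -/
inductive QBarRel (k : Type) [Field k] (q : k) (n r : ℕ) :
    FreeAlgebra k (Fin n × Fin r) → FreeAlgebra k (Fin n × Fin r) → Prop
  | row (i : Fin n) (j l : Fin r) (h : j < l) :
      QBarRel k q n r (FreeAlgebra.ι k (i, j) * FreeAlgebra.ι k (i, l))
        (q • (FreeAlgebra.ι k (i, l) * FreeAlgebra.ι k (i, j)))
  | col (i s : Fin n) (j : Fin r) (h : i < s) :
      QBarRel k q n r (FreeAlgebra.ι k (i, j) * FreeAlgebra.ι k (s, j))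
        (q • (FreeAlgebra.ι k (s, j) * FreeAlgebra.ι k (i, j)))
  | cross (i s : Fin n) (j l : Fin r) (h1 : i ≠ s) (h2 : j ≠ l) :
      QBarRel k q n r (FreeAlgebra.ι k (i, j) * FreeAlgebra.ι k (s, l))
        (FreeAlgebra.ι k (s, l) * FreeAlgebra.ι k (i, j))

/-- The quasipolynomial algebra `M̄_q(n,r)`. -/
abbrev QBar (k : Type) [Field k] (q : k) (n r : ℕ) : Type := RingQuot (QBarRel k q n r)

/-- The generator `Z_{i,j}` of `M̄_q(n,r)`. -/
noncomputable def ZbarGen (k : Type) [Field k] (q : k) (n r : ℕ) (i : Fin n) (j : Fin r) :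
    QBar k q n r :=
  RingQuot.mkAlgHom k (QBarRel k q n r) (FreeAlgebra.ι k (i, j))

theorem mul_mul_eq_smul_of_mul_eq_smul {R A : Type*} [CommSemiring R] [Semiring A] [Algebra R A]
    {x y z : A} {c d : R} (hx : z * x = c • (x * z)) (hy : z * y = d • (y * z)) :
    z * (x * y) = (c * d) • (x * y * z) := by
  rw [← mul_assoc, hx, smul_mul_assoc, mul_assoc, hy, mul_smul_comm, smul_smul, mul_assoc]

theorem mul_pow_eq_smul_of_mul_eq_smul {R A : Type*} [CommSemiring R] [Semiring A] [Algebra R A]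
    {x z : A} {c : R} (h : z * x = c • (x * z)) (p : ℕ) :
    z * x ^ p = c ^ p • (x ^ p * z) := by
  induction p with
  | zero => simp
  | succ p ih => rw [pow_succ, pow_succ]; exact mul_mul_eq_smul_of_mul_eq_smul ih h

section QBar

variable {K : Type} [Field K] {q : K} {n r : ℕ}

theorem ZbarGen_mul_row {i : Fin n} {j l : Fin r} (h : j < l) :
    ZbarGen K q n r i j * ZbarGen K q n r i l =
      q • (ZbarGen K q n r i l * ZbarGen K q n r i j) := by
  simpa only [ZbarGen, map_mul, map_smul] using
    RingQuot.mkAlgHom_rel K (QBarRel.row (k := K) (q := q) i j l h)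

theorem ZbarGen_mul_col {i s : Fin n} {j : Fin r} (h : i < s) :
    ZbarGen K q n r i j * ZbarGen K q n r s j =
      q • (ZbarGen K q n r s j * ZbarGen K q n r i j) := by
  simpa only [ZbarGen, map_mul, map_smul] using
    RingQuot.mkAlgHom_rel K (QBarRel.col (k := K) (q := q) i s j h)

theorem ZbarGen_mul_cross {i s : Fin n} {j l : Fin r} (h₁ : i ≠ s) (h₂ : j ≠ l) :
    ZbarGen K q n r i j * ZbarGen K q n r s l =
      ZbarGen K q n r s l * ZbarGen K q n r i j := by
  simpa only [ZbarGen, map_mul] using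
    RingQuot.mkAlgHom_rel K (QBarRel.cross (k := K) (q := q) i s j l h₁ h₂)

/-- An element commuting with every generator is central. -/
theorem mem_center_QBar_of_commute_ZbarGen {w : QBar K q n r}
    (h : ∀ s t, Commute (ZbarGen K q n r s t) w) :
    w ∈ Subalgebra.center K (QBar K q n r) := by
  rw [Subalgebra.mem_center_iff]
  intro x
  obtain ⟨y, rfl⟩ := RingQuot.mkAlgHom_surjective K (QBarRel K q n r) x
  change Commute _ w
  induction y using FreeAlgebra.induction with
  | grade0 c => rw [AlgHom.commutes]; exact Algebra.commutes c w
  | grade1 x => exact h x.1 x.2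
  | mul x y hx hy => rw [map_mul]; exact hx.mul_left hy
  | add x y hx hy => rw [map_add]; exact hx.add_left hy

/-- If `q ≠ 0` and `q ^ p = -1`, a generator commutes with the `p`-th power of another
one up to a sign, which is `-1` exactly when the two are distinct and share a row or a column. -/
theorem ZbarGen_mul_pow {p : ℕ} (hq : q ≠ 0) (hp : q ^ p = -1) (s u : Fin n) (t v : Fin r) :
    ZbarGen K q n r s t * ZbarGen K q n r u v ^ p =
      ((if u = s then -1 else 1) * (if v = t then -1 else 1) : K) •
        (ZbarGen K q n r u v ^ p * ZbarGen K q n r s t) := by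
  have hp' : q⁻¹ ^ p = -1 := by rw [inv_pow, hp, inv_neg, inv_one]
  have skew {x z : QBar K q n r} (h : z * x = q • (x * z)) :
      z * x ^ p = (-1 : K) • (x ^ p * z) := by
    rw [mul_pow_eq_smul_of_mul_eq_smul h, hp]
  have skew' {x z : QBar K q n r} (h : x * z = q • (z * x)) :
      z * x ^ p = (-1 : K) • (x ^ p * z) := by
    have h' : z * x = q⁻¹ • (x * z) := by rw [h, smul_smul, inv_mul_cancel₀ hq, one_smul]
    rw [mul_pow_eq_smul_of_mul_eq_smul h', hp']
  by_cases hu : u = s <;> by_cases hv : v = t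
  · subst hu hv
    simp only [if_true, one_smul, neg_mul, neg_neg, one_mul]
    exact (Commute.refl (ZbarGen K q n r u v)).pow_right p
  · subst hu
    simp only [if_true, if_neg hv, mul_one]
    rcases lt_or_gt_of_ne hv with h | h
    · exact skew' (ZbarGen_mul_row h)
    · exact skew (ZbarGen_mul_row h)
  · subst hv
    simp only [if_true, if_neg hu, one_mul]
    rcases lt_or_gt_of_ne hu with h | h
    · exact skew' (ZbarGen_mul_col h)
    · exact skew (ZbarGen_mul_col h)
  · simp only [if_neg hu, if_neg hv, mul_one, one_smul]
    have h : Commute (ZbarGen K q n r s t) (ZbarGen K q n r u v) :=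
      ZbarGen_mul_cross (Ne.symm hu) (Ne.symm hv)
    exact h.pow_right p

end QBar

/-- Let `m` be even and `q` a primitive `m`-th root of unity.  For all
`k < ℓ` and `i < j`, the element `Z_{k,i}^{m/2} Z_{k,j}^{m/2} Z_{ℓ,i}^{m/2} Z_{ℓ,j}^{m/2}`
is central in the quasipolynomial algebra `M̄_q(n,r)`. -/
theorem pow_four_mem_center_QBar
    (K : Type) [Field K] (q : K) (m : ℕ) (hm0 : 0 < m) (hmeven : Even m)
    (hq : IsPrimitiveRoot q m) (n r : ℕ)
    (a b : Fin n) (i j : Fin r) (hab : a < b) (hij : i < j) :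
    ZbarGen K q n r a i ^ (m / 2) * ZbarGen K q n r a j ^ (m / 2) *
        ZbarGen K q n r b i ^ (m / 2) * ZbarGen K q n r b j ^ (m / 2) ∈
      Subalgebra.center K (QBar K q n r) := by
  have hp : q ^ (m / 2) = -1 :=
    (hq.pow hm0 (Nat.div_mul_cancel hmeven.two_dvd).symm).eq_neg_one_of_two_right
  have hq0 : q ≠ 0 := hq.ne_zero hm0.ne'
  refine mem_center_QBar_of_commute_ZbarGen fun s t => ?_
  have h := mul_mul_eq_smul_of_mul_eq_smul
    (mul_mul_eq_smul_of_mul_eq_smul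
      (mul_mul_eq_smul_of_mul_eq_smul (ZbarGen_mul_pow hq0 hp s a t i) (ZbarGen_mul_pow hq0 hp s a t j))
      (ZbarGen_mul_pow hq0 hp s b t i)) (ZbarGen_mul_pow hq0 hp s b t j)
  refine h.trans ?_
  convert one_smul K _ using 2
  split_ifs <;> norm_num
end

section
/- For every k ≥ 2 one has S_k^k = −I, the matrix 1 − S_k is invertible over ℚ with inverse ½(1 + S_k + S_k^2 + ... + S_k^{k−1}), and for all n×r rational matrices A and M′ one has H_nA − AH_r = M′ if and only if 2(S_nA − AS_r) = (1 − S_n)M′(1 − S_r). In particular, the kernel of the map A ↦ H_nA − AH_r consists exactly of those A with S_nA = AS_r. -/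
open scoped BigOperators

/-- The `k × k` matrix `S_k = -E_{1,k} + Σ_{i=2}^k E_{i,i-1}` (1-based indexing;
here realised with 0-based indices). -/
def Smat (k : ℕ) : Matrix (Fin k) (Fin k) ℚ :=
  Matrix.of fun i j =>
    if (i : ℕ) = (j : ℕ) + 1 then 1 else if (i : ℕ) = 0 ∧ (j : ℕ) = k - 1 then -1 else 0

/-- The `k × k` matrix `H_k = Σ_{1 ≤ j < i ≤ k} (E_{i,j} - E_{j,i})`. -/
def Hmat (k : ℕ) : Matrix (Fin k) (Fin k) ℚ :=
  Matrix.of fun i j => if (j : ℕ) < (i : ℕ) then 1 else if (i : ℕ) < (j : ℕ) then -1 else 0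

theorem Smat_mul_apply_zero {p : ℕ} {ι : Type*} (X : Matrix (Fin (p + 1)) ι ℚ) (j : ι) :
    (Smat (p + 1) * X) 0 j = -X (Fin.last p) j := by
  rw [Matrix.mul_apply, Finset.sum_eq_single (Fin.last p)]
  · simp [Smat]
  · intro b _ hb
    have : (b : ℕ) ≠ p := fun h => hb (Fin.ext h)
    simp [Smat, this]
  · simp

theorem Smat_mul_apply_succ {p : ℕ} {ι : Type*} (X : Matrix (Fin (p + 1)) ι ℚ) (i : Fin p)
    (j : ι) : (Smat (p + 1) * X) i.succ j = X i.castSucc j := by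
  rw [Matrix.mul_apply, Finset.sum_eq_single i.castSucc]
  · simp [Smat]
  · intro b _ hb
    have : (i : ℕ) ≠ b := fun h => hb (Fin.ext h.symm)
    simp [Smat, this]
  · simp

theorem Smat_pow_apply {k m : ℕ} (hm : m ≤ k) (i j : Fin k) :
    (Smat k ^ m) i j =
      if (i : ℕ) = j + m then 1 else if (i : ℕ) + k = j + m then -1 else 0 := by
  obtain _ | p := k
  · exact i.elim0
  induction m generalizing i with
  | zero =>
    rw [pow_zero, Matrix.one_apply]
    simp only [Fin.ext_iff]
    grind
  | succ m ih =>
    rw [pow_succ']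
    refine Fin.cases ?_ (fun i => ?_) i
    · rw [Smat_mul_apply_zero, ih (by omega)]
      simp only [Fin.val_last, Fin.val_zero]
      grind
    · rw [Smat_mul_apply_succ, ih (by omega)]
      simp only [Fin.val_castSucc, Fin.val_succ]
      grind

theorem Smat_pow_self (k : ℕ) : Smat k ^ k = -1 := by
  ext i j
  rw [Smat_pow_apply le_rfl, Matrix.neg_apply, Matrix.one_apply]
  simp only [Fin.ext_iff]
  grind

theorem one_sub_Smat_mul_geom_sum (k : ℕ) :
    (1 - Smat k) * ((2 : ℚ)⁻¹ • ∑ i ∈ Finset.range k, Smat k ^ i) = 1 := by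
  rw [Matrix.mul_smul, mul_neg_geom_sum, Smat_pow_self, sub_neg_eq_add, ← two_smul ℚ,
    smul_smul]
  norm_num

theorem geom_sum_mul_one_sub_Smat (k : ℕ) :
    ((2 : ℚ)⁻¹ • ∑ i ∈ Finset.range k, Smat k ^ i) * (1 - Smat k) = 1 :=
  mul_eq_one_comm.mp (one_sub_Smat_mul_geom_sum k)

theorem one_sub_Smat_mul_Hmat (k : ℕ) : (1 - Smat k) * Hmat k = 1 + Smat k := by
  ext i j
  obtain _ | p := k
  · exact i.elim0
  rw [sub_mul, one_mul, Matrix.sub_apply, Matrix.add_apply, Matrix.one_apply]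
  refine Fin.cases ?_ (fun i => ?_) i
  · rw [Smat_mul_apply_zero]
    simp only [Hmat, Smat, Matrix.of_apply, Fin.ext_iff, Fin.val_last, Fin.val_zero]
    grind
  · rw [Smat_mul_apply_succ]
    simp only [Hmat, Smat, Matrix.of_apply, Fin.ext_iff, Fin.val_castSucc, Fin.val_succ]
    grind

theorem Hmat_mul_one_sub_Smat (k : ℕ) : Hmat k * (1 - Smat k) = 1 + Smat k := by
  set G := (2 : ℚ)⁻¹ • ∑ i ∈ Finset.range k, Smat k ^ i
  have hG : G * (1 - Smat k) = 1 := geom_sum_mul_one_sub_Smat k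
  calc Hmat k * (1 - Smat k)
      = G * ((1 - Smat k) * Hmat k) * (1 - Smat k) := by rw [← mul_assoc G, hG, one_mul]
    _ = G * (1 - Smat k) * (1 + Smat k) := by rw [one_sub_Smat_mul_Hmat]; noncomm_ring
    _ = 1 + Smat k := by rw [hG, one_mul]

theorem one_sub_Smat_mul_mul_one_sub_Smat {n r : ℕ} (A : Matrix (Fin n) (Fin r) ℚ) :
    (1 - Smat n) * (Hmat n * A - A * Hmat r) * (1 - Smat r) =
      (2 : ℚ) • (Smat n * A - A * Smat r) := by
  rw [Matrix.mul_sub (1 - Smat n), Matrix.sub_mul _ _ (1 - Smat r), ← Matrix.mul_assoc _ (Hmat n), one_sub_Smat_mul_Hmat,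
    ← Matrix.mul_assoc _ A, Matrix.mul_assoc _ (Hmat r), Hmat_mul_one_sub_Smat, two_smul]
  simp only [Matrix.add_mul, Matrix.sub_mul, Matrix.mul_add, Matrix.mul_sub, Matrix.one_mul,
    Matrix.mul_one]
  abel

theorem one_sub_Smat_mul_mul_injective (n r : ℕ) :
    Function.Injective fun X : Matrix (Fin n) (Fin r) ℚ =>
      (1 - Smat n) * X * (1 - Smat r) := by
  refine Function.LeftInverse.injective (g := fun Y =>
    ((2 : ℚ)⁻¹ • ∑ i ∈ Finset.range n, Smat n ^ i) * Y *
      ((2 : ℚ)⁻¹ • ∑ i ∈ Finset.range r, Smat r ^ i)) fun X => ?_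
  dsimp only
  rw [Matrix.mul_assoc (1 - Smat n), ← Matrix.mul_assoc _ (1 - Smat n),
    geom_sum_mul_one_sub_Smat, Matrix.one_mul, Matrix.mul_assoc, one_sub_Smat_mul_geom_sum,
    Matrix.mul_one]

/-- For every `k ≥ 2`, `S_k ^ k = -1`, the matrix `1 - S_k` is
invertible with inverse `½ (1 + S_k + ⋯ + S_k^{k-1})`, and for all rational `n × r`
matrices `A`, `M'` one has `H_n A - A H_r = M'` iff
`2 (S_n A - A S_r) = (1 - S_n) M' (1 - S_r)`; in particular `H_n A - A H_r = 0` iff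
`S_n A = A S_r`. -/
theorem Smat_pow_inv_and_kernel :
    (∀ k : ℕ, 2 ≤ k →
      Smat k ^ k = -1 ∧
        (1 - Smat k) * ((2 : ℚ)⁻¹ • ∑ i ∈ Finset.range k, Smat k ^ i) = 1 ∧
        ((2 : ℚ)⁻¹ • ∑ i ∈ Finset.range k, Smat k ^ i) * (1 - Smat k) = 1) ∧
    ∀ n r : ℕ, 1 ≤ n → 1 ≤ r → ∀ A M' : Matrix (Fin n) (Fin r) ℚ,
      ((Hmat n * A - A * Hmat r = M' ↔
          (2 : ℚ) • (Smat n * A - A * Smat r) = (1 - Smat n) * M' * (1 - Smat r)) ∧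
        (Hmat n * A - A * Hmat r = 0 ↔ Smat n * A = A * Smat r)) := by
  refine ⟨fun k _ => ⟨Smat_pow_self k, one_sub_Smat_mul_geom_sum k,
    geom_sum_mul_one_sub_Smat k⟩, fun n r _ _ A M' => ?_⟩
  have key (M : Matrix (Fin n) (Fin r) ℚ) : Hmat n * A - A * Hmat r = M ↔
      (2 : ℚ) • (Smat n * A - A * Smat r) = (1 - Smat n) * M * (1 - Smat r) := by
    rw [← one_sub_Smat_mul_mul_one_sub_Smat]
    exact (one_sub_Smat_mul_mul_injective n r).eq_iff.symm
  refine ⟨key M', ?_⟩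
  rw [key 0, Matrix.mul_zero, Matrix.zero_mul, smul_eq_zero_iff_right two_ne_zero, sub_eq_zero]
end

section
/- Let n ≥ r ≥ 1, let s = gcd(n,r), and write n = x·s, r = y·s. The ℚ-linear map A ↦ H_nA − AH_r on n×r rational matrices fails to be invertible if and only if both x and y are odd; in that case its kernel has dimension exactly s. Consequently, the corank c_{n,r} of the defining matrix J of M̄_q(n,r) equals s if x and y are both odd, and 0 otherwise. -/
open scoped BigOperators

/-- The `ℚ`-linear map `A ↦ H_n A - A H_r` on `n × r` rational matrices. -/
def Jmap (n r : ℕ) : Matrix (Fin n) (Fin r) ℚ →ₗ[ℚ] Matrix (Fin n) (Fin r) ℚ where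
  toFun A := Hmat n * A - A * Hmat r
  map_add' A B := by
    simp only [Matrix.mul_add, Matrix.add_mul]
    abel
  map_smul' c A := by
    simp only [Matrix.mul_smul, Matrix.smul_mul, smul_sub, RingHom.id_apply]

/-- The space of functions `ℤ → ℚ` that are antiperiodic with antiperiod `n`. -/
def antiperiodicSubmodule (n : ℕ) : Submodule ℚ (ℤ → ℚ) where
  carrier := {f | Function.Antiperiodic f (n : ℤ)}
  add_mem' {f g} hf hg t := by
    simp only [Pi.add_apply, hf t, hg t]
    ring
  zero_mem' t := by simp
  smul_mem' c f hf t := by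
    simp only [Pi.smul_apply, hf t, smul_neg]

theorem mem_antiperiodicSubmodule {n : ℕ} {f : ℤ → ℚ} :
    f ∈ antiperiodicSubmodule n ↔ Function.Antiperiodic f (n : ℤ) :=
  Iff.rfl

theorem Function.Antiperiodic.apply_eq_negOnePow_mul_emod {f : ℤ → ℚ} {n : ℤ}
    (hf : Function.Antiperiodic f n) (t : ℤ) :
    f t = ((t / n).negOnePow : ℤ) * f (t % n) := by
  have h := hf.add_zsmul_eq (x := t % n) (t / n)
  rw [smul_eq_mul, mul_comm, Int.emod_add_mul_ediv] at h
  rw [h]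
  simp

theorem Function.Antiperiodic.eq_of_forall_fin {f g : ℤ → ℚ} {n : ℕ} (hn : 0 < n)
    (hf : Function.Antiperiodic f (n : ℤ)) (hg : Function.Antiperiodic g (n : ℤ))
    (h : ∀ i : Fin n, f (i : ℕ) = g (i : ℕ)) (t : ℤ) : f t = g t := by
  rw [hf.apply_eq_negOnePow_mul_emod, hg.apply_eq_negOnePow_mul_emod]
  have h0 : 0 ≤ t % n := Int.emod_nonneg _ (by omega)
  have h1 : t % n < n := Int.emod_lt_of_pos _ (by omega)
  have := h ⟨(t % n).toNat, by omega⟩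
  rw [Int.toNat_of_nonneg h0] at this
  rw [this]

/-- The antiperiodic extension to `ℤ` of a vector indexed by `Fin n`. -/
def antiperiodicExtension {n : ℕ} (hn : 0 < n) (v : Fin n → ℚ) (t : ℤ) : ℚ :=
  ((t / n).negOnePow : ℤ) *
    v ⟨(t % n).toNat, by
      have := Int.emod_lt_of_pos t (b := n) (by omega)
      omega⟩

theorem antiperiodic_antiperiodicExtension {n : ℕ} (hn : 0 < n) (v : Fin n → ℚ) :
    Function.Antiperiodic (antiperiodicExtension hn v) (n : ℤ) := by
  intro t
  have h : (t + n) / (n : ℤ) = t / n + 1 := by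
    rw [Int.add_ediv_of_dvd_right dvd_rfl, Int.ediv_self (by omega)]
  simp [antiperiodicExtension, h, Int.negOnePow_succ]

theorem antiperiodicExtension_apply_fin {n : ℕ} (hn : 0 < n) (v : Fin n → ℚ) (i : Fin n) :
    antiperiodicExtension hn v (i : ℕ) = v i := by
  have h0 : ((i : ℕ) : ℤ) / n = 0 := by
    rw [← Int.natCast_div, Nat.div_eq_of_lt i.isLt, Nat.cast_zero]
  have h1 : (((i : ℕ) : ℤ) % n).toNat = i := by
    rw [← Int.natCast_mod, Nat.mod_eq_of_lt i.isLt, Int.toNat_natCast]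
  simp [antiperiodicExtension, h0, h1]

theorem finrank_antiperiodicSubmodule {n : ℕ} (hn : 0 < n) :
    Module.finrank ℚ (antiperiodicSubmodule n) = n := by
  let restrict : antiperiodicSubmodule n →ₗ[ℚ] (Fin n → ℚ) :=
    { toFun f i := f.1 (i : ℕ)
      map_add' _ _ := rfl
      map_smul' _ _ := rfl }
  have hb : Function.Bijective restrict := by
    refine ⟨fun f g hfg => ?_, fun v => ?_⟩
    · exact Subtype.ext <| funext <| f.2.eq_of_forall_fin hn g.2 fun i => congrFun hfg i
    · exact ⟨⟨_, antiperiodic_antiperiodicExtension hn v⟩,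
        funext (antiperiodicExtension_apply_fin hn v)⟩
  simpa using (LinearEquiv.ofBijective restrict hb).finrank_eq

/-- The sum `f (t - 1) + ⋯ + f (t - (n - 1))` for `n ≥ 1`, which on antiperiodic functions with
antiperiod `n` extends the action of `Hmat n` to functions on `ℤ`. -/
def windowSum (n : ℕ) (f : ℤ → ℚ) (t : ℤ) : ℚ :=
  ∑ m ∈ Finset.range n, f (t - m) - f t

theorem Function.Antiperiodic.windowSum {f : ℤ → ℚ} {c : ℤ} (hf : Function.Antiperiodic f c)
    (n : ℕ) : Function.Antiperiodic (windowSum n f) c := by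
  intro t
  have h (m : ℕ) : f (t + c - m) = -f (t - m) := by
    rw [← hf, sub_add_eq_add_sub]
  simp only [_root_.windowSum, h, hf t, Finset.sum_neg_distrib]
  ring

theorem Function.Antiperiodic.windowSum_add_one {f : ℤ → ℚ} {n : ℕ}
    (hf : Function.Antiperiodic f (n : ℤ)) (t : ℤ) :
    _root_.windowSum n f (t + 1) = _root_.windowSum n f t + f t + f (t + 1) := by
  have h := Finset.sum_range_succ (fun m : ℕ => f (t + 1 - m)) n
  rw [Finset.sum_range_succ'] at h
  have h1 (m : ℕ) : f (t + 1 - (m + 1 : ℕ)) = f (t - m) := by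
    congr 1
    push_cast
    ring
  have h2 : f (t + 1 - n) = -f (t + 1) := hf.sub_eq (t + 1)
  simp only [h1, h2, Nat.cast_zero, sub_zero] at h
  simp only [_root_.windowSum]
  linarith

theorem Hmat_eq (n : ℕ) (i k : Fin n) :
    Hmat n i k = 2 * (if (k : ℕ) < i then 1 else 0) + (if (k : ℕ) = i then 1 else 0) - 1 := by
  simp only [Hmat, Matrix.of_apply]
  split_ifs <;> first | omega | norm_num

theorem sum_Hmat_mul (n : ℕ) (f : ℤ → ℚ) (i : Fin n) :
    ∑ k : Fin n, Hmat n i k * f (k : ℕ) =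
      2 * ∑ k ∈ Finset.range i, f k + f (i : ℕ) - ∑ k ∈ Finset.range n, f k := by
  have h : (Finset.range n).filter (fun k => k < (i : ℕ)) = Finset.range i := by
    ext k
    have := i.isLt
    simp only [Finset.mem_filter, Finset.mem_range]
    omega
  simp only [Hmat_eq]
  rw [Fin.sum_univ_eq_sum_range (fun k : ℕ =>
    (2 * (if k < (i : ℕ) then 1 else 0) + (if k = i then 1 else 0) - 1 : ℚ) * f k)]
  simp [sub_mul, add_mul, Finset.sum_add_distrib, ← Finset.mul_sum,
    ← Finset.sum_filter, h, i.isLt]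

theorem Function.Antiperiodic.sum_Hmat_mul {f : ℤ → ℚ} {n : ℕ}
    (hf : Function.Antiperiodic f (n : ℤ)) (i : Fin n) :
    ∑ k : Fin n, Hmat n i k * f (k : ℕ) = _root_.windowSum n f (i : ℕ) := by
  have h (m : ℕ) : _root_.windowSum n f m =
      2 * ∑ k ∈ Finset.range m, f k + f m + (_root_.windowSum n f 0 - f 0) := by
    induction m with
    | zero => simp
    | succ m ih =>
      rw [Nat.cast_succ, hf.windowSum_add_one, ih, Finset.sum_range_succ]
      ring
  have h0 := h n
  have h1 := hf.windowSum n 0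
  have h2 := hf 0
  rw [zero_add] at h1 h2
  rw [_root_.sum_Hmat_mul, h i]
  linarith

theorem Hmat_transpose (n : ℕ) (i k : Fin n) : Hmat n k i = -Hmat n i k := by
  simp only [Hmat, Matrix.of_apply]
  split_ifs <;> first | omega | norm_num

theorem Jmap_apply (n r : ℕ) (A : Matrix (Fin n) (Fin r) ℚ) :
    Jmap n r A = Hmat n * A - A * Hmat r :=
  rfl

theorem Jmap_apply_of_antiperiodic {n r : ℕ} (g : ℤ → ℤ → ℚ)
    (hn : ∀ j, Function.Antiperiodic (fun i => g i j) (n : ℤ))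
    (hr : ∀ i, Function.Antiperiodic (g i) (r : ℤ)) (i : Fin n) (j : Fin r) :
    Jmap n r (Matrix.of fun i j => g (i : ℕ) (j : ℕ)) i j =
      windowSum n (fun i => g i (j : ℕ)) (i : ℕ) + windowSum r (g (i : ℕ)) (j : ℕ) := by
  rw [← (hn _).sum_Hmat_mul, ← (hr _).sum_Hmat_mul]
  rw [Jmap_apply, Matrix.sub_apply, Matrix.mul_apply, Matrix.mul_apply, sub_eq_add_neg,
    ← Finset.sum_neg_distrib]
  congr 1
  refine Finset.sum_congr rfl fun k _ => ?_
  rw [Hmat_transpose r j k, Matrix.of_apply]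
  ring

/-- The Toeplitz matrix with entries `f (i - j)`. -/
def toeplitz (n r : ℕ) : (ℤ → ℚ) →ₗ[ℚ] Matrix (Fin n) (Fin r) ℚ where
  toFun f := Matrix.of fun i j => f ((i : ℕ) - (j : ℕ))
  map_add' _ _ := rfl
  map_smul' _ _ := rfl

theorem toeplitz_apply {n r : ℕ} (f : ℤ → ℚ) (i : Fin n) (j : Fin r) :
    toeplitz n r f i j = f ((i : ℕ) - (j : ℕ)) :=
  rfl

theorem Function.Antiperiodic.eq_zero_of_add_one {F : ℤ → ℚ} {n : ℕ}
    (hF : Function.Antiperiodic F (n : ℤ)) (h : ∀ t, F (t + 1) = F t) (t : ℤ) : F t = 0 := by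
  have h1 : ∀ m : ℕ, F (t + m) = F t := by
    intro m
    induction m with
    | zero => simp
    | succ m ih => rw [Nat.cast_succ, ← add_assoc, h, ih]
  linarith [hF t, h1 n]

theorem Jmap_toeplitz {n r : ℕ} {f : ℤ → ℚ} (hn : Function.Antiperiodic f (n : ℤ))
    (hr : Function.Antiperiodic f (r : ℤ)) : Jmap n r (toeplitz n r f) = 0 := by
  ext i j
  have hr' (i : ℤ) : Function.Antiperiodic (fun j => f (i - j)) (r : ℤ) := hr.const_sub i
  refine (Jmap_apply_of_antiperiodic (fun i j => f (i - j)) (fun j => hn.sub_const j) hr'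
    i j).trans ?_
  have hnr : windowSum n f ((i : ℕ) - (j : ℕ)) = windowSum r f ((i : ℕ) - (j : ℕ)) := by
    refine sub_eq_zero.mp (Function.Antiperiodic.eq_zero_of_add_one
      (F := fun t => windowSum n f t - windowSum r f t) (n := n) (fun t => ?_) (fun t => ?_) _)
    · simp only [hn.windowSum n t, hn.windowSum r t]
      ring
    · simp only [hn.windowSum_add_one, hr.windowSum_add_one]
      ring
  have hreflect : windowSum r (fun j => f ((i : ℕ) - j)) (j : ℕ) +
      windowSum r f ((i : ℕ) - (j : ℕ)) = 0 := by
    refine Function.Antiperiodic.eq_zero_of_add_one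
      (F := fun t => windowSum r (fun j => f ((i : ℕ) - j)) t + windowSum r f ((i : ℕ) - t))
      (n := r) (fun t => ?_) (fun t => ?_) _
    · have h := ((hr.windowSum r).const_sub ((i : ℕ) : ℤ)) t
      simp only [(hr' _).windowSum r t] at h ⊢
      rw [h]
      ring
    · have h := hr.windowSum_add_one ((i : ℕ) - (t + 1))
      rw [show ((i : ℕ) : ℤ) - (t + 1) + 1 = (i : ℕ) - t by ring] at h
      simp only [(hr' _).windowSum_add_one]
      linarith
  have hcol : windowSum n (fun i => f (i - (j : ℕ))) (i : ℕ) =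
      windowSum n f ((i : ℕ) - (j : ℕ)) := by
    simp only [windowSum, sub_right_comm]
  rw [hcol, hnr, add_comm, hreflect, Matrix.zero_apply]

theorem shift_invariant_of_windowSum_add_eq_zero {n r : ℕ} {g : ℤ → ℤ → ℚ}
    (hn : ∀ j, Function.Antiperiodic (fun i => g i j) (n : ℤ))
    (hr : ∀ i, Function.Antiperiodic (g i) (r : ℤ))
    (h : ∀ i j, windowSum n (fun i => g i j) i + windowSum r (g i) j = 0) (i j : ℤ) :
    g (i + 1) (j + 1) = g i j := by
  linarith [h i j, h (i + 1) j, h i (j + 1), h (i + 1) (j + 1),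
    (hn j).windowSum_add_one i, (hn (j + 1)).windowSum_add_one i,
    (hr i).windowSum_add_one j, (hr (i + 1)).windowSum_add_one j]

theorem eq_toeplitz_of_shift_invariant {g : ℤ → ℤ → ℚ}
    (h : ∀ i j, g (i + 1) (j + 1) = g i j) (i j : ℤ) : g i j = g (i - j) 0 := by
  have hs (t : ℤ) : g (t + j) j = g t 0 := by
    induction j with
    | zero => simp
    | succ k ih => rw [← ih, ← add_assoc, h]
    | pred k ih => rw [← ih, ← h]; congr 1 <;> ring
  rw [← hs, sub_add_cancel]

theorem exists_toeplitz_of_Jmap_eq_zero {n r : ℕ} (hn : 0 < n) (hr : 0 < r)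
    {A : Matrix (Fin n) (Fin r) ℚ} (hA : Jmap n r A = 0) :
    ∃ f : ℤ → ℚ, Function.Antiperiodic f (n : ℤ) ∧ Function.Antiperiodic f (r : ℤ) ∧
      toeplitz n r f = A := by
  set g : ℤ → ℤ → ℚ := fun i j =>
    antiperiodicExtension hn (fun a => antiperiodicExtension hr (A a) j) i with hg
  have hgn (j : ℤ) : Function.Antiperiodic (fun i => g i j) (n : ℤ) :=
    antiperiodic_antiperiodicExtension hn _
  have hgr (i : ℤ) : Function.Antiperiodic (g i) (r : ℤ) := fun j => by
    simp only [hg, antiperiodicExtension.eq_def hn,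
      antiperiodic_antiperiodicExtension hr _ j, mul_neg]
  have hgA (i : Fin n) (j : Fin r) : g (i : ℕ) (j : ℕ) = A i j := by
    simp only [hg, antiperiodicExtension_apply_fin]
  have hgA' : Matrix.of (fun (i : Fin n) (j : Fin r) => g (i : ℕ) (j : ℕ)) = A :=
    Matrix.ext hgA
  have hbox (i : Fin n) (j : Fin r) :
      windowSum n (fun i => g i (j : ℕ)) (i : ℕ) + windowSum r (g (i : ℕ)) (j : ℕ) = 0 := by
    rw [← Jmap_apply_of_antiperiodic g hgn hgr, hgA', hA, Matrix.zero_apply]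
  have hanti_n (j : ℤ) : Function.Antiperiodic
      (fun i => windowSum n (fun i => g i j) i + windowSum r (g i) j) (n : ℤ) := fun i => by
    have h (k : ℤ) : g (i + n) k = -g i k := hgn k i
    simp only [(hgn j).windowSum n i]
    simp only [windowSum, h, Finset.sum_neg_distrib]
    ring
  have hanti_r (i : ℤ) : Function.Antiperiodic
      (fun j => windowSum n (fun i => g i j) i + windowSum r (g i) j) (r : ℤ) := fun j => by
    have h (k : ℤ) : g k (j + r) = -g k j := hgr k j
    simp only [(hgr i).windowSum r j]
    simp only [windowSum, h, Finset.sum_neg_distrib]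
    ring
  have hzero (c : ℤ) : Function.Antiperiodic (fun _ : ℤ => (0 : ℚ)) c := fun _ => by simp
  have hall (i j : ℤ) : windowSum n (fun i => g i j) i + windowSum r (g i) j = 0 :=
    (hanti_n j).eq_of_forall_fin hn (hzero n) (fun a =>
      (hanti_r (a : ℕ)).eq_of_forall_fin hr (hzero r) (fun b => hbox a b) j) i
  have hshift := eq_toeplitz_of_shift_invariant
    (shift_invariant_of_windowSum_add_eq_zero hgn hgr hall)
  refine ⟨fun t => g t 0, hgn 0, fun t => ?_, ?_⟩
  · have h1 := hshift t (-r)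
    rw [sub_neg_eq_add] at h1
    have h2 := hgr t (-r)
    rw [neg_add_cancel] at h2
    simp only [← h1, h2, neg_neg]
  · ext i j
    exact (hshift _ _).symm.trans (hgA i j)

theorem toeplitz_injective_of_antiperiodic {n r : ℕ} (hn : 0 < n) (hr : 0 < r) {f g : ℤ → ℚ}
    (hf : Function.Antiperiodic f (n : ℤ)) (hg : Function.Antiperiodic g (n : ℤ))
    (h : toeplitz n r f = toeplitz n r g) : f = g := by
  refine funext <| hf.eq_of_forall_fin hn hg fun i => ?_
  have := congrFun (congrFun h i) ⟨0, hr⟩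
  simpa only [toeplitz_apply, Nat.cast_zero, sub_zero] using this

theorem finrank_ker_Jmap {n r : ℕ} (hn : 0 < n) (hr : 0 < r) :
    Module.finrank ℚ (LinearMap.ker (Jmap n r)) =
      Module.finrank ℚ ↥(antiperiodicSubmodule n ⊓ antiperiodicSubmodule r) := by
  let φ := (toeplitz n r).domRestrict (antiperiodicSubmodule n ⊓ antiperiodicSubmodule r)
  have hφ : Function.Injective φ := fun f g hfg =>
    Subtype.ext <| toeplitz_injective_of_antiperiodic hn hr f.2.1 g.2.1 hfg
  have hrange : LinearMap.range φ = LinearMap.ker (Jmap n r) := by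
    ext A
    rw [LinearMap.mem_range, LinearMap.mem_ker]
    constructor
    · rintro ⟨f, rfl⟩
      exact Jmap_toeplitz f.2.1 f.2.2
    · intro hA
      obtain ⟨f, hfn, hfr, rfl⟩ := exists_toeplitz_of_Jmap_eq_zero hn hr hA
      exact ⟨⟨f, hfn, hfr⟩, rfl⟩
  rw [← hrange, LinearMap.finrank_range_of_inj hφ]

theorem Function.Antiperiodic.natCast_mul_of_odd {f : ℤ → ℚ} {c : ℤ}
    (hf : Function.Antiperiodic f c) {k : ℕ} (hk : Odd k) :
    Function.Antiperiodic f (k * c) := by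
  obtain ⟨m, rfl⟩ := hk
  simpa only [nsmul_eq_mul] using hf.odd_nsmul_antiperiodic m

theorem Function.Antiperiodic.natCast_mul_of_even {f : ℤ → ℚ} {c : ℤ}
    (hf : Function.Antiperiodic f c) {k : ℕ} (hk : Even k) :
    Function.Periodic f (k * c) := by
  obtain ⟨m, rfl⟩ := hk.two_dvd
  simpa only [nsmul_eq_mul] using hf.even_nsmul_periodic m

theorem antiperiodicSubmodule_inf_of_odd {x y s : ℕ} (hxy : Nat.Coprime x y) (hx : Odd x)
    (hy : Odd y) :
    antiperiodicSubmodule (x * s) ⊓ antiperiodicSubmodule (y * s) =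
      antiperiodicSubmodule s := by
  ext f
  simp only [Submodule.mem_inf, mem_antiperiodicSubmodule, Nat.cast_mul]
  constructor
  · rintro ⟨hfx, hfy⟩ t
    have hbez := Nat.gcd_eq_gcd_ab x y
    rw [hxy.gcd_eq_one, Nat.cast_one] at hbez
    have hodd : Odd (x.gcdA y + x.gcdB y) := by
      have h := hbez ▸ (odd_one : Odd (1 : ℤ))
      have hx' : Odd (x : ℤ) := by exact_mod_cast hx
      have hy' : Odd (y : ℤ) := by exact_mod_cast hy
      simp only [Int.odd_add, Int.odd_mul, hx', hy', true_and, ← Int.not_odd_iff_even] at h ⊢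
      exact h
    have h1 := hfx.add_zsmul_eq (x := t) (x.gcdA y)
    have h2 := hfy.add_zsmul_eq (x := t + x.gcdA y • (x * s : ℤ)) (x.gcdB y)
    rw [h1, smul_smul, ← Units.val_mul, ← Int.negOnePow_add, add_comm (x.gcdB y),
      Int.negOnePow_odd _ hodd] at h2
    have ht : t + s = t + x.gcdA y • (x * s : ℤ) + x.gcdB y • (y * s : ℤ) := by
      simp only [smul_eq_mul]
      linear_combination (s : ℤ) * hbez
    rw [ht]
    simpa using h2
  · intro hf
    exact ⟨hf.natCast_mul_of_odd hx, hf.natCast_mul_of_odd hy⟩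

theorem antiperiodicSubmodule_inf_of_not_odd {x y s : ℕ} (hxy : Nat.Coprime x y)
    (h : ¬(Odd x ∧ Odd y)) :
    antiperiodicSubmodule (x * s) ⊓ antiperiodicSubmodule (y * s) = ⊥ := by
  have key {x y : ℕ} (hx : Even x) (hy : Odd y) {f : ℤ → ℚ}
      (hfx : Function.Antiperiodic f (x * s : ℤ)) (hfy : Function.Antiperiodic f (y * s : ℤ)) :
      f = 0 := by
    funext t
    have h1 := hfx.natCast_mul_of_odd hy t
    have h2 := hfy.natCast_mul_of_even hx t
    rw [mul_left_comm] at h2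
    rw [h2] at h1
    simp only [Pi.zero_apply]
    linarith
  rw [eq_bot_iff]
  rintro f ⟨hfx, hfy⟩
  simp only [SetLike.mem_coe, mem_antiperiodicSubmodule, Nat.cast_mul] at hfx hfy
  rw [Submodule.mem_bot]
  rcases Nat.even_or_odd x with hx | hx
  · refine key hx (Nat.not_even_iff_odd.mp fun hy => ?_) hfx hfy
    have := Nat.dvd_gcd hx.two_dvd hy.two_dvd
    rw [hxy.gcd_eq_one] at this
    omega
  · exact key (Nat.not_odd_iff_even.mp fun hy => h ⟨hx, hy⟩) hx hfy hfx

/-- Let `n ≥ r ≥ 1`, `s = gcd(n,r)`, `n = x·s`, `r = y·s`.  The map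
`A ↦ H_n A - A H_r` fails to be invertible iff both `x` and `y` are odd, and its kernel
has dimension `s` in that case and `0` otherwise (so the corank `c_{n,r}` of the defining
matrix `J` of `M̄_q(n,r)` is `s` if `x` and `y` are odd, and `0` otherwise). -/
theorem Jmap_corank (n r x y s : ℕ) (hr : 1 ≤ r) (hrn : r ≤ n)
    (hs : s = Nat.gcd n r) (hx : n = x * s) (hy : r = y * s) :
    (¬ Function.Bijective (Jmap n r) ↔ (Odd x ∧ Odd y)) ∧
      Module.finrank ℚ (LinearMap.ker (Jmap n r)) =
        (if Odd x ∧ Odd y then s else 0) := by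
  have hs0 : 0 < s := hs ▸ Nat.gcd_pos_of_pos_right n hr
  have hcop : Nat.Coprime x y := by
    rw [hx, hy, Nat.gcd_mul_right] at hs
    exact Nat.eq_of_mul_eq_mul_right hs0 (by rw [one_mul]; exact hs.symm)
  have hfin : Module.finrank ℚ (LinearMap.ker (Jmap n r)) =
      if Odd x ∧ Odd y then s else 0 := by
    rw [finrank_ker_Jmap (hr.trans hrn) hr, hx, hy]
    split_ifs with h
    · rw [antiperiodicSubmodule_inf_of_odd hcop h.1 h.2, finrank_antiperiodicSubmodule hs0]
    · rw [antiperiodicSubmodule_inf_of_not_odd hcop h, finrank_bot]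
  refine ⟨?_, hfin⟩
  have hbij : Function.Bijective (Jmap n r) ↔
      Module.finrank ℚ (LinearMap.ker (Jmap n r)) = 0 := by
    rw [Submodule.finrank_eq_zero, LinearMap.ker_eq_bot]
    exact ⟨fun h => h.1, fun h => ⟨h, LinearMap.injective_iff_surjective.mp h⟩⟩
  rw [hbij, hfin]
  split_ifs with h
  · simp [h, hs0.ne']
  · simp [h]
end
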